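/- Let (u, π, v, θ) be a smooth solution of the stationary 3D tropical climate model. Suppose p ∈ [3, 9/2], q ∈ [2p′, 6], r ∈ [2p′, 6] where p′ = p/(p−1), α ∈ [0, 3/p − 2/3], β ∈ [0, 3/q − 1/2], γ ∈ [0, 3/r − 1/2], and the inequalities α + 2β ≤ 3/p + 6/q − 2, α + 2γ ≤ 3/p + 6/r − 2, and β + γ < 3/q + 3/r − 2 hold. Assume there exists a sequence R_j → +∞ such that X_{α,p,R_j} → 0 as j → ∞ and the limits lim_{j→∞} Y_{β,q,R_j} and lim_{j→∞} Z_{γ,r,R_j} exist and are finite. Then u = 0, v = 0 and θ = 0 identically on ℝ³. -/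

import Mathlib

open MeasureTheory Filter Metric

noncomputable section

abbrev R3 : Type := EuclideanSpace ℝ (Fin 3)

/-- Partial derivative of `f` in the `j`-th coordinate direction. -/
def pd (f : R3 → ℝ) (j : Fin 3) (x : R3) : ℝ :=
  fderiv ℝ f x (EuclideanSpace.single j 1)

/-- Laplacian of `f`. -/
def lap (f : R3 → ℝ) (x : R3) : ℝ := ∑ j, pd (pd f j) j x

/-- The stationary 3D tropical climate model:
`-Δu + (u·∇)u + ∇π + div(v⊗v) = 0`, `-Δv + (u·∇)v + ∇θ + (v·∇)u = 0`,
`-Δθ + u·∇θ + div v = 0`, `div u = 0`. -/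
def TCM (u v : R3 → R3) (pr θ : R3 → ℝ) : Prop :=
  (∀ i x, -lap (fun y => u y i) x + (∑ j, u x j * pd (fun y => u y i) j x)
      + pd pr i x + (∑ j, pd (fun y => v y j * v y i) j x) = 0) ∧
  (∀ i x, -lap (fun y => v y i) x + (∑ j, u x j * pd (fun y => v y i) j x)
      + pd θ i x + (∑ j, v x j * pd (fun y => u y i) j x) = 0) ∧
  (∀ x, -lap θ x + (∑ j, u x j * pd θ j x) + (∑ j, pd (fun y => v y j) j x) = 0) ∧
  (∀ x, (∑ j, pd (fun y => u y j) j x) = 0)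

/-- The annulus `B_{2R} \ B_R`. -/
def annulus (R : ℝ) : Set R3 := ball (0 : R3) (2 * R) \ ball 0 R

/-- `L^p` norm of a scalar function on a set `E`. -/
def lpS (g : R3 → ℝ) (p : ℝ) (E : Set R3) : ℝ := (∫ x in E, |g x| ^ p) ^ (1 / p)

/-- `X_{α,p,R} = R^{-α} ‖f‖_{L^p(B_{2R} \ B_R)}` for a vector field `f`. -/
def XnV (f : R3 → R3) (a p R : ℝ) : ℝ := R ^ (-a) * lpS (fun x => ‖f x‖) p (annulus R)

/-- `X_{α,p,R} = R^{-α} ‖f‖_{L^p(B_{2R} \ B_R)}` for a scalar function `f`. -/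
def XnS (f : R3 → ℝ) (a p R : ℝ) : ℝ := R ^ (-a) * lpS f p (annulus R)


abbrev Sm (f : R3 → ℝ) : Prop := ContDiff ℝ (⊤ : ℕ∞) f

lemma Sm.diff {f : R3 → ℝ} (hf : Sm f) : Differentiable ℝ f := hf.differentiable (by simp)
lemma Sm.dat {f : R3 → ℝ} (hf : Sm f) (x : R3) : DifferentiableAt ℝ f x := hf.diff x
lemma Sm.cont {f : R3 → ℝ} (hf : Sm f) : Continuous f := hf.continuous

lemma Sm.pd {f : R3 → ℝ} (hf : Sm f) (j : Fin 3) : Sm (pd f j) := by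
  unfold Sm _root_.pd
  exact (hf.fderiv_right (m := ((⊤ : ℕ∞) : WithTop ℕ∞)) (by simp)).clm_apply contDiff_const

lemma Sm.mul {f g : R3 → ℝ} (hf : Sm f) (hg : Sm g) : Sm (fun x => f x * g x) := ContDiff.mul hf hg
lemma Sm.add {f g : R3 → ℝ} (hf : Sm f) (hg : Sm g) : Sm (fun x => f x + g x) := ContDiff.add hf hg
lemma Sm.sub {f g : R3 → ℝ} (hf : Sm f) (hg : Sm g) : Sm (fun x => f x - g x) := ContDiff.sub hf hg
lemma Sm.cmul {f : R3 → ℝ} (c : ℝ) (hf : Sm f) : Sm (fun x => c * f x) := contDiff_const.mul hf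
lemma Sm.sum {ι : Type*} {s : Finset ι} {f : ι → R3 → ℝ} (hf : ∀ i ∈ s, Sm (f i)) :
    Sm (fun x => ∑ i ∈ s, f i x) := ContDiff.sum hf
lemma Sm.lap {f : R3 → ℝ} (hf : Sm f) : Sm (lap f) := by
  unfold _root_.lap
  exact Sm.sum fun j _ => (hf.pd j).pd j

lemma pd_mul {f g : R3 → ℝ} (hf : Sm f) (hg : Sm g) (j : Fin 3) (x : R3) :
    pd (fun y => f y * g y) j x = pd f j x * g x + f x * pd g j x := by
  unfold pd
  rw [fderiv_fun_mul (hf.dat x) (hg.dat x)]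
  simp; ring
lemma pd_add {f g : R3 → ℝ} (hf : Sm f) (hg : Sm g) (j : Fin 3) (x : R3) :
    pd (fun y => f y + g y) j x = pd f j x + pd g j x := by
  unfold pd
  rw [fderiv_fun_add (hf.dat x) (hg.dat x)]; simp
lemma pd_sub {f g : R3 → ℝ} (hf : Sm f) (hg : Sm g) (j : Fin 3) (x : R3) :
    pd (fun y => f y - g y) j x = pd f j x - pd g j x := by
  unfold pd
  rw [fderiv_fun_sub (hf.dat x) (hg.dat x)]; simp
lemma pd_cmul {f : R3 → ℝ} (c : ℝ) (hf : Sm f) (j : Fin 3) (x : R3) :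
    pd (fun y => c * f y) j x = c * pd f j x := by
  unfold pd
  rw [fderiv_const_mul (hf.dat x)]; simp
lemma pd_sum {ι : Type*} {s : Finset ι} {f : ι → R3 → ℝ} (hf : ∀ i ∈ s, Sm (f i)) (j : Fin 3) (x : R3) :
    pd (fun y => ∑ i ∈ s, f i y) j x = ∑ i ∈ s, pd (f i) j x := by
  unfold pd
  rw [fderiv_fun_sum (fun i hi => (hf i hi).dat x)]; simp
lemma pd_const (c : ℝ) (j : Fin 3) (x : R3) : pd (fun _ => c) j x = 0 := by
  unfold pd; simp

lemma pd_comm {f : R3 → ℝ} (hf : Sm f) (i j : Fin 3) (x : R3) :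
    pd (pd f i) j x = pd (pd f j) i x := by
  have h2 : ∀ k l, pd (pd f k) l x
      = fderiv ℝ (fderiv ℝ f) x (EuclideanSpace.single l 1) (EuclideanSpace.single k 1) := by
    intro k l
    have hd : DifferentiableAt ℝ (fderiv ℝ f) x :=
      ((hf.fderiv_right (m := ((⊤ : ℕ∞) : WithTop ℕ∞)) (by simp)).differentiable (by simp)) x
    unfold pd
    rw [fderiv_clm_apply hd (differentiableAt_const _)]
    simp
  rw [h2, h2]
  exact (hf.contDiffAt.isSymmSndFDerivAt (by simp only [minSmoothness_of_isRCLikeNormedField]; exact WithTop.coe_le_coe.2 le_top)) _ _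

lemma cs_pd {f : R3 → ℝ} (hf : HasCompactSupport f) (j : Fin 3) : HasCompactSupport (pd f j) := by
  unfold pd
  exact hf.fderiv_apply (𝕜 := ℝ) _

lemma tsupport_pd (f : R3 → ℝ) (j : Fin 3) : tsupport (pd f j) ⊆ tsupport f := by
  unfold pd
  exact tsupport_fderiv_apply_subset ℝ _

lemma cs_int {f : R3 → ℝ} (hf : Continuous f) (hc : HasCompactSupport f) : Integrable f :=
  hf.integrable_of_hasCompactSupport hc

lemma int_pd {f : R3 → ℝ} (hf : Sm f) (hc : HasCompactSupport f) (j : Fin 3) :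
    ∫ x, pd f j x = 0 := by
  have := integral_mul_fderiv_eq_neg_fderiv_mul_of_integrable (𝕜 := ℝ) (f := fun _ : R3 => (1:ℝ)) (g := f)
    (v := EuclideanSpace.single j 1) (μ := volume) ?_ ?_ ?_ ?_ ?_
  · simpa [pd] using this
  · simp
  · have h := cs_int (hf.pd j).cont (cs_pd hc j)
    unfold pd at h
    simpa using h
  · simpa using cs_int hf.cont hc
  · simp
  · intro x _; exact hf.dat x

lemma int_div {F : Fin 3 → R3 → ℝ} (hf : ∀ j, Sm (F j)) (hc : ∀ j, HasCompactSupport (F j)) :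
    ∫ x, ∑ j, pd (F j) j x = 0 := by
  rw [integral_finsetSum]
  · simp [int_pd (hf _) (hc _)]
  · intro j _; exact cs_int ((hf j).pd j).cont (cs_pd (hc j) j)


section avg
variable {Ω : Type} [MeasurableSpace Ω] (μ : Measure Ω) (k : Ω → ℝ) (T : Ω → R3)

def avgE {E : Type} [NormedAddCommGroup E] [NormedSpace ℝ E] (f : R3 → E) (x : R3) : E :=
  ∫ ω, k ω • f (x + T ω) ∂μ

def avg (f : R3 → ℝ) (x : R3) : ℝ := ∫ ω, k ω * f (x + T ω) ∂μ

variable {μ k T}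

lemma avgE_integrable {E : Type} [NormedAddCommGroup E] [NormedSpace ℝ E] {f : R3 → E}
    (hk : Integrable k μ) (hT : AEMeasurable T μ) (hf : Continuous f) {C : ℝ} (hC : ∀ x, ‖f x‖ ≤ C) (x : R3) :
    Integrable (fun ω => k ω • f (x + T ω)) μ := by
  refine Integrable.mono' (g := fun ω => ‖k ω‖ * C) (hk.norm.mul_const C) ?_ ?_
  · refine hk.aestronglyMeasurable.smul ?_
    exact (hf.comp (continuous_const.add continuous_id)).comp_aestronglyMeasurable hT.aestronglyMeasurable
  · refine ae_of_all _ fun ω => ?_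
    rw [norm_smul]
    exact mul_le_mul_of_nonneg_left (hC _) (norm_nonneg _)

lemma cs_bdd {E : Type} [NormedAddCommGroup E] {f : R3 → E} (hf : Continuous f)
    (hc : HasCompactSupport f) : ∃ C, 0 ≤ C ∧ ∀ x, ‖f x‖ ≤ C := by
  obtain ⟨C, hC⟩ := hc.exists_bound_of_continuous hf
  exact ⟨C, (norm_nonneg _).trans (hC 0), hC⟩

lemma avgE_hasFDerivAt {E : Type} [NormedAddCommGroup E] [NormedSpace ℝ E] {f : R3 → E}
    (hk : Integrable k μ) (hT : AEMeasurable T μ) (hf : ContDiff ℝ 1 f)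
    (hc : HasCompactSupport f) (x : R3) :
    HasFDerivAt (avgE μ k T f) (avgE μ k T (fderiv ℝ f) x) x := by
  obtain ⟨C, _, hC⟩ := cs_bdd hf.continuous hc
  have hf' : Continuous (fderiv ℝ f) := hf.continuous_fderiv (by simp)
  obtain ⟨C', _, hC'⟩ := cs_bdd hf' (hc.fderiv (𝕜 := ℝ))
  refine hasFDerivAt_integral_of_dominated_of_fderiv_le (s := Set.univ) (bound := fun ω => ‖k ω‖ * C')
    (F' := fun x ω => k ω • fderiv ℝ f (x + T ω)) Filter.univ_mem
    ?_ (avgE_integrable hk hT hf.continuous hC x) (avgE_integrable hk hT hf' hC' x).aestronglyMeasurable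
    ?_ (hk.norm.mul_const _) ?_
  · exact Eventually.of_forall fun y => (avgE_integrable hk hT hf.continuous hC y).aestronglyMeasurable
  · refine ae_of_all _ fun ω y _ => ?_
    rw [norm_smul]
    exact mul_le_mul_of_nonneg_left (hC' _) (norm_nonneg _)
  · refine ae_of_all _ fun ω y _ => ?_
    refine HasFDerivAt.const_smul ?_ _
    have h := ((hf.differentiable (by simp)) (y + T ω)).hasFDerivAt
    exact (hasFDerivAt_comp_add_right (T ω)).2 h

lemma avgE_contDiff (hk : Integrable k μ) (hT : AEMeasurable T μ) (n : ℕ) :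
    ∀ {E : Type} [NormedAddCommGroup E] [NormedSpace ℝ E] {f : R3 → E},
    ContDiff ℝ (⊤ : ℕ∞) f → HasCompactSupport f → ContDiff ℝ n (avgE μ k T f) := by
  induction n with
  | zero =>
    intro E _ _ f hf hc
    have hf1 : ContDiff ℝ 1 f := hf.of_le (by exact_mod_cast le_top)
    have : Differentiable ℝ (avgE μ k T f) := fun x => (avgE_hasFDerivAt hk hT hf1 hc x).differentiableAt
    simpa [contDiff_zero] using this.continuous
  | succ n ih =>
    intro E _ _ f hf hc
    have hf1 : ContDiff ℝ 1 f := hf.of_le (by exact_mod_cast le_top)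
    push_cast
    rw [contDiff_succ_iff_fderiv]
    refine ⟨fun x => (avgE_hasFDerivAt hk hT hf1 hc x).differentiableAt, by simp, ?_⟩
    have : fderiv ℝ (avgE μ k T f) = avgE μ k T (fderiv ℝ f) :=
      funext fun x => (avgE_hasFDerivAt hk hT hf1 hc x).fderiv
    rw [this]
    exact ih (hf.fderiv_right (by simp)) (hc.fderiv (𝕜 := ℝ))

lemma avg_eq (f : R3 → ℝ) : avg μ k T f = avgE μ k T f := rfl

lemma avg_int {f : R3 → ℝ} (hk : Integrable k μ) (hT : AEMeasurable T μ) (hf : Continuous f) (hc : HasCompactSupport f) (x : R3) :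
    Integrable (fun ω => k ω * f (x + T ω)) μ := by
  obtain ⟨C, _, hC⟩ := cs_bdd hf hc
  exact avgE_integrable hk hT hf hC x

lemma avg_sm {f : R3 → ℝ} (hk : Integrable k μ) (hT : AEMeasurable T μ) (hf : Sm f) (hc : HasCompactSupport f) :
    Sm (avg μ k T f) := by
  rw [avg_eq]
  exact contDiff_infty.2 fun n => avgE_contDiff hk hT n hf hc

lemma avg_pd {f : R3 → ℝ} (hk : Integrable k μ) (hT : AEMeasurable T μ) (hf : Sm f) (hc : HasCompactSupport f)
    (j : Fin 3) : pd (avg μ k T f) j = avg μ k T (pd f j) := by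
  funext x
  have hf1 : ContDiff ℝ 1 f := hf.of_le (by exact_mod_cast le_top)
  unfold pd
  rw [avg_eq, (avgE_hasFDerivAt hk hT hf1 hc x).fderiv]
  unfold avg avgE
  obtain ⟨C', _, hC'⟩ := cs_bdd (hf1.continuous_fderiv (by simp)) (hc.fderiv (𝕜 := ℝ))
  rw [ContinuousLinearMap.integral_apply (avgE_integrable hk hT (hf1.continuous_fderiv (by simp)) hC' x)]
  rfl

lemma avg_bdd {f : R3 → ℝ} (hk : Integrable k μ) {C : ℝ} (hC : ∀ x, |f x| ≤ C) (x : R3) :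
    |avg μ k T f x| ≤ (∫ ω, |k ω| ∂μ) * C := by
  unfold avg
  rw [← integral_mul_const, ← Real.norm_eq_abs]
  refine norm_integral_le_of_norm_le (hk.abs.mul_const _) (ae_of_all _ fun ω => ?_)
  rw [norm_mul]
  exact mul_le_mul_of_nonneg_left (hC _) (abs_nonneg _)

lemma avg_add {f g : R3 → ℝ} (hk : Integrable k μ) (hT : AEMeasurable T μ) (hf : Continuous f) (hc : HasCompactSupport f)
    (hg : Continuous g) (hcg : HasCompactSupport g) (x : R3) :
    avg μ k T (fun y => f y + g y) x = avg μ k T f x + avg μ k T g x := by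
  unfold avg
  rw [← integral_add (avg_int hk hT hf hc x) (avg_int hk hT hg hcg x)]
  simp [mul_add]

lemma avg_sum {ι : Type*} {s : Finset ι} {f : ι → R3 → ℝ} (hk : Integrable k μ) (hT : AEMeasurable T μ)
    (hf : ∀ i, Continuous (f i)) (hc : ∀ i, HasCompactSupport (f i)) (x : R3) :
    avg μ k T (fun y => ∑ i ∈ s, f i y) x = ∑ i ∈ s, avg μ k T (f i) x := by
  unfold avg
  rw [← integral_finsetSum _ (fun i _ => avg_int hk hT (hf i) (hc i) x)]
  simp [Finset.mul_sum]

lemma avg_lap {f : R3 → ℝ} (hk : Integrable k μ) (hT : AEMeasurable T μ) (hf : Sm f) (hc : HasCompactSupport f) :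
    lap (avg μ k T f) = avg μ k T (lap f) := by
  funext x
  unfold lap
  rw [avg_sum hk hT (fun j => ((hf.pd j).pd j).cont) (fun j => cs_pd (cs_pd hc j) j)]
  refine Finset.sum_congr rfl fun j _ => ?_
  rw [avg_pd hk hT hf hc, avg_pd hk hT (hf.pd j) (cs_pd hc j)]

lemma cs_lap {f : R3 → ℝ} (hc : HasCompactSupport f) : HasCompactSupport (lap f) := by
  have : lap f = fun x => pd (pd f 0) 0 x + pd (pd f 1) 1 x + pd (pd f 2) 2 x := by
    funext x; simp [lap, Fin.sum_univ_three]
  rw [this]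
  exact ((cs_pd (cs_pd hc 0) 0).add (cs_pd (cs_pd hc 1) 1)).add (cs_pd (cs_pd hc 2) 2)

/-- L1 bound (absolute values), translation average. -/
lemma avg_L1 [SFinite μ] {f : R3 → ℝ} (hk : Integrable k μ) (hT : Measurable T) (hf : Integrable f) :
    Integrable (avg μ k T f) ∧ ∫ x, |avg μ k T f x| ≤ (∫ ω, |k ω| ∂μ) * ∫ x, |f x| := by
  -- joint integrability
  have hmp : MeasurePreserving (fun z : Ω × R3 => (z.1, z.2 + T z.1)) (μ.prod volume) (μ.prod volume) := by
    refine MeasurePreserving.skew_product (g := fun ω x => x + T ω) (MeasurePreserving.id μ) ?_ ?_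
    · exact measurable_snd.add (hT.comp measurable_fst)
    · exact ae_of_all _ fun ω => (measurePreserving_add_right volume (T ω)).map_eq
  have hj0 : Integrable (fun z : Ω × R3 => k z.1 * f z.2) (μ.prod volume) := hk.mul_prod hf
  have hj : Integrable (fun z : Ω × R3 => k z.1 * f (z.2 + T z.1)) (μ.prod volume) := by
    have := hmp.integrable_comp_of_integrable hj0
    exact this
  refine ⟨hj.integral_prod_right, ?_⟩
  have h1 : ∀ x, |avg μ k T f x| ≤ ∫ ω, |k ω * f (x + T ω)| ∂μ := fun x => abs_integral_le_integral_abs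
  have hja := hj.abs
  calc ∫ x, |avg μ k T f x| ≤ ∫ x, (∫ ω, |k ω * f (x + T ω)| ∂μ) := by
        refine integral_mono hj.integral_prod_right.abs hja.integral_prod_right h1
    _ = ∫ ω, (∫ x : R3, |k ω * f (x + T ω)|) ∂μ := by
        exact (integral_integral_swap (f := fun ω x => |k ω * f (x + T ω)|) hja).symm
    _ = ∫ ω, (|k ω| * ∫ x : R3, |f x|) ∂μ := by
        congr 1; funext ω
        simp_rw [abs_mul]
        rw [integral_const_mul, integral_add_right_eq_self (fun x => |f x|)]
    _ = _ := by rw [integral_mul_const]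
end avg


lemma fderiv_eq_sum (f : R3 → ℝ) (y z : R3) : fderiv ℝ f y z = ∑ j, z j * pd f j y := by
  have hz : z = ∑ j, z j • (EuclideanSpace.single j (1:ℝ) : R3) := by
    ext i
    simp [Finset.sum_apply, Pi.single_apply]
  conv_lhs => rw [hz]
  simp [pd]

lemma hasFDerivAt_aff (g : R3 → ℝ) (hg : Sm g) (x : R3) (s : ℝ) (z : R3) :
    HasFDerivAt (fun z => g (x + s • z)) (s • fderiv ℝ g (x + s • z)) z := by
  have h1 : HasFDerivAt (fun z : R3 => x + s • z) (s • ContinuousLinearMap.id ℝ R3) z :=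
    ((hasFDerivAt_id z).const_smul s).const_add x
  have h2 := (hg.dat (x + s • z)).hasFDerivAt.comp z h1
  refine h2.congr_fderiv ?_
  ext w
  simp

lemma pd_aff (g : R3 → ℝ) (hg : Sm g) (x : R3) (s : ℝ) (j : Fin 3) (z : R3) :
    pd (fun z => g (x + s • z)) j z = s * pd g j (x + s • z) := by
  unfold pd
  rw [(hasFDerivAt_aff g hg x s z).fderiv]
  simp

lemma sm_aff {g : R3 → ℝ} (hg : Sm g) (x : R3) (s : ℝ) : Sm (fun z => g (x + s • z)) :=
  hg.comp (f := fun z : R3 => x + s • z) (by fun_prop)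

/-- averaging at scale `s` against a kernel -/
def rad (η : R3 → ℝ) (s : ℝ) (f : R3 → ℝ) (x : R3) : ℝ := avg volume η (fun z => s • z) f x

lemma meas_sm (s : ℝ) : Measurable (fun z : R3 => s • z) := measurable_const_smul s

structure RadK (η ζ : R3 → ℝ) : Prop where
  hη : Integrable η
  hη1 : Integrable (fun z => ‖z‖ * η z)
  hζ : Integrable ζ
  sζ : Sm ζ
  cη : Continuous η
  hd : ∀ j z, pd ζ j z = - (z j * η z)

lemma int_mul_bdd {η g : R3 → ℝ} (hη : Integrable η) (hg : Continuous g) {C : ℝ} (hC : ∀ x, |g x| ≤ C) :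
    Integrable (fun z => η z * g z) := by
  refine Integrable.mul_bdd hη hg.aestronglyMeasurable (c := C) ?_
  exact ae_of_all _ fun x => hC x

lemma rad_deriv {η ζ : R3 → ℝ} (H : RadK η ζ) {f : R3 → ℝ} (hf : Sm f) (hc : HasCompactSupport f) (x : R3) (s : ℝ) :
    HasDerivAt (fun s => rad η s f x) (s * rad ζ s (lap f) x) s := by
  have hf' : Continuous (fderiv ℝ f) := hf.continuous_fderiv (by simp)
  obtain ⟨C, _, hC⟩ := cs_bdd hf.cont hc
  obtain ⟨C', hC0, hC'⟩ := cs_bdd hf' (hc.fderiv (𝕜 := ℝ))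
  have hcoord : ∀ j (z : R3), |z j| ≤ ‖z‖ := fun j z => PiLp.norm_apply_le z j
  have key := hasDerivAt_integral_of_dominated_loc_of_deriv_le (μ := (volume : Measure R3)) (s := Set.univ) (x₀ := s)
    (F := fun s z => η z * f (x + s • z)) (F' := fun s z => η z * fderiv ℝ f (x + s • z) z)
    (bound := fun z => ‖‖z‖ * η z‖ * C') Filter.univ_mem
    (Eventually.of_forall fun t => (avg_int H.hη (meas_sm t).aemeasurable hf.cont hc x).aestronglyMeasurable)
    (avg_int H.hη (meas_sm s).aemeasurable hf.cont hc x)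
    ?_ ?_ (H.hη1.norm.mul_const _) ?_
  · have h2 := key.2
    refine h2.congr_deriv ?_
    symm
    unfold rad avg
    have hint : ∀ j, Integrable (fun z : R3 => (z j * η z) * pd f j (x + s • z)) := by
      intro j
      obtain ⟨D, _, hD⟩ := cs_bdd (hf.pd j).cont (cs_pd hc j)
      refine int_mul_bdd (η := fun z : R3 => z j * η z) ?_ (sm_aff (hf.pd j) x s).cont fun z => hD _
      refine H.hη1.mono ?_ (ae_of_all _ fun z => ?_)
      · exact (Continuous.mul (by fun_prop) H.cη).aestronglyMeasurable
      · simp only [norm_mul, norm_norm]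
        exact mul_le_mul_of_nonneg_right (hcoord j z) (norm_nonneg _)
    have e1 : ∀ z : R3, η z * fderiv ℝ f (x + s • z) z = ∑ j, (z j * η z) * pd f j (x + s • z) := by
      intro z
      rw [fderiv_eq_sum, Finset.mul_sum]
      exact Finset.sum_congr rfl fun j _ => by ring
    simp_rw [e1]
    rw [integral_finsetSum _ fun j _ => hint j]
    have hint2 : ∀ j, Integrable (fun z : R3 => ζ z * pd (pd f j) j (x + s • z)) := by
      intro j
      exact avg_int H.hζ (meas_sm s).aemeasurable ((hf.pd j).pd j).cont (cs_pd (cs_pd hc j) j) x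
    have e2 : ∀ j, ∫ z : R3, (z j * η z) * pd f j (x + s • z) = s * ∫ z : R3, ζ z * pd (pd f j) j (x + s • z) := by
      intro j
      have hibp := integral_mul_fderiv_eq_neg_fderiv_mul_of_integrable (𝕜 := ℝ) (f := ζ)
        (g := fun z => pd f j (x + s • z)) (v := EuclideanSpace.single j 1) (μ := volume) ?_ ?_ ?_ ?_ ?_
      · change ∫ z, ζ z * pd (fun z => pd f j (x + s • z)) j z = - ∫ z, pd ζ j z * pd f j (x + s • z) at hibp
        simp_rw [pd_aff _ (hf.pd j), H.hd] at hibp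
        rw [← integral_const_mul]
        rw [← integral_neg] at hibp
        calc _ = ∫ z : R3, -(-(z j * η z) * pd f j (x + s • z)) :=
              integral_congr_ae (ae_of_all _ fun z => by ring)
          _ = _ := hibp.symm
          _ = _ := integral_congr_ae (ae_of_all _ fun z => by ring)
      · change Integrable fun z => pd ζ j z * pd f j (x + s • z)
        simp_rw [H.hd]
        simpa using (hint j).neg
      · change Integrable fun z => ζ z * pd (fun z => pd f j (x + s • z)) j z
        simp_rw [pd_aff _ (hf.pd j)]
        have := (hint2 j).const_mul s
        refine this.congr (ae_of_all _ fun z => by ring)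
      · obtain ⟨D, _, hD⟩ := cs_bdd (hf.pd j).cont (cs_pd hc j)
        exact int_mul_bdd H.hζ (sm_aff (hf.pd j) x s).cont fun z => hD _
      · intro z _; exact H.sζ.dat z
      · intro z _; exact (sm_aff (hf.pd j) x s).dat z
    simp_rw [e2]
    rw [← Finset.mul_sum, ← integral_finsetSum _ fun j _ => hint2 j]
    congr 2
    funext z
    rw [lap, Finset.mul_sum]
  · refine (H.cη.mul ?_).aestronglyMeasurable
    have : Continuous fun z : R3 => fderiv ℝ f (x + s • z) := hf'.comp (by fun_prop)
    exact this.clm_apply continuous_id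
  · refine ae_of_all _ fun z t _ => ?_
    have := (fderiv ℝ f (x + t • z)).le_opNorm z
    simp only [norm_mul, norm_norm]
    calc ‖η z‖ * ‖fderiv ℝ f (x + t • z) z‖ ≤ ‖η z‖ * (C' * ‖z‖) := by
          refine mul_le_mul_of_nonneg_left (this.trans ?_) (norm_nonneg _)
          exact mul_le_mul_of_nonneg_right (hC' _) (norm_nonneg _)
      _ = _ := by ring
  · refine ae_of_all _ fun z t _ => ?_
    refine HasDerivAt.const_mul _ ?_
    have h1 : HasDerivAt (fun t : ℝ => x + t • z) z t := by
      simpa using ((hasDerivAt_id t).smul_const z).const_add x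
    exact (hf.dat (x + t • z)).hasFDerivAt.comp_hasDerivAt t h1

lemma rad_cont {η : R3 → ℝ} (hη : Integrable η) {f : R3 → ℝ} (hf : Continuous f) (hc : HasCompactSupport f) :
    Continuous (fun w : ℝ × R3 => rad η w.1 f w.2) := by
  obtain ⟨C, _, hC⟩ := cs_bdd hf hc
  unfold rad avg
  refine continuous_of_dominated (bound := fun z => ‖η z‖ * C) ?_ ?_ (hη.norm.mul_const _) ?_
  · intro w
    exact (avg_int hη (meas_sm w.1).aemeasurable hf hc w.2).aestronglyMeasurable
  · intro w
    refine ae_of_all _ fun z => ?_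
    rw [norm_mul]
    exact mul_le_mul_of_nonneg_left (hC _) (norm_nonneg _)
  · refine ae_of_all _ fun z => ?_
    have : Continuous fun w : ℝ × R3 => f (w.2 + w.1 • z) := hf.comp (by fun_prop)
    exact continuous_const.mul this

lemma rad_sm {η : R3 → ℝ} (hη : Integrable η) {f : R3 → ℝ} (hf : Sm f) (hc : HasCompactSupport f) (s : ℝ) :
    Sm (rad η s f) := avg_sm hη (meas_sm s).aemeasurable hf hc
lemma rad_pd {η : R3 → ℝ} (hη : Integrable η) {f : R3 → ℝ} (hf : Sm f) (hc : HasCompactSupport f) (s : ℝ) (j : Fin 3) :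
    pd (rad η s f) j = rad η s (pd f j) := avg_pd hη (meas_sm s).aemeasurable hf hc j
lemma rad_lap {η : R3 → ℝ} (hη : Integrable η) {f : R3 → ℝ} (hf : Sm f) (hc : HasCompactSupport f) (s : ℝ) :
    lap (rad η s f) = rad η s (lap f) := avg_lap hη (meas_sm s).aemeasurable hf hc
lemma rad_zero {η : R3 → ℝ} (h1 : ∫ z, η z = 1) (f : R3 → ℝ) (x : R3) : rad η 0 f x = f x := by
  simp [rad, avg, integral_mul_const, h1]


lemma gauss_int {b : ℝ} (hb : 0 < b) : Integrable (fun z : R3 => Real.exp (-b * ‖z‖ ^ 2)) := by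
  have h := GaussianFourier.integrable_cexp_neg_mul_sq_norm_add (V := R3) (b := (b : ℂ)) (by simpa using hb) 0 0
  have h2 := h.re
  refine h2.congr (ae_of_all _ fun z => ?_)
  simp only [zero_mul, add_zero]
  rw [← Complex.ofReal_neg, ← Complex.ofReal_pow, ← Complex.ofReal_mul, ← Complex.ofReal_exp]
  exact Complex.ofReal_re _

def gau0 (z : R3) : ℝ := Real.exp (-(1/2) * ‖z‖ ^ 2)

lemma gau0_int : Integrable gau0 := gauss_int (by norm_num)
lemma gau0_pos (z : R3) : 0 < gau0 z := Real.exp_pos _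
lemma gau0_sm : Sm gau0 := by
  unfold gau0
  exact Real.contDiff_exp.comp (contDiff_const.mul (contDiff_norm_sq ℝ))
lemma gau0_ipos : 0 < ∫ z, gau0 z := by
  refine (integral_pos_iff_support_of_nonneg (fun z => (gau0_pos z).le) gau0_int).2 ?_
  have : Function.support gau0 = Set.univ := by
    ext z; simp [(gau0_pos z).ne']
  rw [this]; simp

lemma pd_normsq (j : Fin 3) (z : R3) : HasFDerivAt (fun z : R3 => ‖z‖ ^ 2) (2 • (innerSL ℝ z)) z := by
  exact (hasStrictFDerivAt_norm_sq z).hasFDerivAt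

lemma innerSL_single (j : Fin 3) (z : R3) : innerSL ℝ z (EuclideanSpace.single j 1) = z j := by
  simp [innerSL_apply_apply, EuclideanSpace.inner_single_right]

lemma gau0_pd (j : Fin 3) (z : R3) : pd gau0 j z = - (z j * gau0 z) := by
  have h : HasFDerivAt gau0 (Real.exp (-(1/2) * ‖z‖ ^ 2) • ((-(1/2) : ℝ) • (2 • (innerSL ℝ z)))) z :=
    ((pd_normsq j z).const_mul _).exp
  unfold pd
  rw [h.fderiv]
  simp [innerSL_single, gau0]
  ring

lemma gau0_int1 : Integrable (fun z => ‖z‖ * gau0 z) := by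
  refine Integrable.mono' (g := fun z : R3 => 2 * Real.exp (-(1/4) * ‖z‖ ^ 2)) ((gauss_int (by norm_num)).const_mul _) ?_ ?_
  · exact (continuous_norm.mul gau0_sm.cont).aestronglyMeasurable
  · refine ae_of_all _ fun z => ?_
    have h1 : ‖z‖ ≤ 2 * Real.exp ((1/4) * ‖z‖ ^ 2) := by
      have := Real.add_one_le_exp ((1/4) * ‖z‖ ^ 2)
      nlinarith [sq_nonneg (‖z‖ - 1)]
    have h2 : gau0 z = Real.exp (-(1/4) * ‖z‖ ^ 2) * Real.exp (-(1/4) * ‖z‖ ^ 2) := by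
      rw [← Real.exp_add, gau0]; congr 1; ring
    have h3 : Real.exp ((1/4) * ‖z‖ ^ 2) * Real.exp (-(1/4) * ‖z‖ ^ 2) = 1 := by
      rw [← Real.exp_add]; simp
    rw [norm_mul, norm_norm, Real.norm_of_nonneg (gau0_pos z).le, h2]
    have hp := Real.exp_pos (-(1/4) * ‖z‖ ^ 2)
    calc ‖z‖ * (Real.exp (-(1/4) * ‖z‖ ^ 2) * Real.exp (-(1/4) * ‖z‖ ^ 2))
        ≤ (2 * Real.exp ((1/4) * ‖z‖ ^ 2)) * (Real.exp (-(1/4) * ‖z‖ ^ 2) * Real.exp (-(1/4) * ‖z‖ ^ 2)) := by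
          gcongr
      _ = 2 * (Real.exp ((1/4) * ‖z‖ ^ 2) * Real.exp (-(1/4) * ‖z‖ ^ 2)) * Real.exp (-(1/4) * ‖z‖ ^ 2) := by ring
      _ = _ := by rw [h3]; ring

def gam (z : R3) : ℝ := (∫ z, gau0 z)⁻¹ * gau0 z

lemma gam_pos (z : R3) : 0 < gam z := mul_pos (inv_pos.2 gau0_ipos) (gau0_pos z)
lemma gam_one : ∫ z, gam z = 1 := by
  unfold gam
  rw [integral_const_mul, inv_mul_cancel₀ gau0_ipos.ne']
lemma gam_abs : ∫ z, |gam z| = 1 := by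
  simp_rw [abs_of_pos (gam_pos _), gam_one]
lemma gam_bdd (z : R3) : |gam z| ≤ (∫ z, gau0 z)⁻¹ := by
  rw [abs_of_pos (gam_pos z)]
  unfold gam
  refine mul_le_of_le_one_right (inv_pos.2 gau0_ipos).le ?_
  unfold gau0
  rw [Real.exp_le_one_iff]
  nlinarith [sq_nonneg ‖z‖]

lemma gam_radK : RadK gam gam where
  hη := gau0_int.const_mul _
  hη1 := (gau0_int1.const_mul (∫ z, gau0 z)⁻¹).congr (ae_of_all _ fun z => by simp only [gam]; ring)
  hζ := gau0_int.const_mul _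
  sζ := gau0_sm.cmul _
  cη := (gau0_sm.cmul _).cont
  hd := by
    intro j z
    unfold gam
    rw [pd_cmul _ gau0_sm, gau0_pd]; ring

lemma int_aff (g : R3 → ℝ) (x : R3) {s : ℝ} (hs : 0 < s) :
    ∫ z, g (x + s • z) = (s ^ 3)⁻¹ * ∫ z, g z := by
  have := Measure.integral_comp_smul (volume : Measure R3) (fun z => g (x + z)) s
  rw [this]
  rw [integral_add_left_eq_self (fun z => g z)]
  simp only [finrank_euclideanSpace, Fintype.card_fin, smul_eq_mul]
  rw [abs_of_pos (by positivity)]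

lemma gam_decay {f : R3 → ℝ} (hf : Continuous f) (hc : HasCompactSupport f) {s : ℝ} (hs : 0 < s) (x : R3) :
    |rad gam s f x| ≤ (∫ z, gau0 z)⁻¹ * ((s ^ 3)⁻¹ * ∫ z, |f z|) := by
  have hfi : Integrable (fun z => |f (x + s • z)|) := by
    have h : Integrable (fun z => f (x + z)) := (cs_int hf hc).comp_add_left x
    exact (h.comp_smul hs.ne').abs
  rw [← int_aff (fun z => |f z|) x hs, ← integral_const_mul, ← Real.norm_eq_abs]
  unfold rad avg
  refine norm_integral_le_of_norm_le (hfi.const_mul _) (ae_of_all _ fun z => ?_)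
  rw [norm_mul]
  exact mul_le_mul_of_nonneg_right (gam_bdd z) (norm_nonneg _)


section bell
variable (P Q K : ℝ)

def bZ (X Y : ℝ) : ℝ := X ^ P + Y ^ Q
def bB (X Y : ℝ) : ℝ := K * Y ^ Q + X * bZ P Q X Y ^ (1 - 1/P)
def bX (X Y : ℝ) : ℝ := bZ P Q X Y ^ (1 - 1/P) + (P - 1) * X ^ P * bZ P Q X Y ^ (-1/P)
def bY (X Y : ℝ) : ℝ := K * Q * Y ^ (Q - 1) + (1 - 1/P) * Q * X * bZ P Q X Y ^ (-1/P) * Y ^ (Q - 1)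
def bXX (X Y : ℝ) : ℝ := (P - 1) * X ^ (P - 1) * bZ P Q X Y ^ (-1 - 1/P) * ((1 + P) * bZ P Q X Y - X ^ P)
def bXY (X Y : ℝ) : ℝ := (1 - 1/P) * Q * Y ^ (Q - 1) * Y ^ Q * bZ P Q X Y ^ (-1 - 1/P)
def bYY (X Y : ℝ) : ℝ := K * Q * (Q - 1) * Y ^ (Q - 2)
  + (1 - 1/P) * Q * X * (-(1/P) * Q * bZ P Q X Y ^ (-1 - 1/P) * (Y ^ (Q - 1)) ^ 2
      + (Q - 1) * bZ P Q X Y ^ (-1/P) * Y ^ (Q - 2))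

variable {P Q K}

lemma rp_succ {X : ℝ} (hX : 0 < X) (e : ℝ) : X ^ e = X * X ^ (e - 1) := by
  rw [Real.rpow_sub_one hX.ne']; field_simp

lemma bZ_pos {X Y : ℝ} (hX : 0 < X) (hY : 0 < Y) : 0 < bZ P Q X Y := by
  unfold bZ; positivity

lemma bZ_deriv {X Y : ℝ → ℝ} {X' Y' r : ℝ} (hX : HasDerivAt X X' r) (hY : HasDerivAt Y Y' r)
    (pX : 0 < X r) (pY : 0 < Y r) :
    HasDerivAt (fun r => bZ P Q (X r) (Y r)) (P * X r ^ (P - 1) * X' + Q * Y r ^ (Q - 1) * Y') r := by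
  unfold bZ
  refine ((hX.rpow_const (p := P) (Or.inl pX.ne')).add (hY.rpow_const (p := Q) (Or.inl pY.ne'))).congr_deriv ?_
  ring

lemma bB_deriv (hP : 1 < P) {X Y : ℝ → ℝ} {X' Y' r : ℝ} (hX : HasDerivAt X X' r) (hY : HasDerivAt Y Y' r)
    (pX : 0 < X r) (pY : 0 < Y r) :
    HasDerivAt (fun r => bB P Q K (X r) (Y r)) (bX P Q (X r) (Y r) * X' + bY P Q K (X r) (Y r) * Y') r := by
  have hZ := bZ_deriv (P := P) (Q := Q) hX hY pX pY
  have pZ := bZ_pos (P := P) (Q := Q) pX pY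
  unfold bB
  refine (((hY.rpow_const (p := Q) (Or.inl pY.ne')).const_mul K).add
    (hX.mul (hZ.rpow_const (p := 1 - 1/P) (Or.inl pZ.ne')))).congr_deriv ?_
  unfold bX bY
  rw [show (1 - 1/P - 1) = -1/P by ring, rp_succ pX P]
  have hP0 : P ≠ 0 := by linarith
  field_simp
  ring

lemma bX_deriv (hP : 1 < P) {X Y : ℝ → ℝ} {X' Y' r : ℝ} (hX : HasDerivAt X X' r) (hY : HasDerivAt Y Y' r)
    (pX : 0 < X r) (pY : 0 < Y r) :
    HasDerivAt (fun r => bX P Q (X r) (Y r)) (bXX P Q (X r) (Y r) * X' + bXY P Q (X r) (Y r) * Y') r := by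
  have hZ := bZ_deriv (P := P) (Q := Q) hX hY pX pY
  have pZ := bZ_pos (P := P) (Q := Q) pX pY
  have eZ : bZ P Q (X r) (Y r) = X r ^ P + Y r ^ Q := rfl
  unfold bX
  refine ((hZ.rpow_const (p := 1 - 1/P) (Or.inl pZ.ne')).add
    (((hX.rpow_const (p := P) (Or.inl pX.ne')).const_mul (P - 1)).mul
     (hZ.rpow_const (p := -1/P) (Or.inl pZ.ne')))).congr_deriv ?_
  unfold bXX bXY
  rw [show (1 - 1/P - 1) = -1/P by ring, show -1/P - 1 = -1 - 1/P by ring]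
  have hP0 : P ≠ 0 := by linarith
  have e1 : bZ P Q (X r) (Y r) ^ (-1/P) = bZ P Q (X r) (Y r) * bZ P Q (X r) (Y r) ^ (-1 - 1/P) := by
    rw [rp_succ pZ]; congr 2; ring
  have e2 : Y r ^ Q = bZ P Q (X r) (Y r) - X r ^ P := by rw [eZ]; ring
  rw [e1, e2]
  generalize bZ P Q (X r) (Y r) ^ (-1 - 1/P) = z
  generalize bZ P Q (X r) (Y r) = Z
  generalize X r ^ P = xp
  generalize X r ^ (P - 1) = xp1
  generalize Y r ^ (Q - 1) = yq1
  field_simp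
  ring

lemma bY_deriv (hP : 1 < P) {X Y : ℝ → ℝ} {X' Y' r : ℝ} (hX : HasDerivAt X X' r) (hY : HasDerivAt Y Y' r)
    (pX : 0 < X r) (pY : 0 < Y r) :
    HasDerivAt (fun r => bY P Q K (X r) (Y r)) (bXY P Q (X r) (Y r) * X' + bYY P Q K (X r) (Y r) * Y') r := by
  have hZ := bZ_deriv (P := P) (Q := Q) hX hY pX pY
  have pZ := bZ_pos (P := P) (Q := Q) pX pY
  have eZ : bZ P Q (X r) (Y r) = X r ^ P + Y r ^ Q := rfl
  unfold bY
  have hY1 := hY.rpow_const (p := Q - 1) (Or.inl pY.ne')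
  refine ((hY1.const_mul (K * Q)).add
    (((hX.const_mul ((1 - 1/P) * Q)).mul (hZ.rpow_const (p := -1/P) (Or.inl pZ.ne'))).mul hY1)).congr_deriv ?_
  unfold bXY bYY
  simp only [Pi.mul_apply]
  rw [show -1/P - 1 = -1 - 1/P by ring, show Q - 1 - 1 = Q - 2 by ring]
  have hP0 : P ≠ 0 := by linarith
  have e1 : bZ P Q (X r) (Y r) ^ (-1/P) = bZ P Q (X r) (Y r) * bZ P Q (X r) (Y r) ^ (-1 - 1/P) := by
    rw [rp_succ pZ]; congr 2; ring
  have e2 : Y r ^ Q = bZ P Q (X r) (Y r) - X r ^ P := by rw [eZ]; ring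
  have e3 : X r ^ P = X r * X r ^ (P - 1) := rp_succ pX P
  rw [e1, e2, e3]
  generalize bZ P Q (X r) (Y r) ^ (-1 - 1/P) = z
  generalize bZ P Q (X r) (Y r) = Z
  generalize X r ^ (P - 1) = xp1
  generalize Y r ^ (Q - 1) = yq1
  generalize Y r ^ (Q - 2) = yq2
  field_simp
  ring

/-! bounds -/
lemma bX_ge (hP : 1 < P) (hQP : Q / P = 2 * Q - 1) {X Y : ℝ} (hX : 0 < X) (hY : 0 < Y) :
    Y ^ (1 - Q) ≤ bX P Q X Y := by
  have pZ := bZ_pos (P := P) (Q := Q) hX hY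
  have hP0 : 0 < P := by linarith
  have h1 : Y ^ Q ≤ bZ P Q X Y := by unfold bZ; have := Real.rpow_pos_of_pos hX P; linarith
  have h2 : (Y ^ Q) ^ (1 - 1/P) ≤ bZ P Q X Y ^ (1 - 1/P) :=
    Real.rpow_le_rpow (by positivity) h1 (by rw [sub_nonneg, div_le_one hP0]; exact hP.le)
  rw [← Real.rpow_mul hY.le, show Q * (1 - 1/P) = 1 - Q by
    have : Q * (1 - 1/P) = Q - Q / P := by ring
    rw [this, hQP]; ring] at h2
  unfold bX
  have : 0 ≤ (P - 1) * X ^ P * bZ P Q X Y ^ (-1/P) := by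
    have : 0 ≤ P - 1 := by linarith
    positivity
  linarith

lemma bXX_nonneg (hP : 1 < P) {X Y : ℝ} (hX : 0 < X) (hY : 0 < Y) : 0 ≤ bXX P Q X Y := by
  have pZ := bZ_pos (P := P) (Q := Q) hX hY
  have h1 : X ^ P ≤ bZ P Q X Y := by unfold bZ; have := Real.rpow_pos_of_pos hY Q; linarith
  unfold bXX
  have : 0 ≤ P - 1 := by linarith
  have : 0 ≤ (1 + P) * bZ P Q X Y - X ^ P := by nlinarith
  positivity

lemma X_le (hP : 1 < P) {X Y : ℝ} (hX : 0 < X) (hY : 0 < Y) : X ≤ bZ P Q X Y ^ (1/P) := by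
  have h1 : X ^ P ≤ bZ P Q X Y := by unfold bZ; have := Real.rpow_pos_of_pos hY Q; linarith
  have hP0 : 0 < P := by linarith
  calc X = (X ^ P) ^ (1/P) := by rw [← Real.rpow_mul hX.le, mul_one_div_cancel hP0.ne', Real.rpow_one]
    _ ≤ _ := Real.rpow_le_rpow (by positivity) h1 (by positivity)

lemma bXY_bd (hP : 1 < P) (hQ : 1/2 < Q) (hQ1 : Q < 1) (hQP : Q / P = 2 * Q - 1) {X Y s t : ℝ} (hX : 0 < X) (hY : 0 < Y)
    (hs : s ^ 2 ≤ X) (ht : t ^ 2 ≤ Y) : |4 * s * t * bXY P Q X Y| ≤ 4 := by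
  have pZ := bZ_pos (P := P) (Q := Q) hX hY
  have hP0 : 0 < P := by linarith
  have h1 : Y ^ Q ≤ bZ P Q X Y := by unfold bZ; have := Real.rpow_pos_of_pos hX P; linarith
  have hsX : |s| ≤ X ^ (1/2 : ℝ) := by
    rw [← Real.sqrt_eq_rpow]; exact Real.abs_le_sqrt hs
  have htY : |t| ≤ Y ^ (1/2 : ℝ) := by
    rw [← Real.sqrt_eq_rpow]; exact Real.abs_le_sqrt ht
  have hXZ : X ^ (1/2 : ℝ) ≤ bZ P Q X Y ^ (1/P * (1/2)) := by
    rw [Real.rpow_mul pZ.le]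
    exact Real.rpow_le_rpow hX.le (X_le hP hX hY) (by norm_num)
  have hb0 : 0 ≤ bXY P Q X Y := by
    unfold bXY
    have : 0 ≤ 1 - 1/P := by rw [sub_nonneg, div_le_one hP0]; exact hP.le
    have : 0 ≤ Q := by linarith
    positivity
  have hcoef : (1 - 1/P) * Q ≤ 1 := by
    have : 0 < 1/P := by positivity
    nlinarith
  have hZe : bZ P Q X Y ^ (1/P * (1/2)) * bZ P Q X Y ^ (-1 - 1/P) ≤ (Y ^ Q) ^ (-1 - 1/(2*P)) := by
    rw [← Real.rpow_add pZ, show 1/P * (1/2) + (-1 - 1/P) = -1 - 1/(2*P) by field_simp; ring]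
    refine Real.rpow_le_rpow_of_nonpos (by positivity) h1 ?_
    have : 0 < 1/(2*P) := by positivity
    linarith
  have hYe : Y ^ (1/2 : ℝ) * Y ^ (Q - 1) * Y ^ Q * (Y ^ Q) ^ (-1 - 1/(2*P)) = 1 := by
    rw [← Real.rpow_mul hY.le, ← Real.rpow_add hY, ← Real.rpow_add hY, ← Real.rpow_add hY]
    have : 1/2 + (Q - 1) + Q + Q * (-1 - 1/(2*P)) = 0 := by
      have e : Q * (-1 - 1/(2*P)) = -Q - (Q / P)/2 := by field_simp
      rw [e, hQP]; ring
    rw [this, Real.rpow_zero]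
  rw [abs_mul, abs_of_nonneg hb0, abs_mul, abs_mul, abs_of_pos (by norm_num : (0:ℝ) < 4)]
  have hst : |s| * |t| * bXY P Q X Y ≤ 1 := by
    unfold bXY
    calc |s| * |t| * ((1 - 1/P) * Q * Y ^ (Q - 1) * Y ^ Q * bZ P Q X Y ^ (-1 - 1/P))
        ≤ (bZ P Q X Y ^ (1/P * (1/2))) * Y ^ (1/2 : ℝ) * (1 * Y ^ (Q - 1) * Y ^ Q * bZ P Q X Y ^ (-1 - 1/P)) := by
          have := hsX.trans hXZ
          gcongr
      _ = (Y ^ (1/2 : ℝ) * Y ^ (Q - 1) * Y ^ Q) * (bZ P Q X Y ^ (1/P * (1/2)) * bZ P Q X Y ^ (-1 - 1/P)) := by ring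
      _ ≤ (Y ^ (1/2 : ℝ) * Y ^ (Q - 1) * Y ^ Q) * (Y ^ Q) ^ (-1 - 1/(2*P)) := by gcongr
      _ = 1 := hYe
  nlinarith

lemma bYY_bd (hP : 1 < P) (hQ : 1/2 < Q) (hQ1 : Q < 1) (hK : 0 ≤ K) {X Y t : ℝ} (hX : 0 < X) (hY : 0 < Y)
    (ht : t ^ 2 ≤ Y) :
    (K * Q * (4 * Q - 2) - 4) * Y ^ (Q - 1) ≤ 2 * bY P Q K X Y + 4 * t ^ 2 * bYY P Q K X Y := by
  have pZ := bZ_pos (P := P) (Q := Q) hX hY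
  have hP0 : 0 < P := by linarith
  have h1 : Y ^ Q ≤ bZ P Q X Y := by unfold bZ; have := Real.rpow_pos_of_pos hX P; linarith
  have hPi : 0 < 1/P := by positivity
  have hPi1 : 1/P < 1 := by rw [div_lt_one hP0]; exact hP
  have hYY : bYY P Q K X Y ≤ 0 := by
    unfold bYY
    have a1 : K * Q * (Q - 1) * Y ^ (Q - 2) ≤ 0 := by
      have : 0 ≤ K * Q * (1 - Q) * Y ^ (Q - 2) := by
        have : 0 ≤ 1 - Q := by linarith
        positivity
      linarith
    have a2 : 0 ≤ (1 - 1/P) * Q * X * ((1/P) * Q * bZ P Q X Y ^ (-1 - 1/P) * (Y ^ (Q - 1)) ^ 2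
      + (1 - Q) * bZ P Q X Y ^ (-1/P) * Y ^ (Q - 2)) := by
      have : 0 ≤ 1 - Q := by linarith
      have : 0 ≤ 1 - 1/P := by linarith
      positivity
    nlinarith
  have hY2 : 4 * Y * bYY P Q K X Y ≤ 4 * t ^ 2 * bYY P Q K X Y := by nlinarith
  -- key term
  have hkey : X * bZ P Q X Y ^ (-1 - 1/P) * Y ^ Q ≤ 1 := by
    calc X * bZ P Q X Y ^ (-1 - 1/P) * Y ^ Q ≤ bZ P Q X Y ^ (1/P) * bZ P Q X Y ^ (-1 - 1/P) * bZ P Q X Y := by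
          have := X_le (Q := Q) hP hX hY
          gcongr
      _ = 1 := by
          nth_rewrite 3 [← Real.rpow_one (bZ P Q X Y)]
          rw [← Real.rpow_add pZ, ← Real.rpow_add pZ]
          rw [show 1/P + (-1 - 1/P) + 1 = 0 by ring, Real.rpow_zero]
  have e1 : Y ^ (Q - 1) = Y * Y ^ (Q - 2) := by rw [rp_succ hY (Q-1)]; congr 2; ring
  have e2 : Y ^ Q = Y * Y ^ (Q - 1) := rp_succ hY Q
  have expand : 2 * bY P Q K X Y + 4 * Y * bYY P Q K X Y
      = K * Q * (4 * Q - 2) * Y ^ (Q - 1)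
        + (1 - 1/P) * Q * X * bZ P Q X Y ^ (-1/P) * (4 * Q - 2) * Y ^ (Q - 1)
        - 4 * ((1 - 1/P) * (1/P) * Q ^ 2) * (X * bZ P Q X Y ^ (-1 - 1/P) * Y ^ Q) * Y ^ (Q - 1) := by
    unfold bY bYY
    rw [e2, e1]
    ring
  have n1 : 0 ≤ (1 - 1/P) * Q * X * bZ P Q X Y ^ (-1/P) * (4 * Q - 2) * Y ^ (Q - 1) := by
    have : 0 ≤ 1 - 1/P := by linarith
    have : 0 ≤ 4 * Q - 2 := by linarith
    positivity
  have n2 : ((1 - 1/P) * (1/P) * Q ^ 2) * (X * bZ P Q X Y ^ (-1 - 1/P) * Y ^ Q) * Y ^ (Q - 1) ≤ 1 * Y ^ (Q - 1) := by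
    have c1 : (1 - 1/P) * (1/P) * Q ^ 2 ≤ 1 := by
      have : (1 - 1/P) * (1/P) ≤ 1 := by nlinarith
      have : Q ^ 2 ≤ 1 := by nlinarith
      have : 0 ≤ (1 - 1/P) * (1/P) := by nlinarith
      nlinarith
    have c0 : 0 ≤ X * bZ P Q X Y ^ (-1 - 1/P) * Y ^ Q := by positivity
    gcongr
    have : ((1 - 1/P) * (1/P) * Q ^ 2) * (X * bZ P Q X Y ^ (-1 - 1/P) * Y ^ Q) ≤ 1 * 1 := by gcongr
    linarith
  nlinarith
end bell


structure BellP (P Q K ε : ℝ) (B Bs Bt Bss Bst Btt : ℝ → ℝ → ℝ) : Prop where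
  sm : ContDiff ℝ (⊤ : ℕ∞) (fun w : ℝ × ℝ => B w.1 w.2)
  cs : Continuous (fun w : ℝ × ℝ => Bs w.1 w.2)
  ct : Continuous (fun w : ℝ × ℝ => Bt w.1 w.2)
  d0 : ∀ (S T : ℝ → ℝ) (S' T' r : ℝ), HasDerivAt S S' r → HasDerivAt T T' r →
    HasDerivAt (fun r => B (S r) (T r)) (Bs (S r) (T r) * S' + Bt (S r) (T r) * T') r
  d1 : ∀ (S T : ℝ → ℝ) (S' T' r : ℝ), HasDerivAt S S' r → HasDerivAt T T' r →
    HasDerivAt (fun r => Bs (S r) (T r)) (Bss (S r) (T r) * S' + Bst (S r) (T r) * T') r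
  d2 : ∀ (S T : ℝ → ℝ) (S' T' r : ℝ), HasDerivAt S S' r → HasDerivAt T T' r →
    HasDerivAt (fun r => Bt (S r) (T r)) (Bst (S r) (T r) * S' + Btt (S r) (T r) * T') r
  form : ∀ s t, ∃ y, 0 < y ∧ ∀ a b, y * a ^ 2 + y⁻¹ * b ^ 2 ≤ Bss s t * a ^ 2 + 2 * Bst s t * a * b + Btt s t * b ^ 2
  lo : ∀ s t, 0 ≤ B s t
  hi : ∀ s t, B s t ≤ (s ^ 2 + ε ^ 2) ^ P + (K + 1) * (t ^ 2 + ε ^ 2) ^ Q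
  zero : B 0 0 = 0

lemma bell_exists {P Q : ℝ} (hP : 1 < P) (hQ : 1/2 < Q) (hQ1 : Q < 1) (hQP : Q / P = 2 * Q - 1) :
    ∃ K, 0 ≤ K ∧ ∀ ε, 0 < ε → ∃ B Bs Bt Bss Bst Btt, BellP P Q K ε B Bs Bt Bss Bst Btt := by
  set K : ℝ := 21 / (Q * (4 * Q - 2)) with hKdef
  have hden : 0 < Q * (4 * Q - 2) := by nlinarith
  have hK0 : 0 ≤ K := by positivity
  have hKM : K * Q * (4 * Q - 2) = 21 := by
    rw [mul_assoc]; exact div_mul_cancel₀ _ hden.ne'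
  have hP0 : 0 < P := by linarith
  refine ⟨K, hK0, fun ε hε => ?_⟩
  have pp : ∀ s : ℝ, 0 < s ^ 2 + ε ^ 2 := fun s => by positivity
  have hsq : ∀ (S : ℝ → ℝ) (S' r : ℝ), HasDerivAt S S' r →
      HasDerivAt (fun r => S r ^ 2 + ε ^ 2) (2 * S r * S') r := by
    intro S S' r h
    refine ((h.pow 2).add_const _).congr_deriv ?_
    simp
  have cX : Continuous fun w : ℝ × ℝ => w.1 ^ 2 + ε ^ 2 := by fun_prop
  have cY : Continuous fun w : ℝ × ℝ => w.2 ^ 2 + ε ^ 2 := by fun_prop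
  have cXe : ∀ e : ℝ, Continuous fun w : ℝ × ℝ => (w.1 ^ 2 + ε ^ 2) ^ e := fun e =>
    cX.rpow_const fun w => Or.inl (pp _).ne'
  have cYe : ∀ e : ℝ, Continuous fun w : ℝ × ℝ => (w.2 ^ 2 + ε ^ 2) ^ e := fun e =>
    cY.rpow_const fun w => Or.inl (pp _).ne'
  have pZ : ∀ s t : ℝ, 0 < bZ P Q (s ^ 2 + ε ^ 2) (t ^ 2 + ε ^ 2) := fun s t => bZ_pos (pp s) (pp t)
  have cZ : Continuous fun w : ℝ × ℝ => bZ P Q (w.1 ^ 2 + ε ^ 2) (w.2 ^ 2 + ε ^ 2) := by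
    unfold bZ; exact (cXe _).add (cYe _)
  have cZe : ∀ e : ℝ, Continuous fun w : ℝ × ℝ => bZ P Q (w.1 ^ 2 + ε ^ 2) (w.2 ^ 2 + ε ^ 2) ^ e := fun e =>
    cZ.rpow_const fun w => Or.inl (pZ _ _).ne'
  have sX : ContDiff ℝ (⊤ : ℕ∞) fun w : ℝ × ℝ => w.1 ^ 2 + ε ^ 2 := by fun_prop
  have sY : ContDiff ℝ (⊤ : ℕ∞) fun w : ℝ × ℝ => w.2 ^ 2 + ε ^ 2 := by fun_prop
  have sYQ := sY.rpow_const_of_ne (p := Q) (fun w => (pp w.2).ne')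
  have sZ : ContDiff ℝ (⊤ : ℕ∞) fun w : ℝ × ℝ => bZ P Q (w.1 ^ 2 + ε ^ 2) (w.2 ^ 2 + ε ^ 2) := by
    unfold bZ
    exact (sX.rpow_const_of_ne (p := P) (fun w => (pp w.1).ne')).add sYQ
  have hPi1 : 0 < 1 - 1/P := by rw [sub_pos, div_lt_one hP0]; exact hP
  refine ⟨fun s t => bB P Q K (s ^ 2 + ε ^ 2) (t ^ 2 + ε ^ 2) - bB P Q K (0 ^ 2 + ε ^ 2) (0 ^ 2 + ε ^ 2),
    fun s t => 2 * s * bX P Q (s ^ 2 + ε ^ 2) (t ^ 2 + ε ^ 2),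
    fun s t => 2 * t * bY P Q K (s ^ 2 + ε ^ 2) (t ^ 2 + ε ^ 2),
    fun s t => 2 * bX P Q (s ^ 2 + ε ^ 2) (t ^ 2 + ε ^ 2) + 4 * s ^ 2 * bXX P Q (s ^ 2 + ε ^ 2) (t ^ 2 + ε ^ 2),
    fun s t => 4 * s * t * bXY P Q (s ^ 2 + ε ^ 2) (t ^ 2 + ε ^ 2),
    fun s t => 2 * bY P Q K (s ^ 2 + ε ^ 2) (t ^ 2 + ε ^ 2) + 4 * t ^ 2 * bYY P Q K (s ^ 2 + ε ^ 2) (t ^ 2 + ε ^ 2),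
    ?_⟩
  constructor
  · unfold bB
    exact ((contDiff_const.mul sYQ).add (sX.mul (sZ.rpow_const_of_ne (fun w => (pZ _ _).ne')))).sub contDiff_const
  · unfold bX
    have c1 : Continuous fun w : ℝ × ℝ => 2 * w.1 := by fun_prop
    exact c1.mul ((cZe _).add ((continuous_const.mul (cXe _)).mul (cZe _)))
  · unfold bY
    have c1 : Continuous fun w : ℝ × ℝ => 2 * w.2 := by fun_prop
    exact c1.mul ((continuous_const.mul (cYe _)).add (((continuous_const.mul cX).mul (cZe _)).mul (cYe _)))
  · intro S T S' T' r hS hT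
    exact ((bB_deriv hP (hsq S S' r hS) (hsq T T' r hT) (pp _) (pp _)).sub_const _).congr_deriv (by ring)
  · intro S T S' T' r hS hT
    have h := bX_deriv (Q := Q) hP (hsq S S' r hS) (hsq T T' r hT) (pp _) (pp _)
    exact ((hS.const_mul 2).mul h).congr_deriv (by ring)
  · intro S T S' T' r hS hT
    have h := bY_deriv (Q := Q) (K := K) hP (hsq S S' r hS) (hsq T T' r hT) (pp _) (pp _)
    exact ((hT.const_mul 2).mul h).congr_deriv (by ring)
  · intro s t
    have hX := pp s
    have hY := pp t
    have hsX : s ^ 2 ≤ s ^ 2 + ε ^ 2 := by nlinarith [sq_nonneg ε]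
    have htY : t ^ 2 ≤ t ^ 2 + ε ^ 2 := by nlinarith [sq_nonneg ε]
    have i1 := bX_ge (Q := Q) hP hQP hX hY
    have i2 := bXX_nonneg (Q := Q) hP hX hY
    have i3 := bXY_bd hP hQ hQ1 hQP hX hY hsX htY
    have i4 := bYY_bd (K := K) hP hQ hQ1 hK0 hX hY htY
    rw [hKM] at i4
    have hy : (t ^ 2 + ε ^ 2) ^ (Q - 1) = ((t ^ 2 + ε ^ 2) ^ (1 - Q))⁻¹ := by
      rw [← Real.rpow_neg hY.le]; congr 1; ring
    rw [hy] at i4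
    have hypos : 0 < (t ^ 2 + ε ^ 2) ^ (1 - Q) := by positivity
    refine ⟨(t ^ 2 + ε ^ 2) ^ (1 - Q), hypos, fun a b => ?_⟩
    have j1 : 2 * (t ^ 2 + ε ^ 2) ^ (1 - Q) ≤ 2 * bX P Q (s ^ 2 + ε ^ 2) (t ^ 2 + ε ^ 2) + 4 * s ^ 2 * bXX P Q (s ^ 2 + ε ^ 2) (t ^ 2 + ε ^ 2) := by
      have : 0 ≤ 4 * s ^ 2 * bXX P Q (s ^ 2 + ε ^ 2) (t ^ 2 + ε ^ 2) := by positivity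
      linarith
    revert j1 i3 i4
    generalize 2 * bX P Q (s ^ 2 + ε ^ 2) (t ^ 2 + ε ^ 2) + 4 * s ^ 2 * bXX P Q (s ^ 2 + ε ^ 2) (t ^ 2 + ε ^ 2) = m1
    generalize 4 * s * t * bXY P Q (s ^ 2 + ε ^ 2) (t ^ 2 + ε ^ 2) = m2
    generalize 2 * bY P Q K (s ^ 2 + ε ^ 2) (t ^ 2 + ε ^ 2) + 4 * t ^ 2 * bYY P Q K (s ^ 2 + ε ^ 2) (t ^ 2 + ε ^ 2) = m3
    revert hypos
    generalize (t ^ 2 + ε ^ 2) ^ (1 - Q) = y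
    intro hypos i3 i4 j1
    have hyi : 0 < y⁻¹ := by positivity
    have k1 : 2 * y * a ^ 2 ≤ m1 * a ^ 2 := by gcongr
    have k2 : (21 - 4) * y⁻¹ * b ^ 2 ≤ m3 * b ^ 2 := by gcongr
    have k3 : -(8 * |a * b|) ≤ 2 * m2 * a * b := by
      have : |2 * m2 * a * b| ≤ 8 * |a * b| := by
        rw [show 2 * m2 * a * b = m2 * (2 * (a * b)) by ring, abs_mul, abs_mul, abs_two]
        have := abs_nonneg (a * b)
        nlinarith
      linarith [neg_abs_le (2 * m2 * a * b)]
    have k4 : 8 * |a * b| ≤ y * a ^ 2 + 16 * y⁻¹ * b ^ 2 := by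
      rw [abs_mul]
      have e : y * a ^ 2 + 16 * y⁻¹ * b ^ 2 - 8 * (|a| * |b|) = y * (|a| - 4 * y⁻¹ * |b|) ^ 2 := by
        rw [← sq_abs a, ← sq_abs b]; field_simp; ring
      have : 0 ≤ y * (|a| - 4 * y⁻¹ * |b|) ^ 2 := by positivity
      linarith
    nlinarith
  · intro s t
    rw [sub_nonneg]
    unfold bB
    have hXl : (0:ℝ) ^ 2 + ε ^ 2 ≤ s ^ 2 + ε ^ 2 := by nlinarith [sq_nonneg s]
    have hYl : (0:ℝ) ^ 2 + ε ^ 2 ≤ t ^ 2 + ε ^ 2 := by nlinarith [sq_nonneg t]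
    have e0 := (pp 0).le
    have hQ0 : 0 ≤ Q := by linarith
    have z0 := (pZ 0 0).le
    have hZl : bZ P Q (0 ^ 2 + ε ^ 2) (0 ^ 2 + ε ^ 2) ≤ bZ P Q (s ^ 2 + ε ^ 2) (t ^ 2 + ε ^ 2) := by
      unfold bZ
      exact add_le_add (Real.rpow_le_rpow e0 hXl hP0.le) (Real.rpow_le_rpow e0 hYl hQ0)
    refine add_le_add ?_ ?_
    · exact mul_le_mul_of_nonneg_left (Real.rpow_le_rpow e0 hYl hQ0) hK0
    · exact mul_le_mul hXl (Real.rpow_le_rpow z0 hZl hPi1.le) (Real.rpow_nonneg z0 _) (pp s).le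
  · intro s t
    have hn : 0 ≤ bB P Q K (0 ^ 2 + ε ^ 2) (0 ^ 2 + ε ^ 2) := by
      unfold bB
      have := pZ 0 0
      have := pp 0
      positivity
    refine (sub_le_self _ hn).trans ?_
    unfold bB
    have hl := X_le (Q := Q) hP (pp s) (pp t)
    have h2 : (s ^ 2 + ε ^ 2) * bZ P Q (s ^ 2 + ε ^ 2) (t ^ 2 + ε ^ 2) ^ (1 - 1/P) ≤ bZ P Q (s ^ 2 + ε ^ 2) (t ^ 2 + ε ^ 2) := by
      calc _ ≤ bZ P Q (s ^ 2 + ε ^ 2) (t ^ 2 + ε ^ 2) ^ (1/P) * bZ P Q (s ^ 2 + ε ^ 2) (t ^ 2 + ε ^ 2) ^ (1 - 1/P) :=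
            mul_le_mul_of_nonneg_right hl (Real.rpow_nonneg (pZ s t).le _)
        _ = _ := by rw [← Real.rpow_add (pZ s t)]; simp
    have e : bZ P Q (s ^ 2 + ε ^ 2) (t ^ 2 + ε ^ 2) = (s ^ 2 + ε ^ 2) ^ P + (t ^ 2 + ε ^ 2) ^ Q := rfl
    linarith
  · exact sub_self _


lemma param_deriv {χ : R3 → ℝ} (hχ : Continuous χ) (hcχ : HasCompactSupport χ) {g g' : ℝ → R3 → ℝ}
    (hg : ∀ s, Continuous (g s)) (hg' : Continuous (fun w : ℝ × R3 => g' w.1 w.2))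
    (hd : ∀ s x, HasDerivAt (fun s => g s x) (g' s x) s) (s : ℝ) :
    HasDerivAt (fun s => ∫ x, χ x * g s x) (∫ x, χ x * g' s x) s := by
  have hK : IsCompact (Set.Icc (s-1) (s+1) ×ˢ tsupport χ) := isCompact_Icc.prod hcχ
  obtain ⟨C, hC⟩ := hK.exists_bound_of_continuousOn hg'.continuousOn
  have cg' : ∀ s, Continuous (g' s) := fun s => hg'.comp (by fun_prop : Continuous fun x : R3 => (s, x))
  refine (hasDerivAt_integral_of_dominated_loc_of_deriv_le (μ := (volume : Measure R3))
    (s := Set.Icc (s-1) (s+1)) (x₀ := s) (F := fun s x => χ x * g s x) (F' := fun s x => χ x * g' s x)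
    (bound := fun x => |χ x| * C) (Icc_mem_nhds (by linarith) (by linarith))
    (Eventually.of_forall fun t => (hχ.mul (hg t)).aestronglyMeasurable)
    (cs_int (hχ.mul (hg s)) hcχ.mul_right) (hχ.mul (cg' s)).aestronglyMeasurable ?_
    ((cs_int hχ hcχ).abs.mul_const C) ?_).2
  · refine ae_of_all _ fun x t ht => ?_
    rw [norm_mul]
    by_cases hx : x ∈ tsupport χ
    · exact mul_le_mul_of_nonneg_left (hC (t, x) ⟨ht, hx⟩) (abs_nonneg _)
    · simp [image_eq_zero_of_notMem_tsupport hx]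
  · exact ae_of_all _ fun x t _ => (hd t x).const_mul _

lemma pd_hasDerivAt {f : R3 → ℝ} (hf : Sm f) (j : Fin 3) (x : R3) :
    HasDerivAt (fun r : ℝ => f (x + r • EuclideanSpace.single j 1)) (pd f j x) 0 := by
  have h1 : HasDerivAt (fun r : ℝ => x + r • (EuclideanSpace.single j 1 : R3)) (EuclideanSpace.single j 1) 0 := by
    simpa using ((hasDerivAt_id (0:ℝ)).smul_const (EuclideanSpace.single j 1 : R3)).const_add x
  have h2 : HasFDerivAt f (fderiv ℝ f x) (x + (0:ℝ) • (EuclideanSpace.single j 1 : R3)) := by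
    simpa using (hf.dat x).hasFDerivAt
  exact h2.comp_hasDerivAt (0:ℝ) h1

lemma pd_eq_of {f : R3 → ℝ} (hf : Sm f) {j : Fin 3} {x : R3} {d : ℝ}
    (h : HasDerivAt (fun r : ℝ => f (x + r • EuclideanSpace.single j 1)) d 0) : pd f j x = d :=
  (pd_hasDerivAt hf j x).unique h

lemma bell_lap {P Q K ε : ℝ} {B Bs Bt Bss Bst Btt : ℝ → ℝ → ℝ} (H : BellP P Q K ε B Bs Bt Bss Bst Btt)
    {F G : R3 → ℝ} (hF : Sm F) (hG : Sm G) (i j : Fin 3) (x : R3) :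
    Bs (F x) (G x) * lap F x + Bt (F x) (G x) * lap G x + 2 * |pd G i x * pd F j x|
      ≤ lap (fun x => B (F x) (G x)) x := by
  have hb : Sm (fun x => B (F x) (G x)) := H.sm.comp (hF.prodMk hG)
  have h1 : ∀ k, pd (fun x => B (F x) (G x)) k
      = fun x => Bs (F x) (G x) * pd F k x + Bt (F x) (G x) * pd G k x := by
    intro k; funext y
    refine pd_eq_of hb ?_
    have := H.d0 _ _ _ _ 0 (pd_hasDerivAt hF k y) (pd_hasDerivAt hG k y)
    simpa using this
  have h2 : ∀ k, pd (pd (fun x => B (F x) (G x)) k) k x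
      = Bs (F x) (G x) * pd (pd F k) k x + Bt (F x) (G x) * pd (pd G k) k x
        + (Bss (F x) (G x) * pd F k x ^ 2 + 2 * Bst (F x) (G x) * pd F k x * pd G k x + Btt (F x) (G x) * pd G k x ^ 2) := by
    intro k
    refine pd_eq_of (hb.pd k) ?_
    rw [h1]
    have a1 := H.d1 _ _ _ _ 0 (pd_hasDerivAt hF k x) (pd_hasDerivAt hG k x)
    have a2 := H.d2 _ _ _ _ 0 (pd_hasDerivAt hF k x) (pd_hasDerivAt hG k x)
    refine ((a1.mul (pd_hasDerivAt (hF.pd k) k x)).add (a2.mul (pd_hasDerivAt (hG.pd k) k x))).congr_deriv ?_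
    simp only [zero_smul, add_zero]
    ring
  obtain ⟨y, hy, hform⟩ := H.form (F x) (G x)
  have hyi : 0 < y⁻¹ := by positivity
  unfold lap
  simp_rw [h2]
  rw [Finset.sum_add_distrib, Finset.sum_add_distrib, ← Finset.mul_sum, ← Finset.mul_sum]
  have h3 : ∑ k, (y * pd F k x ^ 2 + y⁻¹ * pd G k x ^ 2) ≤ ∑ k, (Bss (F x) (G x) * pd F k x ^ 2 + 2 * Bst (F x) (G x) * pd F k x * pd G k x + Btt (F x) (G x) * pd G k x ^ 2) :=
    Finset.sum_le_sum fun k _ => hform _ _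
  rw [Finset.sum_add_distrib] at h3
  have h4 : y * pd F j x ^ 2 ≤ ∑ k, y * pd F k x ^ 2 :=
    Finset.single_le_sum (f := fun k => y * pd F k x ^ 2) (fun k _ => by positivity) (Finset.mem_univ j)
  have h5 : y⁻¹ * pd G i x ^ 2 ≤ ∑ k, y⁻¹ * pd G k x ^ 2 :=
    Finset.single_le_sum (f := fun k => y⁻¹ * pd G k x ^ 2) (fun k _ => by positivity) (Finset.mem_univ i)
  have h6 : 2 * |pd G i x * pd F j x| ≤ y * pd F j x ^ 2 + y⁻¹ * pd G i x ^ 2 := by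
    rw [abs_mul]
    have e : y * pd F j x ^ 2 + y⁻¹ * pd G i x ^ 2 - 2 * (|pd G i x| * |pd F j x|) = y * (|pd F j x| - y⁻¹ * |pd G i x|) ^ 2 := by
      rw [← sq_abs (pd F j x), ← sq_abs (pd G i x)]; field_simp; ring
    have : 0 ≤ y * (|pd F j x| - y⁻¹ * |pd G i x|) ^ 2 := by positivity
    linarith
  linarith

lemma ibp {f g : R3 → ℝ} (hf : Sm f) (hg : Sm g) (hc : HasCompactSupport f) (j : Fin 3) :
    ∫ x, f x * pd g j x = - ∫ x, pd f j x * g x := by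
  have h := int_pd (hf.mul hg) hc.mul_right j
  simp_rw [pd_mul hf hg] at h
  rw [integral_add (f := fun x => pd f j x * g x) (g := fun x => f x * pd g j x)
    (cs_int ((hf.pd j).cont.mul hg.cont) (cs_pd hc j).mul_right)
    (cs_int (hf.cont.mul (hg.pd j).cont) hc.mul_right)] at h
  linarith

lemma int_lap_symm {f g : R3 → ℝ} (hf : Sm f) (hg : Sm g) (hc : HasCompactSupport f) :
    ∫ x, f x * lap g x = ∫ x, lap f x * g x := by
  unfold lap
  simp_rw [Finset.mul_sum, Finset.sum_mul]
  rw [integral_finsetSum, integral_finsetSum]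
  · refine Finset.sum_congr rfl fun j _ => ?_
    rw [ibp hf (hg.pd j) hc, ibp (hf.pd j) hg (cs_pd hc j), neg_neg]
  · intro j _; exact cs_int (((hf.pd j).pd j).cont.mul hg.cont) (cs_pd (cs_pd hc j) j).mul_right
  · intro j _; exact cs_int (hf.cont.mul ((hg.pd j).pd j).cont) hc.mul_right

lemma int4 {a b c d : R3 → ℝ} (ha : Integrable a) (hb : Integrable b) (hc : Integrable c) (hd : Integrable d) :
    ∫ x, (a x + b x - c x + d x) = (∫ x, a x) + (∫ x, b x) - (∫ x, c x) + ∫ x, d x := by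
  rw [integral_add (f := fun x => a x + b x - c x) (g := d) ((ha.add hb).sub hc) hd,
    integral_sub (f := fun x => a x + b x) (g := c) (ha.add hb) hc, integral_add ha hb]

/-- commutator identity, k-th piece -/
lemma comm_k {χ G H : R3 → ℝ} (hχ : Sm χ) (hc : HasCompactSupport χ) (hG : Sm G) (hH : Sm H) (i j k : Fin 3) :
    ∫ x, (χ x * (pd (pd G k) k x * pd (pd H i) j x + G x * pd (pd (pd (pd H k) k) i) j x)
      + 2 * (χ x * (pd G i x * pd (pd (pd H k) k) j x))
      + (pd χ i x * (G x * pd (pd (pd H k) k) j x) + pd χ k x * (pd G k x * pd (pd H i) j x)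
        - pd χ i x * (pd G k x * pd (pd H k) j x) + pd χ k x * (pd G i x * pd (pd H k) j x))) = 0 := by
  have s1 := hχ.mul (hG.mul (((hH.pd k).pd k).pd j))
  have s2 := hχ.mul ((hG.pd k).mul ((hH.pd i).pd j))
  have s3 := hχ.mul ((hG.pd k).mul ((hH.pd k).pd j))
  have s4 := hχ.mul ((hG.pd i).mul ((hH.pd k).pd j))
  have i1 := int_pd s1 hc.mul_right i
  have i2 := int_pd s2 hc.mul_right k
  have i3 := int_pd s3 hc.mul_right i
  have i4 := int_pd s4 hc.mul_right k
  have n1 := cs_int (s1.pd i).cont (cs_pd hc.mul_right i)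
  have n2 := cs_int (s2.pd k).cont (cs_pd hc.mul_right k)
  have n3 := cs_int (s3.pd i).cont (cs_pd hc.mul_right i)
  have n4 := cs_int (s4.pd k).cont (cs_pd hc.mul_right k)
  have tot : ∫ x, (pd (fun x => χ x * (G x * pd (pd (pd H k) k) j x)) i x
      + pd (fun x => χ x * (pd G k x * pd (pd H i) j x)) k x
      - pd (fun x => χ x * (pd G k x * pd (pd H k) j x)) i x
      + pd (fun x => χ x * (pd G i x * pd (pd H k) j x)) k x) = 0 := by
    rw [int4 n1 n2 n3 n4, i1, i2, i3, i4]
    simp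
  rw [← tot]
  refine integral_congr_ae (ae_of_all _ fun x => ?_)
  have c1 : pd (pd (pd (pd H k) k) i) j x = pd (pd (pd (pd H k) k) j) i x := pd_comm ((hH.pd k).pd k) i j x
  have c2 : pd (pd (pd H i) j) k x = pd (pd (pd H k) j) i x := by
    have a : pd (pd H i) j = pd (pd H j) i := funext (pd_comm hH i j)
    have b : pd (pd H k) j = pd (pd H j) k := funext (pd_comm hH k j)
    rw [a, b]
    exact pd_comm (hH.pd j) i k x
  have c3 : pd (pd (pd H k) j) k x = pd (pd (pd H k) k) j x := pd_comm (hH.pd k) j k x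
  have c4 : pd (pd G i) k x = pd (pd G k) i x := pd_comm hG i k x
  beta_reduce
  rw [pd_mul hχ (hG.mul (((hH.pd k).pd k).pd j)), pd_mul hχ ((hG.pd k).mul ((hH.pd i).pd j)),
    pd_mul hχ ((hG.pd k).mul ((hH.pd k).pd j)), pd_mul hχ ((hG.pd i).mul ((hH.pd k).pd j)),
    pd_mul hG (((hH.pd k).pd k).pd j), pd_mul (hG.pd k) ((hH.pd i).pd j), pd_mul (hG.pd k) ((hH.pd k).pd j),
    pd_mul (hG.pd i) ((hH.pd k).pd j), c1, c2, c3, c4]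
  ring


lemma bell_lip {P Q K ε : ℝ} {B Bs Bt Bss Bst Btt : ℝ → ℝ → ℝ} (H : BellP P Q K ε B Bs Bt Bss Bst Btt) (M : ℝ) :
    ∃ L, 0 ≤ L ∧ ∀ s t, |s| ≤ M → |t| ≤ M → |B s t| ≤ L * (|s| + |t|) := by
  have hK : IsCompact (closedBall (0 : ℝ × ℝ) M) := isCompact_closedBall _ _
  obtain ⟨L, hL⟩ := hK.exists_bound_of_continuousOn (H.sm.continuous_fderiv (by simp)).continuousOn
  refine ⟨|L|, abs_nonneg _, fun s t hs ht => ?_⟩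
  have hmem : (s, t) ∈ closedBall (0 : ℝ × ℝ) M := by
    rw [mem_closedBall_zero_iff, Prod.norm_def]; exact max_le hs ht
  have h0 : (0, 0) ∈ closedBall (0 : ℝ × ℝ) M := by
    have : 0 ≤ M := (abs_nonneg s).trans hs
    rw [mem_closedBall_zero_iff, Prod.norm_def]; simp [this]
  have := (convex_closedBall (0 : ℝ × ℝ) M).norm_image_sub_le_of_norm_fderiv_le (𝕜 := ℝ)
    (fun x _ => (H.sm.differentiable (by simp)) x) hL h0 hmem
  simp only [H.zero, sub_zero, Real.norm_eq_abs] at this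
  refine this.trans ?_
  have h2 : ‖(s, t) - ((0, 0) : ℝ × ℝ)‖ ≤ |s| + |t| := by
    rw [Prod.norm_def]; simp
  exact mul_le_mul (le_abs_self L) h2 (norm_nonneg _) (abs_nonneg _)

lemma comm_k_bd {χ G H : R3 → ℝ} (hχ : Sm χ) (hc : HasCompactSupport χ) (hG : Sm G) (hH : Sm H) (i j k : Fin 3)
    {c M : ℝ} (hcb : ∀ l x, |pd χ l x| ≤ c) (hM2 : ∀ a b x, |pd (pd H a) b x| ≤ M)
    (hM3 : ∀ a b d x, |pd (pd (pd H a) b) d x| ≤ M) (hG0 : Integrable G) (hG1 : ∀ l, Integrable (pd G l)) :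
    |∫ x, (χ x * (pd (pd G k) k x * pd (pd H i) j x + G x * pd (pd (pd (pd H k) k) i) j x)
      + 2 * (χ x * (pd G i x * pd (pd (pd H k) k) j x)))|
      ≤ c * M * ((∫ x, |G x|) + 2 * (∫ x, |pd G k x|) + ∫ x, |pd G i x|) := by
  have h := comm_k hχ hc hG hH i j k
  have hc0 : 0 ≤ c := (abs_nonneg _).trans (hcb 0 0)
  have hM0 : 0 ≤ M := (abs_nonneg _).trans (hM2 0 0 0)
  have cont1 := hχ.cont
  have cont2 := hG.cont
  have c3 := fun a => (hχ.pd a).cont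
  have c4 := fun a => (hG.pd a).cont
  have c5 := fun a b => ((hG.pd a).pd b).cont
  have c6 := fun a b => ((hH.pd a).pd b).cont
  have c7 := fun a b d => (((hH.pd a).pd b).pd d).cont
  have c8 := fun a b d e => ((((hH.pd a).pd b).pd d).pd e).cont
  have I1 : Integrable (fun x => χ x * (pd (pd G k) k x * pd (pd H i) j x + G x * pd (pd (pd (pd H k) k) i) j x)
      + 2 * (χ x * (pd G i x * pd (pd (pd H k) k) j x))) := by
    refine Integrable.add (cs_int (cont1.mul (((c5 _ _).mul (c6 _ _)).add (cont2.mul (c8 _ _ _ _)))) hc.mul_right) ?_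
    exact (cs_int (cont1.mul ((c4 _).mul (c7 _ _ _))) hc.mul_right).const_mul 2
  have I2 : Integrable (fun x => (pd χ i x * (G x * pd (pd (pd H k) k) j x) + pd χ k x * (pd G k x * pd (pd H i) j x)
        - pd χ i x * (pd G k x * pd (pd H k) j x) + pd χ k x * (pd G i x * pd (pd H k) j x))) := by
    refine ((Integrable.add ?_ ?_).sub ?_).add ?_
    · exact cs_int ((c3 _).mul (cont2.mul (c7 _ _ _))) (cs_pd hc _).mul_right
    · exact cs_int ((c3 _).mul ((c4 _).mul (c6 _ _))) (cs_pd hc _).mul_right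
    · exact cs_int ((c3 _).mul ((c4 _).mul (c6 _ _))) (cs_pd hc _).mul_right
    · exact cs_int ((c3 _).mul ((c4 _).mul (c6 _ _))) (cs_pd hc _).mul_right
  rw [integral_add I1 I2] at h
  rw [eq_neg_of_add_eq_zero_left h, abs_neg, ← Real.norm_eq_abs]
  have hbd : ∫ x, c * M * (|G x| + 2 * |pd G k x| + |pd G i x|)
     = c * M * ((∫ x, |G x|) + 2 * (∫ x, |pd G k x|) + ∫ x, |pd G i x|) := by
    rw [integral_const_mul, integral_add (f := fun x => |G x| + 2 * |pd G k x|) (hG0.abs.add ((hG1 k).abs.const_mul 2)) (hG1 i).abs,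
      integral_add hG0.abs ((hG1 k).abs.const_mul 2), integral_const_mul]
  rw [← hbd]
  refine norm_integral_le_of_norm_le (((hG0.abs.add ((hG1 k).abs.const_mul 2)).add (hG1 i).abs).const_mul _)
    (ae_of_all _ fun x => ?_)
  have tri : ∀ a b c' d : ℝ, |a + b - c' + d| ≤ |a| + |b| + |c'| + |d| := by
    intro a b c' d
    refine (abs_add_le _ _).trans (add_le_add_left ((abs_sub _ _).trans (add_le_add_left (abs_add_le _ _) _)) _)
  have one : ∀ a b d : ℝ, |a| ≤ c → |d| ≤ M → |a * (b * d)| ≤ c * M * |b| := by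
    intro a b d ha hd
    rw [abs_mul, abs_mul]
    calc |a| * (|b| * |d|) ≤ c * (|b| * M) := by gcongr
      _ = _ := by ring
  rw [Real.norm_eq_abs]
  refine (tri _ _ _ _).trans ?_
  have t1 := one _ (G x) _ (hcb i x) (hM3 k k j x)
  have t2 := one _ (pd G k x) _ (hcb k x) (hM2 i j x)
  have t3 := one _ (pd G k x) _ (hcb i x) (hM2 k j x)
  have t4 := one _ (pd G i x) _ (hcb k x) (hM2 k j x)
  linarith

lemma pd_lap {H : R3 → ℝ} (hH : Sm H) (j : Fin 3) : pd (lap H) j = fun x => ∑ k, pd (pd (pd H k) k) j x := by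
  funext x
  exact pd_sum (f := fun k => pd (pd H k) k) (fun k _ => (hH.pd k).pd k) j x

lemma comm_bd {χ G H : R3 → ℝ} (hχ : Sm χ) (hc : HasCompactSupport χ) (hG : Sm G) (hH : Sm H) (i j : Fin 3)
    {c M : ℝ} (hcb : ∀ l x, |pd χ l x| ≤ c) (hM2 : ∀ a b x, |pd (pd H a) b x| ≤ M)
    (hM3 : ∀ a b d x, |pd (pd (pd H a) b) d x| ≤ M) (hG0 : Integrable G) (hG1 : ∀ l, Integrable (pd G l)) {N : ℝ}
    (hN0 : ∫ x, |G x| ≤ N) (hN1 : ∀ l, ∫ x, |pd G l x| ≤ N) :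
    |∫ x, (χ x * (lap G x * pd (pd H i) j x + G x * pd (pd (lap H) i) j x)
      + 2 * (χ x * (pd G i x * pd (lap H) j x)))| ≤ 12 * (c * M * N) := by
  have hc0 : 0 ≤ c := (abs_nonneg _).trans (hcb 0 0)
  have hM0 : 0 ≤ M := (abs_nonneg _).trans (hM2 0 0 0)
  have e : ∀ x, (χ x * (lap G x * pd (pd H i) j x + G x * pd (pd (lap H) i) j x)
      + 2 * (χ x * (pd G i x * pd (lap H) j x)))
      = ∑ k, (χ x * (pd (pd G k) k x * pd (pd H i) j x + G x * pd (pd (pd (pd H k) k) i) j x)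
      + 2 * (χ x * (pd G i x * pd (pd (pd H k) k) j x))) := by
    intro x
    have e1 : pd (pd (lap H) i) j x = ∑ k, pd (pd (pd (pd H k) k) i) j x := by
      rw [pd_lap hH i]
      exact pd_sum (f := fun k => pd (pd (pd H k) k) i) (fun k _ => ((hH.pd k).pd k).pd i) j x
    rw [e1, pd_lap hH j]
    simp only [lap, Fin.sum_univ_three]
    ring
  simp_rw [e]
  rw [integral_finsetSum]
  · refine (Finset.abs_sum_le_sum_abs _ _).trans ?_
    have : ∀ k ∈ (Finset.univ : Finset (Fin 3)), |∫ x, (χ x * (pd (pd G k) k x * pd (pd H i) j x + G x * pd (pd (pd (pd H k) k) i) j x)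
      + 2 * (χ x * (pd G i x * pd (pd (pd H k) k) j x)))| ≤ 4 * (c * M * N) := by
      intro k _
      refine (comm_k_bd hχ hc hG hH i j k hcb hM2 hM3 hG0 hG1).trans ?_
      have := hN1 k
      have := hN1 i
      have : 0 ≤ c * M := by positivity
      nlinarith
    refine (Finset.sum_le_sum this).trans ?_
    simp only [Finset.sum_const, Finset.card_univ, Fintype.card_fin]
    rw [nsmul_eq_mul]; push_cast; linarith
  · intro k _
    refine Integrable.add (cs_int (hχ.cont.mul ((((hG.pd k).pd k).cont.mul ((hH.pd i).pd j).cont).add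
      (hG.cont.mul ((((hH.pd k).pd k).pd i).pd j).cont))) hc.mul_right) ?_
    exact (cs_int (hχ.cont.mul ((hG.pd i).cont.mul (((hH.pd k).pd k).pd j).cont)) hc.mul_right).const_mul 2


lemma lap_pd {f : R3 → ℝ} (hf : Sm f) (i : Fin 3) : lap (pd f i) = pd (lap f) i := by
  rw [pd_lap hf]
  funext x
  unfold lap
  refine Finset.sum_congr rfl fun k _ => ?_
  have h1 : pd (pd f i) k = pd (pd f k) i := by funext y; exact pd_comm hf i k y
  rw [h1, pd_comm (hf.pd k) i k]

lemma rg_bdd {f : R3 → ℝ} {C : ℝ} (hC : ∀ x, |f x| ≤ C) (s : ℝ) (x : R3) : |rad gam s f x| ≤ C := by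
  have := avg_bdd (T := fun z : R3 => s • z) gam_radK.hη hC x
  rwa [gam_abs, one_mul] at this

lemma rg_L1 {f : R3 → ℝ} (hf : Integrable f) (s : ℝ) :
    Integrable (rad gam s f) ∧ ∫ x, |rad gam s f x| ≤ ∫ x, |f x| := by
  have := avg_L1 (T := fun z : R3 => s • z) gam_radK.hη (meas_sm s) hf
  rwa [gam_abs, one_mul] at this

lemma fin_max (f : Fin 3 → ℝ) : ∃ C, ∀ i, f i ≤ C := by
  refine ⟨|f 0| + |f 1| + |f 2|, fun i => ?_⟩
  have := le_abs_self (f 0); have := le_abs_self (f 1); have := le_abs_self (f 2)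
  have := abs_nonneg (f 0); have := abs_nonneg (f 1); have := abs_nonneg (f 2)
  fin_cases i <;> simp <;> linarith

lemma heat_step {P Q K ε : ℝ} {B Bs Bt Bss Bst Btt : ℝ → ℝ → ℝ} (H : BellP P Q K ε B Bs Bt Bss Bst Btt)
    {A h : R3 → ℝ} (hA : Sm A) (cA : HasCompactSupport A) (hh : Sm h) (ch : HasCompactSupport h) (i j : Fin 3) :
    ∃ E, 0 ≤ E ∧ ∀ χ : R3 → ℝ, Sm χ → HasCompactSupport χ → (∀ x, 0 ≤ χ x) → ∀ c, (∀ l x, |pd χ l x| ≤ c) →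
      (∀ x, |lap χ x| ≤ c) → ∀ κ : ℝ, |κ| = 1 → ∀ σ : ℝ, 0 ≤ σ → ∃ d, d ≤ σ * (c * E) ∧
      HasDerivAt (fun σ => ∫ x, χ x * (B (rad gam σ (lap h) x) (rad gam σ A x)
        + κ * (rad gam σ A x * rad gam σ (pd (pd h i) j) x))) d σ := by
  have hg := gam_radK.hη
  have hf : Sm (lap h) := hh.lap
  have cf : HasCompactSupport (lap h) := cs_lap ch
  have hJ : Sm (pd (pd h i) j) := (hh.pd i).pd j
  have cJ : HasCompactSupport (pd (pd h i) j) := cs_pd (cs_pd ch i) j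
  obtain ⟨C1, h10, hC1⟩ := cs_bdd hf.cont cf
  obtain ⟨C2, h20, hC2⟩ := cs_bdd hA.cont cA
  obtain ⟨L, hL0, hL⟩ := bell_lip H (C1 + C2)
  have ex2 : ∀ a b, ∃ C, ∀ x, |pd (pd h a) b x| ≤ C := fun a b => by
    obtain ⟨C, _, hC⟩ := cs_bdd ((hh.pd a).pd b).cont (cs_pd (cs_pd ch a) b); exact ⟨C, hC⟩
  have ex3 : ∀ a b d, ∃ C, ∀ x, |pd (pd (pd h a) b) d x| ≤ C := fun a b d => by
    obtain ⟨C, _, hC⟩ := cs_bdd (((hh.pd a).pd b).pd d).cont (cs_pd (cs_pd (cs_pd ch a) b) d); exact ⟨C, hC⟩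
  choose m2 hm2 using ex2
  choose m3 hm3 using ex3
  have : ∃ M, (∀ a b x, |pd (pd h a) b x| ≤ M) ∧ ∀ a b d x, |pd (pd (pd h a) b) d x| ≤ M := by
    choose n2 hn2 using fun a => fin_max (m2 a)
    obtain ⟨M2, hM2⟩ := fin_max n2
    choose n3 hn3 using fun a b => fin_max (m3 a b)
    choose n4 hn4 using fun a => fin_max (n3 a)
    obtain ⟨M3, hM3⟩ := fin_max n4
    exact ⟨max M2 M3, fun a b x => (((hm2 a b x).trans (hn2 a b)).trans (hM2 a)).trans (le_max_left _ _),
      fun a b d x => ((((hm3 a b d x).trans (hn3 a b d)).trans (hn4 a b)).trans (hM3 a)).trans (le_max_right _ _)⟩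
  obtain ⟨M, hM2, hM3⟩ := this
  have hM0 : 0 ≤ M := (abs_nonneg _).trans (hM2 0 0 0)
  obtain ⟨N1, hN1⟩ := fin_max (fun l => ∫ x, |pd A l x|)
  set N := max (∫ x, |A x|) N1 with hN
  have hN0 : 0 ≤ N := le_max_of_le_left (integral_nonneg fun x => abs_nonneg _)
  have if0 : 0 ≤ ∫ x, |lap h x| := integral_nonneg fun x => abs_nonneg _
  have iA0 : 0 ≤ ∫ x, |A x| := integral_nonneg fun x => abs_nonneg _
  refine ⟨L * ((∫ x, |lap h x|) + ∫ x, |A x|) + 12 * (M * N), by positivity, ?_⟩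
  intro χ hχ cχ χ0 c hc hlc κ hκ σ hσ
  have hc0 : 0 ≤ c := (abs_nonneg _).trans (hlc 0)
  set F := fun σ => rad gam σ (lap h) with hF
  set G := fun σ => rad gam σ A with hG
  set J := fun σ => rad gam σ (pd (pd h i) j) with hJd
  have contF := rad_cont hg hf.cont cf
  have contG := rad_cont hg hA.cont cA
  have contJ := rad_cont hg hJ.cont cJ
  have contF' := rad_cont hg hf.lap.cont (cs_lap cf)
  have contG' := rad_cont hg hA.lap.cont (cs_lap cA)
  have contJ' := rad_cont hg hJ.lap.cont (cs_lap cJ)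
  have sF : ∀ s, Sm (F s) := fun s => rad_sm hg hf cf s
  have sG : ∀ s, Sm (G s) := fun s => rad_sm hg hA cA s
  have sJ : ∀ s, Sm (J s) := fun s => rad_sm hg hJ cJ s
  have sH : ∀ s, Sm (rad gam s h) := fun s => rad_sm hg hh ch s
  have sB : ∀ s, Sm (fun x => B (F s x) (G s x)) := fun s => H.sm.comp ((sF s).prodMk (sG s))
  have cBs : Continuous (fun w : ℝ × R3 => Bs (F w.1 w.2) (G w.1 w.2)) := H.cs.comp (contF.prodMk contG)
  have cBt : Continuous (fun w : ℝ × R3 => Bt (F w.1 w.2) (G w.1 w.2)) := H.ct.comp (contF.prodMk contG)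
  have key := param_deriv (χ := χ) hχ.cont cχ
    (g := fun s x => B (F s x) (G s x) + κ * (G s x * J s x))
    (g' := fun s x => Bs (F s x) (G s x) * (s * rad gam s (lap (lap h)) x) + Bt (F s x) (G s x) * (s * rad gam s (lap A) x)
      + κ * ((s * rad gam s (lap A) x) * J s x + G s x * (s * rad gam s (lap (pd (pd h i) j)) x)))
    (fun s => ((sB s).add (((sG s).mul (sJ s)).cmul κ)).cont)
    (by
      have c1 : Continuous (fun w : ℝ × R3 => w.1) := continuous_fst
      exact ((cBs.mul (c1.mul contF')).add (cBt.mul (c1.mul contG'))).add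
        (continuous_const.mul (((c1.mul contG').mul contJ).add (contG.mul (c1.mul contJ')))))
    (fun s x => by
      have d1 := rad_deriv gam_radK hf cf x s
      have d2 := rad_deriv gam_radK hA cA x s
      have d3 := rad_deriv gam_radK hJ cJ x s
      exact (H.d0 _ _ _ _ s d1 d2).add ((d2.mul d3).const_mul κ)) σ
  refine ⟨_, ?_, key⟩
  clear key
  have lapF : lap (F σ) = rad gam σ (lap (lap h)) := rad_lap hg hf cf σ
  have lapG : lap (G σ) = rad gam σ (lap A) := rad_lap hg hA cA σ
  have lapH : lap (rad gam σ h) = F σ := rad_lap hg hh ch σ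
  have H2 : ∀ a b, pd (pd (rad gam σ h) a) b = rad gam σ (pd (pd h a) b) := fun a b => by
    rw [rad_pd hg hh ch, rad_pd hg (hh.pd a) (cs_pd ch a)]
  have H3 : ∀ a b d, pd (pd (pd (rad gam σ h) a) b) d = rad gam σ (pd (pd (pd h a) b) d) := fun a b d => by
    rw [H2, rad_pd hg ((hh.pd a).pd b) (cs_pd (cs_pd ch a) b)]
  have G1 : ∀ l, pd (G σ) l = rad gam σ (pd A l) := fun l => rad_pd hg hA cA σ l
  have lapJ : rad gam σ (lap (pd (pd h i) j)) = pd (pd (lap (rad gam σ h)) i) j := by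
    rw [lap_pd (hh.pd i), lap_pd hh, lapH, hF, rad_pd hg hf cf, rad_pd hg (hf.pd i) (cs_pd cf i)]
  have iA : Integrable A := cs_int hA.cont cA
  have iA' : ∀ l, Integrable (pd A l) := fun l => cs_int (hA.pd l).cont (cs_pd cA l)
  have cb := comm_bd hχ cχ (sG σ) (sH σ) i j (c := c) (M := M) (N := N) hc
    (fun a b x => by rw [H2]; exact rg_bdd (hM2 a b) σ x)
    (fun a b d x => by rw [H3]; exact rg_bdd (hM3 a b d) σ x)
    (rg_L1 iA σ).1 (fun l => by rw [G1]; exact (rg_L1 (iA' l) σ).1)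
    (((rg_L1 iA σ).2).trans (le_max_left _ _))
    (fun l => by rw [G1]; exact (((rg_L1 (iA' l) σ).2).trans (hN1 l)).trans (le_max_right _ _))
  rw [← lapJ, H2, lapH, lapG] at cb
  have iF := rg_L1 (cs_int hf.cont cf) σ
  have iG := rg_L1 iA σ
  have lb : ∫ x, χ x * lap (fun x => B (F σ x) (G σ x)) x ≤ c * (L * ((∫ x, |lap h x|) + ∫ x, |A x|)) := by
    rw [int_lap_symm hχ (sB σ) cχ]
    calc _ ≤ ∫ x, c * (L * (|F σ x| + |G σ x|)) := by
          refine integral_mono (cs_int (hχ.lap.cont.mul (sB σ).cont) (cs_lap cχ).mul_right)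
            (((iF.1.abs.add iG.1.abs).const_mul L).const_mul c) fun x => ?_
          refine (le_abs_self _).trans ?_
          simp only [abs_mul]
          refine mul_le_mul (hlc x) (hL _ _ ?_ ?_) (abs_nonneg _) hc0
          · exact (rg_bdd hC1 σ x).trans (by linarith)
          · exact (rg_bdd hC2 σ x).trans (by linarith)
      _ = c * (L * ((∫ x, |F σ x|) + ∫ x, |G σ x|)) := by
          rw [integral_const_mul, integral_const_mul, integral_add iF.1.abs iG.1.abs]
      _ ≤ _ := by
          have := iF.2; have := iG.2
          gcongr
  have ci : ∀ {q : R3 → ℝ}, Continuous q → Integrable (fun x => χ x * q x) := fun hq =>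
    cs_int (hχ.cont.mul hq) cχ.mul_right
  have c1 : Continuous (rad gam σ (lap A)) := lapG ▸ (sG σ).lap.cont
  have c2 : Continuous (rad gam σ (lap (pd (pd h i) j))) := (rad_sm hg hJ.lap (cs_lap cJ) σ).cont
  have c3 : Continuous (rad gam σ (lap (lap h))) := lapF ▸ (sF σ).lap.cont
  set W : R3 → ℝ := fun x => (χ x * (rad gam σ (lap A) x * rad gam σ (pd (pd h i) j) x + G σ x * rad gam σ (lap (pd (pd h i) j)) x)
      + 2 * (χ x * (pd (G σ) i x * pd (F σ) j x))) with hW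
  have iW : Integrable W :=
    (ci ((c1.mul (sJ σ).cont).add ((sG σ).cont.mul c2))).add ((ci (((sG σ).pd i).cont.mul ((sF σ).pd j).cont)).const_mul 2)
  have ilb := ci (sB σ).lap.cont
  calc _ ≤ ∫ x, σ * (χ x * lap (fun x => B (F σ x) (G σ x)) x + κ * W x) := by
        refine integral_mono (ci ?_) ((ilb.add (iW.const_mul κ)).const_mul σ) fun x => ?_
        · have cBs' := cBs.comp (by fun_prop : Continuous fun x : R3 => (σ, x))
          have cBt' := cBt.comp (by fun_prop : Continuous fun x : R3 => (σ, x))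
          exact ((cBs'.mul (continuous_const.mul c3)).add (cBt'.mul (continuous_const.mul c1))).add
            (continuous_const.mul (((continuous_const.mul c1).mul (sJ σ).cont).add ((sG σ).cont.mul (continuous_const.mul c2))))
        · have bl := bell_lap H (sF σ) (sG σ) i j x
          rw [lapF, lapG] at bl
          have hy : -(pd (G σ) i x * pd (F σ) j x) * κ ≤ |pd (G σ) i x * pd (F σ) j x| := by
            refine (le_abs_self _).trans ?_
            rw [abs_mul, abs_neg, hκ, mul_one]
          have := mul_le_mul_of_nonneg_left bl (χ0 x)
          have h2 := mul_le_mul_of_nonneg_left hy (χ0 x)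
          simp only [hW]
          have := mul_le_mul_of_nonneg_left (show χ x * (Bs (F σ x) (G σ x) * rad gam σ (lap (lap h)) x
              + Bt (F σ x) (G σ x) * rad gam σ (lap A) x)
              - 2 * (χ x * (pd (G σ) i x * pd (F σ) j x)) * κ ≤ χ x * lap (fun x => B (F σ x) (G σ x)) x by
                linarith) hσ
          simp only [hJd]
          nlinarith
    _ = σ * ((∫ x, χ x * lap (fun x => B (F σ x) (G σ x)) x) + κ * ∫ x, W x) := by
        rw [integral_const_mul, integral_add ilb (iW.const_mul κ), integral_const_mul]
    _ ≤ _ := by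
        refine mul_le_mul_of_nonneg_left ?_ hσ
        have : κ * ∫ x, W x ≤ 12 * (c * M * N) := by
          refine (le_abs_self _).trans ?_
          rw [abs_mul, hκ, one_mul]; exact cb
        linarith


lemma mono_bd {φ : ℝ → ℝ} {D : ℝ} (h : ∀ σ : ℝ, 0 ≤ σ → ∃ d, d ≤ σ * D ∧ HasDerivAt φ d σ) {S : ℝ} (hS : 0 ≤ S) :
    φ S ≤ φ 0 + D * S ^ 2 / 2 := by
  choose! d hd hd' using h
  have dv : ∀ σ, 0 ≤ σ → HasDerivAt (fun σ => φ σ - D * σ ^ 2 / 2) (d σ - D * (2 * σ) / 2) σ := fun σ hσ => by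
    have h2 : HasDerivAt (fun σ : ℝ => D * σ ^ 2 / 2) (D * (2 * σ) / 2) σ := by
      have := ((hasDerivAt_pow 2 σ).const_mul D).div_const 2
      simpa using this
    exact (hd' σ hσ).sub h2
  have : AntitoneOn (fun σ => φ σ - D * σ ^ 2 / 2) (Set.Ici 0) := by
    refine antitoneOn_of_hasDerivWithinAt_nonpos (convex_Ici 0) (f' := fun σ => d σ - D * (2 * σ) / 2) ?_ ?_ ?_
    · exact fun σ hσ => (dv σ hσ).continuousAt.continuousWithinAt
    · intro σ hσ
      rw [interior_Ici] at hσ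
      exact (dv σ (le_of_lt hσ)).hasDerivWithinAt
    · intro σ hσ
      rw [interior_Ici] at hσ
      have := hd σ (le_of_lt hσ)
      linarith
  have := this Set.self_mem_Ici (show S ∈ Set.Ici (0:ℝ) from hS) hS
  simp only at this
  linarith

lemma heat_S {P Q K ε : ℝ} {B Bs Bt Bss Bst Btt : ℝ → ℝ → ℝ} (H : BellP P Q K ε B Bs Bt Bss Bst Btt)
    {A h : R3 → ℝ} (hA : Sm A) (cA : HasCompactSupport A) (hh : Sm h) (ch : HasCompactSupport h) (i j : Fin 3) :
    ∃ E C, 0 ≤ E ∧ 0 ≤ C ∧ ∀ χ : R3 → ℝ, Sm χ → HasCompactSupport χ → (∀ x, 0 ≤ χ x) → (∀ x, χ x ≤ 1) →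
      ∀ c, (∀ l x, |pd χ l x| ≤ c) →
      (∀ x, |lap χ x| ≤ c) → ∀ S : ℝ, 0 < S →
      |∫ x, χ x * (A x * pd (pd h i) j x)| ≤ (∫ x, χ x * B (lap h x) (A x)) + C * (S ^ 3)⁻¹ + c * E * S ^ 2 / 2 := by
  obtain ⟨E, hE, hst⟩ := heat_step H hA cA hh ch i j
  have hg := gam_radK.hη
  have hJ : Sm (pd (pd h i) j) := (hh.pd i).pd j
  have cJ : HasCompactSupport (pd (pd h i) j) := cs_pd (cs_pd ch i) j
  have hf : Sm (lap h) := hh.lap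
  have cf : HasCompactSupport (lap h) := cs_lap ch
  have gi : 0 ≤ (∫ z, gau0 z)⁻¹ := (inv_pos.2 gau0_ipos).le
  have J0 : 0 ≤ ∫ z, |pd (pd h i) j z| := integral_nonneg fun x => abs_nonneg _
  have A0 : 0 ≤ ∫ z, |A z| := integral_nonneg fun x => abs_nonneg _
  refine ⟨E, (∫ z, |A z|) * ((∫ z, gau0 z)⁻¹ * ∫ z, |pd (pd h i) j z|), hE, by positivity, ?_⟩
  intro χ hχ cχ χ0 χ1 c hc hlc S hS
  have iA := cs_int hA.cont cA
  have ci : ∀ {q : R3 → ℝ}, Continuous q → Integrable (fun x => χ x * q x) := fun hq =>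
    cs_int (hχ.cont.mul hq) cχ.mul_right
  have sG := rad_sm hg hA cA S
  have sJ := rad_sm hg hJ cJ S
  have sF := rad_sm hg hf cf S
  have tail : |∫ x, χ x * (rad gam S A x * rad gam S (pd (pd h i) j) x)|
      ≤ (∫ z, |A z|) * ((∫ z, gau0 z)⁻¹ * ∫ z, |pd (pd h i) j z|) * (S ^ 3)⁻¹ := by
    rw [← Real.norm_eq_abs]
    set D := (∫ z, gau0 z)⁻¹ * ((S ^ 3)⁻¹ * ∫ z, |pd (pd h i) j z|) with hD
    have hD0 : 0 ≤ D := by positivity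
    calc _ ≤ ∫ x, |rad gam S A x| * D := by
          refine norm_integral_le_of_norm_le ((rg_L1 iA S).1.abs.mul_const _) (ae_of_all _ fun x => ?_)
          rw [Real.norm_eq_abs, abs_mul, abs_mul, abs_of_nonneg (χ0 x)]
          have := gam_decay hJ.cont cJ hS x
          calc χ x * (|rad gam S A x| * |rad gam S (pd (pd h i) j) x|) ≤ 1 * (|rad gam S A x| * D) := by
                gcongr
                exact χ1 x
            _ = _ := one_mul _
      _ = (∫ x, |rad gam S A x|) * D := integral_mul_const _ _
      _ ≤ (∫ z, |A z|) * D := by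
          have := (rg_L1 iA S).2
          gcongr
      _ = _ := by rw [hD]; ring
  have main : ∀ κ : ℝ, |κ| = 1 → -κ * ∫ x, χ x * (A x * pd (pd h i) j x) ≤ (∫ x, χ x * B (lap h x) (A x))
      + (∫ z, |A z|) * ((∫ z, gau0 z)⁻¹ * ∫ z, |pd (pd h i) j z|) * (S ^ 3)⁻¹ + c * E * S ^ 2 / 2 := by
    intro κ hκ
    have := mono_bd (hst χ hχ cχ χ0 c hc hlc κ hκ) hS.le
    simp only [rad_zero gam_one] at this
    have split : ∀ (b y : R3 → ℝ), Continuous b → Continuous y → ∫ x, χ x * (b x + κ * y x)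
        = (∫ x, χ x * b x) + κ * ∫ x, χ x * y x := by
      intro b y hb hy
      rw [← integral_const_mul, ← integral_add (ci hb) ((ci hy).const_mul κ)]
      exact integral_congr_ae (ae_of_all _ fun x => by simp only []; ring)
    rw [split (fun x => B (rad gam S (lap h) x) (rad gam S A x)) (fun x => rad gam S A x * rad gam S (pd (pd h i) j) x)
      (H.sm.continuous.comp (sF.cont.prodMk sG.cont)) (sG.cont.mul sJ.cont),
      split (fun x => B (lap h x) (A x)) (fun x => A x * (pd (pd h i) j) x)
      (H.sm.continuous.comp (hf.cont.prodMk hA.cont)) (hA.cont.mul hJ.cont)] at this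
    have b0 : 0 ≤ ∫ x, χ x * B (rad gam S (lap h) x) (rad gam S A x) :=
      integral_nonneg fun x => mul_nonneg (χ0 x) (H.lo _ _)
    have t2 : -(κ * ∫ x, χ x * (rad gam S A x * rad gam S (pd (pd h i) j) x)) ≤ _ :=
      ((neg_le_abs _).trans (by rw [abs_mul, hκ, one_mul])).trans tail
    linarith
  rw [abs_le]
  have m1 := main 1 (by simp)
  have m2 := main (-1) (by simp)
  constructor <;> linarith

lemma bump_ex : ∃ χ : R3 → ℝ, ∃ c, 0 ≤ c ∧ Sm χ ∧ HasCompactSupport χ ∧ (∀ x, 0 ≤ χ x) ∧ (∀ x, χ x ≤ 1) ∧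
    (∀ x, ‖x‖ ≤ 1 → χ x = 1) ∧ (∀ l x, |pd χ l x| ≤ c) ∧ (∀ x, |lap χ x| ≤ c) := by
  let f : ContDiffBump (0 : R3) := ⟨1, 2, by norm_num, by norm_num⟩
  have sf : Sm (f : R3 → ℝ) := f.contDiff
  have cf : HasCompactSupport (f : R3 → ℝ) := f.hasCompactSupport
  choose c hc0 hc using fun l => cs_bdd (sf.pd l).cont (cs_pd cf l)
  obtain ⟨C, hC⟩ := fin_max c
  obtain ⟨C', h0, hC'⟩ := cs_bdd sf.lap.cont (cs_lap cf)
  refine ⟨f, max C C', le_max_of_le_right h0, sf, cf, fun x => f.nonneg, fun x => f.le_one,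
    fun x hx => f.one_of_mem_closedBall (by simpa using hx),
    fun l x => ((hc l x).trans (hC l)).trans (le_max_left _ _), fun x => (hC' x).trans (le_max_right _ _)⟩

lemma lap_aff {g : R3 → ℝ} (hg : Sm g) (s : ℝ) (z : R3) :
    lap (fun z => g (0 + s • z)) z = s ^ 2 * lap g (0 + s • z) := by
  unfold lap
  rw [Finset.mul_sum]
  refine Finset.sum_congr rfl fun j _ => ?_
  have : pd (fun z => g (0 + s • z)) j = fun z => s * pd g j (0 + s • z) := funext fun z => pd_aff g hg 0 s j z
  rw [this, pd_cmul s (sm_aff (hg.pd j) 0 s), pd_aff _ (hg.pd j)]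
  ring

lemma cz_bell {P Q K ε : ℝ} {B Bs Bt Bss Bst Btt : ℝ → ℝ → ℝ} (H : BellP P Q K ε B Bs Bt Bss Bst Btt)
    {A h : R3 → ℝ} (hA : Sm A) (cA : HasCompactSupport A) (hh : Sm h) (ch : HasCompactSupport h) (i j : Fin 3)
    {ρ : ℝ} (hρ : 0 < ρ) (sA : ∀ x, ρ < ‖x‖ → A x = 0) (sh : ∀ x, ρ < ‖x‖ → lap h x = 0) :
    |∫ x, A x * pd (pd h i) j x| ≤ ∫ x in closedBall 0 ρ, B (lap h x) (A x) := by
  obtain ⟨E, C, hE, hC, hS⟩ := heat_S H hA cA hh ch i j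
  obtain ⟨χ, c, hc0, hχ, cχ, χ0, χ1, χe, χp, χl⟩ := bump_ex
  refine le_of_forall_pos_le_add fun e he => ?_
  -- choose S
  obtain ⟨S, hS0, hSe⟩ : ∃ S : ℝ, 0 < S ∧ C * (S ^ 3)⁻¹ ≤ e / 2 := by
    have hx : 1 ≤ 1 + 2 * C / e := by have : 0 ≤ 2 * C / e := by positivity
                                      linarith
    refine ⟨1 + 2 * C / e, by linarith, ?_⟩
    have h3 : (1 + 2 * C / e) ≤ (1 + 2 * C / e) ^ 3 := le_self_pow₀ hx (by norm_num)
    rw [← div_eq_mul_inv, div_le_iff₀ (by positivity)]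
    have : e / 2 * (1 + 2 * C / e) = e / 2 + C := by field_simp
    have := mul_le_mul_of_nonneg_left h3 (by positivity : 0 ≤ e / 2)
    linarith
  obtain ⟨τ, hτ0, hτ1, hτρ, hτe⟩ : ∃ τ : ℝ, 0 < τ ∧ τ ≤ 1 ∧ τ * ρ ≤ 1 ∧ τ * c * E * S ^ 2 / 2 ≤ e / 2 := by
    set D := c * E * S ^ 2 with hD
    have hD0 : 0 ≤ D := by positivity
    have hb : 0 < 1 + ρ + D / e := by positivity
    have hDe : 0 ≤ D / e := by positivity
    refine ⟨(1 + ρ + D / e)⁻¹, by positivity, inv_le_one_of_one_le₀ (by linarith), ?_, ?_⟩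
    · rw [inv_mul_le_iff₀ hb]; linarith
    · have : (1 + ρ + D / e)⁻¹ * D ≤ e := by
        rw [inv_mul_le_iff₀ hb]
        have : (1 + ρ + D / e) * e = e + ρ * e + D := by field_simp
        have : 0 ≤ ρ * e := by positivity
        linarith
      rw [show (1 + ρ + D / e)⁻¹ * c * E * S ^ 2 = (1 + ρ + D / e)⁻¹ * D by rw [hD]; ring]
      linarith
  have st : Sm (fun x => χ (0 + τ • x)) := sm_aff hχ 0 τ
  have ct : HasCompactSupport (fun x => χ (0 + τ • x)) := by
    simp only [zero_add]
    exact cχ.comp_smul hτ0.ne'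
  have key := hS _ st ct (fun x => χ0 _) (fun x => χ1 _) (τ * c)
    (fun l x => by
      rw [pd_aff _ hχ, abs_mul, abs_of_pos hτ0]
      exact mul_le_mul_of_nonneg_left (χp _ _) hτ0.le)
    (fun x => by
      rw [lap_aff hχ, abs_mul, abs_of_pos (by positivity)]
      have : τ ^ 2 ≤ τ := by nlinarith
      exact mul_le_mul this (χl _) (abs_nonneg _) hτ0.le) S hS0
  have one : ∀ x : R3, ‖x‖ ≤ ρ → χ (0 + τ • x) = 1 := fun x hx => χe _ (by
    rw [zero_add, norm_smul, Real.norm_eq_abs, abs_of_pos hτ0]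
    exact (mul_le_mul_of_nonneg_left hx hτ0.le).trans hτρ)
  have e1 : ∫ x, χ (0 + τ • x) * (A x * pd (pd h i) j x) = ∫ x, A x * pd (pd h i) j x := by
    refine integral_congr_ae (ae_of_all _ fun x => ?_)
    by_cases hx : ρ < ‖x‖
    · simp [sA x hx]
    · simp only [one x (not_lt.1 hx), one_mul]
  have e2 : ∫ x, χ (0 + τ • x) * B (lap h x) (A x) = ∫ x in closedBall 0 ρ, B (lap h x) (A x) := by
    rw [← integral_indicator measurableSet_closedBall]
    refine integral_congr_ae (ae_of_all _ fun x => ?_)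
    by_cases hx : ρ < ‖x‖
    · have : x ∉ closedBall (0:R3) ρ := by simpa using hx
      simp [sA x hx, sh x hx, H.zero, Set.indicator_of_notMem this]
    · have : x ∈ closedBall (0:R3) ρ := by simpa using hx
      simp only [one x (not_lt.1 hx), Set.indicator_of_mem this, one_mul]
  rw [e1, e2] at key
  linarith

lemma cs_rad {f : R3 → ℝ} (hc : HasCompactSupport f) : ∃ ρ, 0 < ρ ∧ ∀ x, ρ < ‖x‖ → f x = 0 := by
  obtain ⟨ρ, h⟩ := hc.isCompact.isBounded.subset_closedBall 0
  refine ⟨max ρ 1, by positivity, fun x hx => ?_⟩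
  by_contra hne
  have := h (subset_tsupport f hne)
  rw [mem_closedBall_zero_iff] at this
  exact absurd ((le_max_left ρ 1).trans_lt hx) (not_lt.2 this)

lemma cz0 {p q : ℝ} (hp : 2 < p) (hq : q = p / (p - 1)) : ∃ K, 0 ≤ K ∧ ∀ A h : R3 → ℝ, Sm A → HasCompactSupport A →
    Sm h → HasCompactSupport h → ∀ i j, |∫ x, A x * pd (pd h i) j x| ≤ (∫ x, |lap h x| ^ p) + (K + 1) * ∫ x, |A x| ^ q := by
  have hq1 : 1 < q := by rw [hq, lt_div_iff₀ (by linarith)]; linarith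
  have hq2 : q < 2 := by rw [hq, div_lt_iff₀ (by linarith)]; linarith
  have hqp : q / p = q - 1 := by
    rw [hq]; have : p - 1 ≠ 0 := by linarith
    field_simp; ring
  obtain ⟨K, hK, hB⟩ := bell_exists (P := p / 2) (Q := q / 2) (by linarith) (by linarith) (by linarith)
    (by rw [div_div_div_cancel_right₀ (by norm_num)]; linarith)
  refine ⟨K, hK, fun A h hA cA hh ch i j => ?_⟩
  obtain ⟨ρ1, h1, sA⟩ := cs_rad cA
  obtain ⟨ρ2, h2, sh⟩ := cs_rad (cs_lap ch)
  set ρ := max ρ1 ρ2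
  have hρ : 0 < ρ := lt_max_of_lt_left h1
  have sA' : ∀ x : R3, ρ < ‖x‖ → A x = 0 := fun x hx => sA x ((le_max_left _ _).trans_lt hx)
  have sh' : ∀ x : R3, ρ < ‖x‖ → lap h x = 0 := fun x hx => sh x ((le_max_right _ _).trans_lt hx)
  have hf := hh.lap
  set Φ : ℝ → R3 → ℝ := fun ε x => ((lap h x) ^ 2 + ε ^ 2) ^ (p / 2) + (K + 1) * ((A x) ^ 2 + ε ^ 2) ^ (q / 2) with hΦ
  have cΦ : Continuous (Function.uncurry Φ) := by
    have a1 : Continuous (fun w : ℝ × R3 => (lap h w.2) ^ 2 + w.1 ^ 2) :=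
      ((hf.cont.comp continuous_snd).pow 2).add (continuous_fst.pow 2)
    have a2 : Continuous (fun w : ℝ × R3 => (A w.2) ^ 2 + w.1 ^ 2) :=
      ((hA.cont.comp continuous_snd).pow 2).add (continuous_fst.pow 2)
    exact (a1.rpow_const (fun _ => Or.inr (by linarith))).add
      (continuous_const.mul (a2.rpow_const (fun _ => Or.inr (by linarith))))
  have cI : Continuous (fun ε => ∫ x in closedBall (0:R3) ρ, Φ ε x) :=
    continuous_parametric_integral_of_continuous cΦ (isCompact_closedBall _ _)
  have le : ∀ ε, 0 < ε → |∫ x, A x * pd (pd h i) j x| ≤ ∫ x in closedBall (0:R3) ρ, Φ ε x := by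
    intro ε hε
    obtain ⟨B, Bs, Bt, Bss, Bst, Btt, H⟩ := hB ε hε
    refine (cz_bell H hA cA hh ch i j hρ sA' sh').trans ?_
    refine setIntegral_mono ?_ ?_ fun x => H.hi _ _
    · exact (H.sm.continuous.comp (hf.cont.prodMk hA.cont)).continuousOn.integrableOn_compact (isCompact_closedBall _ _)
    · exact (cΦ.comp (by fun_prop : Continuous fun x : R3 => (ε, x))).continuousOn.integrableOn_compact (isCompact_closedBall _ _)
  have lim := ge_of_tendsto (b := |∫ x, A x * pd (pd h i) j x|)
    ((cI.tendsto 0).mono_left (nhdsWithin_le_nhds (s := Set.Ioi 0)))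
    (by filter_upwards [self_mem_nhdsWithin] with ε hε using le ε hε)
  refine lim.trans (le_of_eq ?_)
  have sq : ∀ (a r : ℝ), (a ^ 2) ^ (r / 2) = |a| ^ r := by
    intro a r
    rw [← sq_abs, ← Real.rpow_natCast, ← Real.rpow_mul (abs_nonneg a)]
    congr 1; push_cast; ring
  have i1 : Integrable (fun x => |lap h x| ^ p) := by
    refine cs_int (hf.cont.abs.rpow_const fun _ => Or.inr (by linarith)) ?_
    exact (cs_lap ch).comp_left (g := fun t => |t| ^ p) (by simp only [abs_zero]; exact Real.zero_rpow (by linarith))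
  have i2 : Integrable (fun x => |A x| ^ q) := by
    refine cs_int (hA.cont.abs.rpow_const fun _ => Or.inr (by linarith)) ?_
    exact cA.comp_left (g := fun t => |t| ^ q) (by simp only [abs_zero]; exact Real.zero_rpow (by linarith))
  rw [← integral_const_mul, ← integral_add i1 (i2.const_mul _), ← integral_indicator measurableSet_closedBall]
  refine integral_congr_ae (ae_of_all _ fun x => ?_)
  simp only [hΦ]
  by_cases hx : ρ < ‖x‖
  · have : x ∉ closedBall (0:R3) ρ := by simpa using hx
    rw [Set.indicator_of_notMem this, sA' x hx, sh' x hx]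
    rw [abs_zero, Real.zero_rpow (by linarith), Real.zero_rpow (by linarith)]; simp
  · have : x ∈ closedBall (0:R3) ρ := by simpa using hx
    rw [Set.indicator_of_mem this]
    simp [sq]

lemma cz {p q : ℝ} (hp : 2 < p) (hq : q = p / (p - 1)) : ∃ C, 0 ≤ C ∧ ∀ A h : R3 → ℝ, Sm A → HasCompactSupport A →
    Sm h → HasCompactSupport h → ∀ i j, |∫ x, A x * pd (pd h i) j x|
      ≤ C * ((∫ x, |A x| ^ q) ^ (1 / q) * (∫ x, |lap h x| ^ p) ^ (1 / p)) := by
  obtain ⟨K, hK, h0⟩ := cz0 hp hq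
  have hq1 : 1 < q := by rw [hq, lt_div_iff₀ (by linarith)]; linarith
  refine ⟨K + 2, by linarith, fun A h hA cA hh ch i j => ?_⟩
  set a := ∫ x, |A x| ^ q with ha
  set b := ∫ x, |lap h x| ^ p with hb
  have a0 : 0 ≤ a := integral_nonneg fun x => by positivity
  have b0 : 0 ≤ b := integral_nonneg fun x => by positivity
  set I := ∫ x, A x * pd (pd h i) j x with hI
  have le : ∀ ε, 0 < ε → |I| ≤ (K + 2) * ((a + ε) ^ (1 / q) * (b + ε) ^ (1 / p)) := by
    intro ε hε
    set X := (a + ε) ^ (1 / q) with hX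
    set Y := (b + ε) ^ (1 / p) with hY
    have X0 : 0 < X := by positivity
    have Y0 : 0 < Y := by positivity
    have Xq : X ^ q = a + ε := by
      rw [hX, ← Real.rpow_mul (by positivity), one_div_mul_cancel (by linarith), Real.rpow_one]
    have Yp : Y ^ p = b + ε := by
      rw [hY, ← Real.rpow_mul (by positivity), one_div_mul_cancel (by linarith), Real.rpow_one]
    have := h0 (fun x => X⁻¹ * A x) (fun x => Y⁻¹ * h x) (hA.cmul _) cA.mul_left (hh.cmul _) ch.mul_left i j
    have p1 : ∀ f : R3 → ℝ, Sm f → ∀ l, pd (fun x => Y⁻¹ * f x) l = fun x => Y⁻¹ * pd f l x :=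
      fun f hf l => funext fun x => pd_cmul _ hf l x
    have lp : ∀ x, lap (fun x => Y⁻¹ * h x) x = Y⁻¹ * lap h x := by
      intro x
      unfold lap
      rw [Finset.mul_sum]
      refine Finset.sum_congr rfl fun l _ => ?_
      rw [p1 _ hh, p1 _ (hh.pd l)]
    simp only [p1 _ hh, p1 _ (hh.pd i), lp] at this
    have r1 : ∀ x, |Y⁻¹ * lap h x| ^ p = (b + ε)⁻¹ * |lap h x| ^ p := fun x => by
      rw [abs_mul, abs_of_pos (inv_pos.2 Y0), Real.mul_rpow (by positivity) (by positivity), Real.inv_rpow Y0.le, Yp]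
    have r2 : ∀ x, |X⁻¹ * A x| ^ q = (a + ε)⁻¹ * |A x| ^ q := fun x => by
      rw [abs_mul, abs_of_pos (inv_pos.2 X0), Real.mul_rpow (by positivity) (by positivity), Real.inv_rpow X0.le, Xq]
    simp only [r1, r2, integral_const_mul] at this
    rw [show (∫ x, X⁻¹ * A x * (Y⁻¹ * pd (pd h i) j x)) = (X * Y)⁻¹ * I by
      rw [hI, ← integral_const_mul]
      refine integral_congr_ae (ae_of_all _ fun x => ?_)
      simp only [mul_inv]; ring, abs_mul, abs_of_pos (by positivity)] at this
    rw [← ha, ← hb] at this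
    have u1 : (b + ε)⁻¹ * b ≤ 1 := by rw [inv_mul_le_iff₀ (by positivity)]; linarith
    have u2 : (a + ε)⁻¹ * a ≤ 1 := by rw [inv_mul_le_iff₀ (by positivity)]; linarith
    have u3 := mul_le_mul_of_nonneg_left u2 (by linarith : 0 ≤ K + 1)
    have u4 : (X * Y)⁻¹ * |I| ≤ K + 2 := by linarith
    rw [inv_mul_le_iff₀ (by positivity)] at u4
    linarith
  have cI : Continuous (fun ε : ℝ => (K + 2) * ((a + ε) ^ (1 / q) * (b + ε) ^ (1 / p))) := by
    refine continuous_const.mul (((continuous_const.add continuous_id).rpow_const fun _ => Or.inr ?_).mul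
      ((continuous_const.add continuous_id).rpow_const fun _ => Or.inr ?_))
    · have : 0 < q := by linarith
      positivity
    · have : 0 < p := by linarith
      positivity
  have lim := ge_of_tendsto (b := |I|)
    ((cI.tendsto 0).mono_left (nhdsWithin_le_nhds (s := Set.Ioi 0)))
    (by filter_upwards [self_mem_nhdsWithin] with ε hε using le ε hε)
  simpa using lim


lemma cs_of_norm {f : R3 → ℝ} {r : ℝ} (h : ∀ x, r < ‖x‖ → f x = 0) : HasCompactSupport f := by
  refine HasCompactSupport.intro (isCompact_closedBall (0:R3) r) fun x hx => h x ?_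
  simpa using hx

lemma ker_ex : ∃ η ζ : R3 → ℝ, RadK η ζ ∧ Sm η ∧ ∫ z, η z = 1 ∧ (∀ z, 1 ≤ ‖z‖ → η z = 0) ∧ (∀ z, 1 ≤ ‖z‖ → ζ z = 0) := by
  set e : ℝ → ℝ := fun t => Real.smoothTransition (1 - t) with he
  have se : ContDiff ℝ (⊤ : ℕ∞) e := Real.smoothTransition.contDiff.comp (contDiff_const.sub contDiff_id)
  have e1 : ∀ t, 1 ≤ t → e t = 0 := fun t ht => Real.smoothTransition.zero_of_nonpos (by linarith)
  set Z : ℝ → ℝ := fun t => ∫ r in t..1, e r with hZ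
  have dZ : ∀ t, HasDerivAt Z (-e t) t := fun t =>
    intervalIntegral.integral_hasDerivAt_left (se.continuous.intervalIntegrable _ _)
      se.continuous.stronglyMeasurable.stronglyMeasurableAtFilter se.continuous.continuousAt
  have sZ : ContDiff ℝ (⊤ : ℕ∞) Z := by
    refine contDiff_infty_iff_deriv.2 ⟨fun t => (dZ t).differentiableAt, ?_⟩
    rw [show deriv Z = fun t => -e t from funext fun t => (dZ t).deriv]
    exact se.neg
  have Z1 : ∀ t, 1 ≤ t → Z t = 0 := fun t ht => by
    rw [hZ]
    simp only
    rw [intervalIntegral.integral_congr (g := fun _ => (0:ℝ))]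
    · simp
    · intro r hr
      rw [Set.uIcc_of_ge ht] at hr
      exact e1 r hr.1
  set η0 : R3 → ℝ := fun z => e (‖z‖ ^ 2) with hη0
  set ζ0 : R3 → ℝ := fun z => (1 / 2) * Z (‖z‖ ^ 2) with hζ0
  have s1 : Sm η0 := se.comp (contDiff_norm_sq ℝ)
  have s2 : Sm ζ0 := contDiff_const.mul (sZ.comp (contDiff_norm_sq ℝ))
  have v1 : ∀ z, 1 ≤ ‖z‖ → η0 z = 0 := fun z hz => e1 _ (one_le_pow₀ hz)
  have v2 : ∀ z, 1 ≤ ‖z‖ → ζ0 z = 0 := fun z hz => by simp only [hζ0, Z1 _ (one_le_pow₀ hz), mul_zero]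
  have c1 : HasCompactSupport η0 := cs_of_norm fun x hx => v1 x hx.le
  have c2 : HasCompactSupport ζ0 := cs_of_norm fun x hx => v2 x hx.le
  have hd : ∀ j z, pd ζ0 j z = -(z j * η0 z) := fun j z => by
    have h1 := ((dZ (‖z‖ ^ 2)).comp_hasFDerivAt z (pd_normsq j z)).const_mul (1 / 2)
    have h2 : HasFDerivAt ζ0 _ z := h1
    unfold pd
    rw [h2.fderiv]
    have := innerSL_single j z
    simp only [smul_apply, this, smul_eq_mul, nsmul_eq_mul]
    push_cast
    simp only [hη0]
    ring
  have i1 := cs_int s1.cont c1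
  have pos : 0 < ∫ z, η0 z := by
    refine (integral_pos_iff_support_of_nonneg (fun z => Real.smoothTransition.nonneg _) i1).2 ?_
    refine (measure_ball_pos volume (0:R3) one_pos).trans_le (measure_mono fun z hz => ?_)
    rw [mem_ball_zero_iff] at hz
    have : ‖z‖ ^ 2 < 1 := by have := norm_nonneg z; nlinarith
    exact (Real.smoothTransition.pos_of_pos (by linarith)).ne'
  set N := (∫ z, η0 z)⁻¹ with hN
  refine ⟨fun z => N * η0 z, fun z => N * ζ0 z, ?_, s1.cmul N, ?_, fun z hz => by simp only [v1 z hz, mul_zero],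
    fun z hz => by simp only [v2 z hz, mul_zero]⟩
  · exact { hη := i1.const_mul N
            hη1 := cs_int (continuous_norm.mul (s1.cmul N).cont) (c1.mul_left.mul_left)
            hζ := (cs_int s2.cont c2).const_mul N
            sζ := s2.cmul N
            cη := (s1.cmul N).cont
            hd := fun j z => by rw [pd_cmul _ s2, hd]; ring }
  · rw [integral_const_mul, hN, inv_mul_cancel₀ pos.ne']

lemma avg_vanish {Ω : Type} [MeasurableSpace Ω] {μ : Measure Ω} {k : Ω → ℝ} {T : Ω → R3} {f : R3 → ℝ} {x : R3}
    (h : ∀ ω, k ω ≠ 0 → f (x + T ω) = 0) : avg μ k T f x = 0 := by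
  unfold avg
  refine integral_eq_zero_of_ae (ae_of_all _ fun ω => ?_)
  by_cases hk : k ω = 0
  · simp [hk]
  · simp [h ω hk]

/-- compact parametrix -/
lemma par {η ζ : R3 → ℝ} (H : RadK η ζ) (h1 : ∫ z, η z = 1) (vζ : ∀ z, 1 ≤ ‖z‖ → ζ z = 0) {δ : ℝ} (hδ : 0 < δ)
    {g : R3 → ℝ} (hg : Sm g) (cg : HasCompactSupport g) : ∃ h : R3 → ℝ, Sm h ∧
    (∀ x, (∀ y, ‖y - x‖ ≤ δ → g y = 0) → h x = 0) ∧ ∀ x, lap h x = g x - rad η δ g x := by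
  set k1 : ℝ → ℝ := fun t => (Set.Ioc 0 δ).indicator (fun t => -t) t with hk1
  set k : ℝ × R3 → ℝ := fun w => k1 w.1 * ζ w.2 with hk
  have ik1 : Integrable k1 := by
    rw [hk1, integrable_indicator_iff measurableSet_Ioc]
    exact (continuous_neg.intervalIntegrable 0 δ).1
  have ik : Integrable k (volume.prod volume) := ik1.mul_prod H.hζ
  set T : ℝ × R3 → R3 := fun w => w.1 • w.2 with hT
  have mT : Measurable T := (by fun_prop : Continuous T).measurable
  refine ⟨avg (volume.prod volume) k T g, avg_sm ik mT.aemeasurable hg cg, ?_, ?_⟩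
  · intro x hx
    refine avg_vanish fun w hw => hx _ ?_
    have ha : k1 w.1 ≠ 0 := left_ne_zero_of_mul hw
    have hb : ζ w.2 ≠ 0 := right_ne_zero_of_mul hw
    have hm : w.1 ∈ Set.Ioc 0 δ := Set.mem_of_indicator_ne_zero ha
    have hz : ‖w.2‖ < 1 := not_le.1 fun h => hb (vζ _ h)
    rw [add_sub_cancel_left, hT]
    simp only
    rw [norm_smul, Real.norm_eq_abs, abs_of_pos hm.1]
    have := norm_nonneg w.2
    nlinarith [hm.1, hm.2]
  · intro x
    rw [avg_lap ik mT.aemeasurable hg cg]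
    have hi := avg_int ik mT.aemeasurable hg.lap.cont (cs_lap cg) x
    unfold avg
    rw [integral_prod _ hi]
    have e1 : ∀ t, ∫ y, k (t, y) * lap g (x + T (t, y)) = (Set.Ioc 0 δ).indicator (fun t => -(t * rad ζ t (lap g) x)) t := by
      intro t
      simp only [hk, hT, hk1, rad, avg]
      by_cases ht : t ∈ Set.Ioc 0 δ
      · simp only [Set.indicator_of_mem ht]
        rw [← integral_const_mul, ← integral_neg]
        exact integral_congr_ae (ae_of_all _ fun y => by simp only []; ring)
      · simp [Set.indicator_of_notMem ht]
    simp only [e1]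
    rw [integral_indicator measurableSet_Ioc, ← intervalIntegral.integral_of_le hδ.le]
    have cc : Continuous (fun t => t * rad ζ t (lap g) x) :=
      continuous_id.mul ((rad_cont H.hζ hg.lap.cont (cs_lap cg)).comp (by fun_prop : Continuous fun t : ℝ => (t, x)))
    rw [intervalIntegral.integral_neg, intervalIntegral.integral_eq_sub_of_hasDerivAt
      (f := fun s => rad η s g x) (fun t _ => rad_deriv H hg cg x t) (cc.intervalIntegrable _ _), rad_zero h1]
    ring

/-- segment fields -/
lemma seg {f : R3 → ℝ} (hf : Sm f) (cf : HasCompactSupport f) {δ M D : ℝ} (vf : ∀ z, δ ≤ ‖z‖ → f z = 0)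
    (hM1 : ∀ j x, |pd f j x| ≤ M) (hM2 : ∀ x, |lap f x| ≤ M) {Q : Set R3} (hQ : Convex ℝ Q)
    {g : R3 → ℝ} (hg : Integrable g) {Y : R3 → R3} (hY : Measurable Y) (hgQ : ∀ y, g y ≠ 0 → Y y ∈ Q) {c : R3} (hc : c ∈ Q)
    (hD : ∀ z ∈ Q, ∀ i, |c i - z i| ≤ D) :
    ∃ w : Fin 3 → R3 → ℝ, (∀ i, Sm (w i)) ∧ (∀ i x, (∀ z ∈ Q, δ ≤ ‖x - z‖) → w i x = 0) ∧
      (∀ x, ∑ i, pd (w i) i x = (∫ y, g y * f (x - Y y)) - (∫ y, g y) * f (x - c)) ∧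
      (∀ i j x, |pd (w i) j x| ≤ D * M * ∫ y, |g y|) ∧ (∀ i x, |lap (w i) x| ≤ D * M * ∫ y, |g y|) := by
  have D0 : 0 ≤ D := (abs_nonneg _).trans (hD c hc 0)
  have M0 : 0 ≤ M := (abs_nonneg _).trans (hM2 0)
  set k1 : ℝ → ℝ := (Set.Ioc (0:ℝ) 1).indicator (fun _ => (1:ℝ)) with hk1
  set gi : Fin 3 → R3 → ℝ := fun i y => g y * (c i - Y y i) with hgi
  have bgi : ∀ i y, |gi i y| ≤ D * |g y| := fun i y => by
    simp only [hgi, abs_mul]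
    by_cases hy : g y = 0
    · simp [hy]
    · rw [mul_comm]; exact mul_le_mul_of_nonneg_right (hD _ (hgQ y hy) i) (abs_nonneg _)
  have mYi : ∀ i, Measurable fun y => Y y i := fun i => (by fun_prop : Continuous fun z : R3 => z i).measurable.comp hY
  have igi : ∀ i, Integrable (gi i) := fun i => by
    refine Integrable.mono' (hg.abs.const_mul D) (hg.aestronglyMeasurable.mul ?_) (ae_of_all _ fun y => bgi i y)
    exact (measurable_const.sub (mYi i)).aestronglyMeasurable
  have ik1 : Integrable k1 := by
    rw [hk1, integrable_indicator_iff measurableSet_Ioc]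
    exact (continuous_const.intervalIntegrable 0 1).1
  set k : Fin 3 → R3 × ℝ → ℝ := fun i w => gi i w.1 * k1 w.2 with hk
  have ik : ∀ i, Integrable (k i) (volume.prod volume) := fun i => (igi i).mul_prod ik1
  set T : R3 × ℝ → R3 := fun w => -(Y w.1 + w.2 • (c - Y w.1)) with hT
  have mT : Measurable T := by
    have hm : Measurable fun w : R3 × ℝ => Y w.1 := hY.comp measurable_fst
    exact (hm.add (measurable_snd.smul (measurable_const.sub hm))).neg
  have k1n : ∫ s, |k1 s| = 1 := by
    have : ∀ s, |k1 s| = k1 s := fun s => abs_of_nonneg (Set.indicator_nonneg (fun _ _ => zero_le_one) s)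
    simp only [this]
    rw [hk1, integral_indicator measurableSet_Ioc]
    simp
  have kn : ∀ i, ∫ w, |k i w| ∂(volume.prod volume) ≤ D * ∫ y, |g y| := fun i => by
    simp only [hk, abs_mul]
    rw [integral_prod_mul (fun y => |gi i y|) (fun s => |k1 s|), k1n, mul_one, ← integral_const_mul]
    exact integral_mono (igi i).abs (hg.abs.const_mul D) fun y => bgi i y
  refine ⟨fun i => avg (volume.prod volume) (k i) T f, fun i => avg_sm (ik i) mT.aemeasurable hf cf, ?_, ?_, ?_, ?_⟩
  · intro i x hx
    refine avg_vanish fun w hw => vf _ ?_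
    have ha : gi i w.1 ≠ 0 := left_ne_zero_of_mul hw
    have hb : k1 w.2 ≠ 0 := right_ne_zero_of_mul hw
    have hm : w.2 ∈ Set.Ioc 0 1 := Set.mem_of_indicator_ne_zero hb
    have hy := hgQ _ (left_ne_zero_of_mul ha)
    rw [hT, ← sub_eq_add_neg]
    refine hx _ ?_
    exact hQ.add_smul_sub_mem hy hc ⟨hm.1.le, hm.2⟩
  · intro x
    have e1 : ∀ i, pd (avg (volume.prod volume) (k i) T f) i x = ∫ y, ∫ s, k i (y, s) * pd f i (x + T (y, s)) := fun i => by
      rw [avg_pd (ik i) mT.aemeasurable hf cf]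
      exact integral_prod _ (avg_int (ik i) mT.aemeasurable (hf.pd i).cont (cs_pd cf i) x)
    have e1i : ∀ i, Integrable (fun y => ∫ s, k i (y, s) * pd f i (x + T (y, s))) := fun i =>
      (avg_int (ik i) mT.aemeasurable (hf.pd i).cont (cs_pd cf i) x).integral_prod_left
    simp only [e1]
    rw [← integral_finsetSum _ (fun i _ => e1i i)]
    obtain ⟨Cf, _, hCf⟩ := cs_bdd hf.cont cf
    have ia : Integrable (fun y => g y * f (x - Y y)) := by
      refine Integrable.mul_bdd hg (c := Cf) ?_ (ae_of_all _ fun y => hCf _)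
      exact (hf.cont.measurable.comp (measurable_const.sub hY)).aestronglyMeasurable
    rw [← integral_mul_const, ← integral_sub ia (hg.mul_const _)]
    refine integral_congr_ae (ae_of_all _ fun y => ?_)
    simp only
    -- inner
    have dd : ∀ s : ℝ, HasDerivAt (fun s : ℝ => f (x + T (y, s))) (-∑ i, (c i - Y y i) * pd f i (x + T (y, s))) s := by
      intro s
      have a1 : HasDerivAt (fun s : ℝ => x + T (y, s)) (-(c - Y y)) s := by
        have := ((((hasDerivAt_id s).smul_const (c - Y y)).const_add (Y y)).neg).const_add x
        simpa [hT] using this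
      have a2 := (hf.dat (x + T (y, s))).hasFDerivAt.comp_hasDerivAt s a1
      refine a2.congr_deriv ?_
      rw [map_neg, fderiv_eq_sum]
      simp
    have inner : ∀ i, ∫ s, k i (y, s) * pd f i (x + T (y, s)) = ∫ s in (0:ℝ)..1, gi i y * pd f i (x + T (y, s)) := fun i => by
      rw [intervalIntegral.integral_of_le zero_le_one, ← integral_indicator measurableSet_Ioc]
      refine integral_congr_ae (ae_of_all _ fun s => ?_)
      simp only [hk, hk1]
      by_cases hs : s ∈ Set.Ioc (0:ℝ) 1
      · simp only [Set.indicator_of_mem hs, mul_one]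
      · simp only [Set.indicator_of_notMem hs, mul_zero, zero_mul]
    have cT : Continuous (fun s : ℝ => x + T (y, s)) := by simp only [hT]; fun_prop
    have cp : ∀ i, Continuous (fun s : ℝ => pd f i (x + T (y, s))) := fun i => (hf.pd i).cont.comp cT
    simp only [inner]
    rw [← intervalIntegral.integral_finsetSum (fun i _ => ((cp i).const_mul _).intervalIntegrable _ _)]
    have e2 : ∀ s, ∑ i, gi i y * pd f i (x + T (y, s)) = -g y * (-∑ i, (c i - Y y i) * pd f i (x + T (y, s))) := fun s => by
      simp only [hgi, neg_mul_neg, Finset.mul_sum, mul_assoc]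
    simp only [e2]
    rw [intervalIntegral.integral_const_mul, intervalIntegral.integral_eq_sub_of_hasDerivAt (fun s _ => dd s)]
    · simp only [hT, one_smul, zero_smul, add_zero, add_sub_cancel, ← sub_eq_add_neg]
      ring
    · refine Continuous.intervalIntegrable ?_ _ _
      exact (continuous_finsetSum _ fun i _ => (cp i).const_mul _).neg
  · intro i j x
    rw [avg_pd (ik i) mT.aemeasurable hf cf]
    refine (avg_bdd (ik i) (hM1 j) x).trans ?_
    have := mul_le_mul_of_nonneg_right (kn i) M0
    linarith
  · intro i x
    rw [avg_lap (ik i) mT.aemeasurable hf cf]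
    refine (avg_bdd (ik i) hM2 x).trans ?_
    have := mul_le_mul_of_nonneg_right (kn i) M0
    linarith


def phi1 (t : ℝ) : ℝ := Real.smoothTransition (22 - 20 * t) * Real.smoothTransition (22 + 20 * t)
lemma phi1_one {t : ℝ} (h : |t| ≤ 21 / 20) : phi1 t = 1 := by
  rw [abs_le] at h
  unfold phi1
  rw [Real.smoothTransition.one_of_one_le (by linarith), Real.smoothTransition.one_of_one_le (by linarith), one_mul]
lemma phi1_zero {t : ℝ} (h : 11 / 10 ≤ |t|) : phi1 t = 0 := by
  unfold phi1
  rcases le_abs.1 h with h | h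
  · rw [Real.smoothTransition.zero_of_nonpos (x := 22 - 20 * t) (by linarith), zero_mul]
  · rw [Real.smoothTransition.zero_of_nonpos (x := 22 + 20 * t) (by linarith), mul_zero]

lemma coord_le (x : R3) (l : Fin 3) : |x l| ≤ ‖x‖ := by
  have := PiLp.norm_apply_le x l
  simpa using this
lemma normsq3 (x : R3) : ‖x‖ ^ 2 = x 0 ^ 2 + x 1 ^ 2 + x 2 ^ 2 := by
  rw [EuclideanSpace.real_norm_sq_eq, Fin.sum_univ_three]
lemma norm_le_191 {x : R3} (h : ∀ l, |x l| ≤ 11 / 10) : ‖x‖ ≤ 191 / 100 := by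
  have h3 := normsq3 x
  have e : ∀ l, x l ^ 2 ≤ (11 / 10) ^ 2 := fun l => by
    rw [← sq_abs]; exact pow_le_pow_left₀ (abs_nonneg _) (h l) 2
  have := e 0; have := e 1; have := e 2
  nlinarith [norm_nonneg x]

lemma cut_ex : ∃ φ : R3 → ℝ, Sm φ ∧ HasCompactSupport φ ∧ (∀ x, 0 ≤ φ x) ∧ (∀ x, ‖x‖ ≤ 1 → φ x = 1) ∧
    ∀ k x, pd φ k x ≠ 0 → 21 / 20 ≤ |x k| ∧ ∀ l, |x l| ≤ 11 / 10 := by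
  set φ : R3 → ℝ := fun x => phi1 (x 0) * phi1 (x 1) * phi1 (x 2) with hφ
  have s1 : ContDiff ℝ (⊤ : ℕ∞) phi1 := by
    unfold phi1
    exact (Real.smoothTransition.contDiff.comp (by fun_prop)).mul (Real.smoothTransition.contDiff.comp (by fun_prop))
  have sφ : Sm φ := by
    have : ∀ l : Fin 3, ContDiff ℝ (⊤ : ℕ∞) fun x : R3 => phi1 (x l) := fun l => s1.comp (by fun_prop)
    exact ((this 0).mul (this 1)).mul (this 2)
  have v0 : ∀ x : R3, ∀ l, 11 / 10 ≤ |x l| → φ x = 0 := fun x l h => by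
    simp only [hφ]
    fin_cases l <;> simp only [Fin.zero_eta, Fin.mk_one, Fin.reduceFinMk] at h <;> rw [phi1_zero h] <;> ring
  refine ⟨φ, sφ, ?_, ?_, ?_, ?_⟩
  · refine cs_of_norm (r := 191 / 100) fun x hx => ?_
    by_contra hne
    refine absurd (norm_le_191 fun l => ?_) (not_le.2 hx)
    by_contra hl
    exact hne (v0 x l (not_le.1 hl).le)
  · intro x
    have : ∀ t, 0 ≤ phi1 t := fun t => mul_nonneg (Real.smoothTransition.nonneg _) (Real.smoothTransition.nonneg _)
    exact mul_nonneg (mul_nonneg (this _) (this _)) (this _)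
  · intro x hx
    have : ∀ l, phi1 (x l) = 1 := fun l => phi1_one (by linarith [coord_le x l])
    simp [hφ, this]
  · intro k x hne
    have cl : ∀ l, Continuous (fun r : ℝ => |(x + r • (EuclideanSpace.single k 1 : R3)) l|) := fun l => by fun_prop
    have cl0 : ∀ l, (fun r : ℝ => |(x + r • (EuclideanSpace.single k 1 : R3)) l|) 0 = |x l| := fun l => by simp
    constructor
    · by_contra hlt
      rw [not_le] at hlt
      refine hne (pd_eq_of sφ ((hasDerivAt_const (0:ℝ) (φ x)).congr_of_eventuallyEq ?_))
      have ev := ((cl k).tendsto 0).eventually_lt_const (u := 21 / 20) (by simpa using hlt)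
      filter_upwards [ev] with r hr
      simp only [hφ]
      have h1 : ∀ l, phi1 ((x + r • (EuclideanSpace.single k 1 : R3)) l) = phi1 (x l) := fun l => by
        by_cases hl : l = k
        · subst hl; rw [phi1_one hr.le, phi1_one hlt.le]
        · congr 1
          simp [hl]
      simp only [h1]
    · intro l
      by_contra hlt
      rw [not_le] at hlt
      refine hne (pd_eq_of sφ ((hasDerivAt_const (0:ℝ) (0:ℝ)).congr_of_eventuallyEq ?_))
      have ev := ((cl l).tendsto 0).eventually_const_lt (u := 11 / 10) (by simpa using hlt)
      filter_upwards [ev] with r hr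
      exact v0 _ l hr.le

def Kc : Set R3 := {x | 101 / 100 ≤ ‖x‖ ∧ ‖x‖ ≤ 39 / 20}
lemma Kc_closed : IsClosed Kc :=
  (isClosed_le continuous_const continuous_norm).inter (isClosed_le continuous_norm continuous_const)
lemma Kc_sub : Kc ⊆ annulus 1 := fun x hx => by
  have h1 := hx.1; have h2 := hx.2
  constructor
  · rw [mem_ball_zero_iff]; linarith
  · rw [mem_ball_zero_iff]; linarith
lemma Kc_far {x z : R3} (hx : x ∉ Kc) (h1 : 21 / 20 ≤ ‖z‖) (h2 : ‖z‖ ≤ 191 / 100) : 1 / 25 < ‖x - z‖ := by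
  have a1 := norm_sub_norm_le z x
  have a2 := norm_sub_norm_le x z
  rw [norm_sub_rev] at a1
  by_contra hc
  refine hx ⟨?_, ?_⟩ <;> linarith
lemma ann_meas (R : ℝ) : MeasurableSet (annulus R) := measurableSet_ball.diff measurableSet_ball

def sgb (b : Bool) : ℝ := if b then 1 else -1
def Qs (k : Fin 3) (b : Bool) : Set R3 := {x | 21 / 20 ≤ sgb b * x k ∧ ∀ l, |x l| ≤ 11 / 10}
lemma sgb_abs (b : Bool) : |sgb b| = 1 := by cases b <;> simp [sgb]
lemma Qs_convex (k : Fin 3) (b : Bool) : Convex ℝ (Qs k b) := by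
  intro x hx y hy s t hs ht hst
  have e : ∀ l, (s • x + t • y) l = s * x l + t * y l := fun l => by simp
  refine ⟨?_, fun l => ?_⟩
  · rw [e]
    have := mul_le_mul_of_nonneg_left hx.1 hs
    have := mul_le_mul_of_nonneg_left hy.1 ht
    have e2 : sgb b * (s * x k + t * y k) = s * (sgb b * x k) + t * (sgb b * y k) := by ring
    rw [e2]
    have : s * (21 / 20) + t * (21 / 20) = (21:ℝ) / 20 := by rw [← add_mul, hst, one_mul]
    linarith
  · rw [e]
    calc |s * x l + t * y l| ≤ s * |x l| + t * |y l| := by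
          refine (abs_add_le _ _).trans ?_
          rw [abs_mul, abs_mul, abs_of_nonneg hs, abs_of_nonneg ht]
      _ ≤ s * (11 / 10) + t * (11 / 10) := by gcongr; exacts [hx.2 l, hy.2 l]
      _ = 11 / 10 := by rw [← add_mul, hst, one_mul]
lemma Qs_norm {k : Fin 3} {b : Bool} {z : R3} (hz : z ∈ Qs k b) : 21 / 20 ≤ ‖z‖ ∧ ‖z‖ ≤ 191 / 100 := by
  refine ⟨?_, norm_le_191 hz.2⟩
  refine (hz.1.trans (le_abs_self _)).trans ?_
  rw [abs_mul, sgb_abs, one_mul]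
  exact coord_le z k

def ckb (k : Fin 3) (b : Bool) : R3 := WithLp.toLp 2 (fun l => if l = k then sgb b * (21 / 20) else 21 / 20)
lemma ckb_abs (k : Fin 3) (b : Bool) (l : Fin 3) : |ckb k b l| = 21 / 20 := by
  simp only [ckb]
  split_ifs
  · rw [abs_mul, sgb_abs]; norm_num
  · norm_num
lemma ckb_mem (k : Fin 3) (b : Bool) : ckb k b ∈ Qs k b := by
  refine ⟨?_, fun l => by rw [ckb_abs]; norm_num⟩
  simp only [ckb, if_true]
  cases b <;> simp [sgb]
lemma ckb_mem' (k : Fin 3) (b : Bool) : ckb k b ∈ Qs (k + 1) true := by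
  refine ⟨?_, fun l => by rw [ckb_abs]; norm_num⟩
  have : k + 1 ≠ k := by fin_cases k <;> decide
  simp [ckb, this, sgb]
lemma c0_mem (k : Fin 3) : ckb 0 true ∈ Qs k true := by
  refine ⟨?_, fun l => by rw [ckb_abs]; norm_num⟩
  simp [ckb, sgb]
lemma QD {k k' : Fin 3} {b b' : Bool} {c z : R3} (hc : c ∈ Qs k b) (hz : z ∈ Qs k' b') (i : Fin 3) : |c i - z i| ≤ 3 := by
  have := hc.2 i; have := hz.2 i
  refine (abs_sub _ _).trans (by linarith)

lemma lap_add {f g : R3 → ℝ} (hf : Sm f) (hg : Sm g) (x : R3) : lap (fun x => f x + g x) x = lap f x + lap g x := by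
  unfold lap
  rw [← Finset.sum_add_distrib]
  refine Finset.sum_congr rfl fun j _ => ?_
  rw [show pd (fun x => f x + g x) j = fun x => pd f j x + pd g j x from funext fun x => pd_add hf hg j x,
    pd_add (hf.pd j) (hg.pd j)]
lemma lap_sum {ι : Type*} {s : Finset ι} {f : ι → R3 → ℝ} (hf : ∀ i ∈ s, Sm (f i)) (x : R3) :
    lap (fun x => ∑ i ∈ s, f i x) x = ∑ i ∈ s, lap (f i) x := by
  unfold lap
  rw [Finset.sum_comm]
  refine Finset.sum_congr rfl fun j _ => ?_
  rw [show pd (fun x => ∑ i ∈ s, f i x) j = fun x => ∑ i ∈ s, pd (f i) j x from funext fun x => pd_sum hf j x,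
    pd_sum (fun i hi => (hf i hi).pd j)]


lemma key_hw : ∃ φ : R3 → ℝ, Sm φ ∧ HasCompactSupport φ ∧ (∀ x, 0 ≤ φ x) ∧ (∀ x, ‖x‖ ≤ 1 → φ x = 1) ∧
    (∀ k x, x ∉ Kc → pd φ k x = 0) ∧ ∃ C, 0 ≤ C ∧ ∀ u : Fin 3 → R3 → ℝ, (∀ i, Sm (u i)) → (∀ x, ∑ j, pd (u j) j x = 0) →
    ∃ (h : R3 → ℝ) (w : Fin 3 → R3 → ℝ), Sm h ∧ (∀ i, Sm (w i)) ∧ (∀ x, x ∉ Kc → h x = 0) ∧ (∀ i x, x ∉ Kc → w i x = 0) ∧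
      (∀ x, lap h x + ∑ i, pd (w i) i x = ∑ i, pd φ i x * u i x) ∧
      (∀ i j x, |pd (w i) j x| ≤ C * ∫ x in annulus 1, ∑ j, |u j x|) ∧
      (∀ i x, |lap (w i) x| ≤ C * ∫ x in annulus 1, ∑ j, |u j x|) ∧
      (∀ x, |lap h x| ≤ C * ((∑ j, |u j x|) + ∫ x in annulus 1, ∑ j, |u j x|)) := by
  obtain ⟨φ, sφ, cφ, φ0, φ1, φd⟩ := cut_ex
  obtain ⟨η, ζ, HR, sη, η1, vη, vζ⟩ := ker_ex
  have φK : ∀ k x, pd φ k x ≠ 0 → 21 / 20 ≤ ‖x‖ ∧ ‖x‖ ≤ 191 / 100 := fun k x h =>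
    ⟨(φd k x h).1.trans (coord_le x k), norm_le_191 (φd k x h).2⟩
  have φKc : ∀ k x, x ∉ Kc → pd φ k x = 0 := fun k x hx => by
    by_contra hne
    have := φK k x hne
    exact hx ⟨by linarith, by linarith⟩
  refine ⟨φ, sφ, cφ, φ0, φ1, φKc, ?_⟩
  -- constants
  set δ : ℝ := 1 / 25 with hδ
  have δ0 : 0 < δ := by norm_num [hδ]
  set f : R3 → ℝ := fun z => (δ ^ 3)⁻¹ * η (0 + (-δ⁻¹) • z) with hf
  have sf : Sm f := (sm_aff sη 0 (-δ⁻¹)).cmul _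
  have vf : ∀ z, δ ≤ ‖z‖ → f z = 0 := fun z hz => by
    simp only [hf]
    rw [vη, mul_zero]
    rw [zero_add, norm_smul, norm_neg, norm_inv, Real.norm_eq_abs, abs_of_pos δ0]
    rw [le_inv_mul_iff₀ δ0]; linarith
  have cf : HasCompactSupport f := cs_of_norm (r := δ) fun x hx => vf x hx.le
  choose m1 _ hm1 using fun l => cs_bdd (sf.pd l).cont (cs_pd cf l)
  obtain ⟨M1, hM1⟩ := fin_max m1
  obtain ⟨M2, _, hM2⟩ := cs_bdd sf.lap.cont (cs_lap cf)
  set M := max M1 M2 with hM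
  have hMa : ∀ j x, |pd f j x| ≤ M := fun j x => ((hm1 j x).trans (hM1 j)).trans (le_max_left _ _)
  have hMb : ∀ x, |lap f x| ≤ M := fun x => (hM2 x).trans (le_max_right _ _)
  have M0 : 0 ≤ M := (abs_nonneg _).trans (hMb 0)
  choose c1 c10 hc1 using fun l => cs_bdd (sφ.pd l).cont (cs_pd cφ l)
  obtain ⟨cp, hcp⟩ := fin_max c1
  have cp0 : 0 ≤ cp := (c10 0).trans (hcp 0)
  have φb : ∀ l x, |pd φ l x| ≤ cp := fun l x => (hc1 l x).trans (hcp l)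
  refine ⟨cp + 12 * (9 * M * cp) , by positivity, ?_⟩
  intro u su du
  set E := ∫ x in annulus 1, ∑ j, |u j x| with hE
  have E0 : 0 ≤ E := integral_nonneg fun x => Finset.sum_nonneg fun j _ => abs_nonneg _
  set g : R3 → ℝ := fun x => ∑ i, pd φ i x * u i x with hg
  have sg : Sm g := Sm.sum fun i _ => (sφ.pd i).mul (su i)
  have gz : ∀ x, ¬ (21 / 20 ≤ ‖x‖ ∧ ‖x‖ ≤ 191 / 100) → g x = 0 := fun x hx => by
    simp only [hg]
    refine Finset.sum_eq_zero fun i _ => ?_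
    by_cases h : pd φ i x = 0
    · rw [h, zero_mul]
    · exact absurd (φK i x h) hx
  have cg : HasCompactSupport g := cs_of_norm (r := 191 / 100) fun x hx => gz x fun h => absurd h.2 (not_le.2 hx)
  obtain ⟨h, sh, hv, hl⟩ := par HR η1 vζ δ0 sg cg
  -- pieces
  set gk : Fin 3 × Bool → R3 → ℝ := fun ι => {y : R3 | 0 < sgb ι.2 * y ι.1}.indicator (fun y => pd φ ι.1 y * u ι.1 y) with hgk
  have ms : ∀ ι : Fin 3 × Bool, MeasurableSet {y : R3 | 0 < sgb ι.2 * y ι.1} := fun ι =>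
    (isOpen_lt continuous_const (by fun_prop)).measurableSet
  have igk : ∀ ι, Integrable (gk ι) := fun ι =>
    (cs_int ((sφ.pd ι.1).mul (su ι.1)).cont (cs_pd cφ ι.1).mul_right).indicator (ms ι)
  have gkQ : ∀ ι y, gk ι y ≠ 0 → y ∈ Qs ι.1 ι.2 := fun ι y hy => by
    have hm : 0 < sgb ι.2 * y ι.1 := by
      have : y ∈ {y : R3 | 0 < sgb ι.2 * y ι.1} := by
        by_contra h0
        exact hy (Set.indicator_of_notMem h0 _)
      exact this
    have hne : pd φ ι.1 y ≠ 0 := by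
      intro h0
      apply hy
      simp only [hgk]
      rw [Set.indicator_apply]; simp [h0]
    refine ⟨?_, (φd _ _ hne).2⟩
    rw [← abs_of_pos hm, abs_mul, sgb_abs, one_mul]
    exact (φd _ _ hne).1
  have gsum : ∀ y, ∑ ι, gk ι y = g y := fun y => by
    rw [Fintype.sum_prod_type]
    simp only [hg]
    refine Finset.sum_congr rfl fun k _ => ?_
    rw [Fintype.sum_bool]
    simp only [hgk, sgb, Set.indicator_apply, Set.mem_ofPred_eq]
    rcases lt_trichotomy (y k) 0 with h | h | h
    · have a : ¬ (0 < y k) := by linarith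
      simp [h, a]
    · have : pd φ k y = 0 := by
        by_contra hne
        have := (φd k y hne).1
        rw [h] at this; norm_num at this
      simp [this]
    · have a : ¬ (y k < 0) := by linarith
      simp [h, a]
  have ia : Integrable (fun x => (annulus 1).indicator (fun x => ∑ j, |u j x|) x) := by
    rw [integrable_indicator_iff (ann_meas 1)]
    refine IntegrableOn.mono_set (t := closedBall 0 2) ?_ ?_
    · exact (continuous_finsetSum _ fun j _ => (su j).cont.abs).continuousOn.integrableOn_compact (isCompact_closedBall _ _)
    · exact fun x hx => by
        have := hx.1
        rw [mem_ball_zero_iff] at this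
        rw [mem_closedBall_zero_iff]; linarith
  have gkE : ∀ ι, ∫ y, |gk ι y| ≤ cp * E := fun ι => by
    rw [hE, ← integral_indicator (ann_meas 1), ← integral_const_mul]
    refine integral_mono (igk ι).abs (ia.const_mul cp) fun y => ?_
    simp only
    by_cases hy : gk ι y = 0
    · rw [hy, abs_zero]
      exact mul_nonneg cp0 (Set.indicator_nonneg (fun x _ => Finset.sum_nonneg fun j _ => abs_nonneg _) _)
    · have hq := Qs_norm (gkQ ι y hy)
      have hA : y ∈ annulus 1 := Kc_sub ⟨by linarith [hq.1], by linarith [hq.2]⟩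
      rw [Set.indicator_of_mem hA]
      have hm : y ∈ {y : R3 | 0 < sgb ι.2 * y ι.1} := Set.mem_of_indicator_ne_zero hy
      simp only [hgk]
      rw [Set.indicator_of_mem hm, abs_mul]
      exact mul_le_mul (φb _ _) (Finset.single_le_sum (f := fun j => |u j y|) (fun j _ => abs_nonneg _) (Finset.mem_univ _))
        (abs_nonneg _) cp0
  choose w1 s1 v1 d1 p1 l1 using fun ι : Fin 3 × Bool => seg sf cf vf hMa hMb (Qs_convex ι.1 ι.2) (igk ι) measurable_id
    (gkQ ι) (ckb_mem ι.1 ι.2) (D := 3) (fun z hz i => QD (ckb_mem ι.1 ι.2) hz i)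
  choose w2 s2 v2 d2 p2 l2 using fun ι : Fin 3 × Bool => seg sf cf vf hMa hMb (Qs_convex (ι.1 + 1) true) (igk ι)
    (Y := fun _ => ckb ι.1 ι.2) measurable_const (fun _ _ => ckb_mem' ι.1 ι.2) (c0_mem (ι.1 + 1)) (D := 3)
    (fun z hz i => QD (c0_mem (ι.1 + 1)) hz i)
  set w : Fin 3 → R3 → ℝ := fun i x => ∑ ι, (w1 ι i x + w2 ι i x) with hw
  have s12 : ∀ i ι, Sm (fun x => w1 ι i x + w2 ι i x) := fun i ι => (s1 ι i).add (s2 ι i)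
  have sw : ∀ i, Sm (w i) := fun i => Sm.sum fun ι _ => s12 i ι
  have pw : ∀ i j x, pd (w i) j x = ∑ ι, (pd (w1 ι i) j x + pd (w2 ι i) j x) := fun i j x => by
    rw [hw]
    simp only
    rw [pd_sum (f := fun ι x => w1 ι i x + w2 ι i x) (fun ι _ => s12 i ι)]
    exact Finset.sum_congr rfl fun ι _ => pd_add (s1 ι i) (s2 ι i) j x
  have lw : ∀ i x, lap (w i) x = ∑ ι, (lap (w1 ι i) x + lap (w2 ι i) x) := fun i x => by
    rw [hw]
    simp only
    rw [lap_sum (f := fun ι x => w1 ι i x + w2 ι i x) (fun ι _ => s12 i ι)]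
    exact Finset.sum_congr rfl fun ι _ => lap_add (s1 ι i) (s2 ι i) x
  have ig0 : ∫ y, g y = 0 := by
    have := int_div (F := fun j x => φ x * u j x) (fun j => sφ.mul (su j)) (fun j => cφ.mul_right)
    rw [← this]
    refine integral_congr_ae (ae_of_all _ fun x => ?_)
    simp only [pd_mul sφ (su _), Finset.sum_add_distrib, ← Finset.mul_sum, du x, mul_zero, add_zero, hg]
  have dw : ∀ x, ∑ i, pd (w i) i x = rad η δ g x := fun x => by
    simp only [pw]
    rw [Finset.sum_comm]
    simp only [Finset.sum_add_distrib, d1, d2]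
    rw [← Finset.sum_add_distrib]
    simp only [integral_mul_const, sub_add_sub_cancel, id]
    rw [Finset.sum_sub_distrib, ← Finset.sum_mul]
    have gs0 : ∑ ι, ∫ y, gk ι y = 0 := by
      rw [← integral_finsetSum _ (fun ι _ => igk ι)]
      simp only [gsum]; exact ig0
    rw [gs0, zero_mul, sub_zero]
    obtain ⟨Cf, _, hCf⟩ := cs_bdd sf.cont cf
    have iik : ∀ ι, Integrable (fun y => gk ι y * f (x - y)) := fun ι => by
      have cc : Continuous (fun y => f (x - y)) := sf.cont.comp (continuous_const.sub continuous_id)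
      exact Integrable.mul_bdd (igk ι) (c := Cf) cc.aestronglyMeasurable (ae_of_all _ fun y => hCf _)
    rw [← integral_finsetSum (f := fun ι y => gk ι y * f (x - y)) _ (fun ι _ => iik ι)]
    simp only [Function.comp, ← Finset.sum_mul, gsum, id]
    have := int_aff (fun y => η (δ⁻¹ • (y - x)) * g y) x δ0
    simp only [add_sub_cancel_left, smul_smul, inv_mul_cancel₀ δ0.ne', one_smul] at this
    unfold rad avg
    rw [this, ← integral_const_mul]
    refine integral_congr_ae (ae_of_all _ fun y => ?_)
    simp only [hf]
    rw [show (0:R3) + (-δ⁻¹) • (x - y) = δ⁻¹ • (y - x) by rw [zero_add, neg_smul, ← smul_neg, neg_sub]]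
    ring
  have pb : ∀ i j x, |pd (w i) j x| ≤ 12 * (3 * M * cp) * E := fun i j x => by
    rw [pw]
    calc _ ≤ ∑ ι : Fin 3 × Bool, |pd (w1 ι i) j x + pd (w2 ι i) j x| := Finset.abs_sum_le_sum_abs _ _
      _ ≤ ∑ ι : Fin 3 × Bool, 2 * (3 * M * cp * E) := by
          refine Finset.sum_le_sum fun ι _ => (abs_add_le _ _).trans ?_
          have := mul_le_mul_of_nonneg_left (gkE ι) (by positivity : 0 ≤ 3 * M)
          have := p1 ι i j x; have := p2 ι i j x
          linarith
      _ = _ := by simp; ring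
  have lb : ∀ i x, |lap (w i) x| ≤ 12 * (3 * M * cp) * E := fun i x => by
    rw [lw]
    calc _ ≤ ∑ ι : Fin 3 × Bool, |lap (w1 ι i) x + lap (w2 ι i) x| := Finset.abs_sum_le_sum_abs _ _
      _ ≤ ∑ ι : Fin 3 × Bool, 2 * (3 * M * cp * E) := by
          refine Finset.sum_le_sum fun ι _ => (abs_add_le _ _).trans ?_
          have := mul_le_mul_of_nonneg_left (gkE ι) (by positivity : 0 ≤ 3 * M)
          have := l1 ι i x; have := l2 ι i x
          linarith
      _ = _ := by simp; ring
  have MC : 12 * (3 * M * cp) * E ≤ (cp + 12 * (9 * M * cp)) * E := by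
    refine mul_le_mul_of_nonneg_right ?_ E0
    have : 0 ≤ M * cp := by positivity
    linarith
  have idn : ∀ x, lap h x + ∑ i, pd (w i) i x = g x := fun x => by rw [hl, dw]; ring
  refine ⟨h, w, sh, sw, ?_, ?_, idn, fun i j x => (pb i j x).trans MC, fun i x => (lb i x).trans MC, ?_⟩
  · intro x hx
    refine hv x fun y hy => gz y fun hK => ?_
    have := Kc_far hx hK.1 hK.2
    exact absurd ((norm_sub_rev x y).le.trans (hy.trans_eq hδ)) (not_le.2 this)
  · intro i x hx
    simp only [hw]
    refine Finset.sum_eq_zero fun ι _ => ?_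
    rw [v1 ι i x fun z hz => (Kc_far hx (Qs_norm hz).1 (Qs_norm hz).2).le,
      v2 ι i x fun z hz => (Kc_far hx (Qs_norm hz).1 (Qs_norm hz).2).le, add_zero]
  · intro x
    have : lap h x = g x - ∑ i, pd (w i) i x := by linarith [idn x]
    rw [this]
    have S0 : 0 ≤ ∑ j, |u j x| := Finset.sum_nonneg fun j _ => abs_nonneg _
    have a1 : |g x| ≤ cp * ∑ j, |u j x| := by
      simp only [hg]
      rw [Finset.mul_sum]
      refine (Finset.abs_sum_le_sum_abs _ _).trans (Finset.sum_le_sum fun i _ => ?_)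
      rw [abs_mul]; exact mul_le_mul_of_nonneg_right (φb i x) (abs_nonneg _)
    have a2 : |∑ i, pd (w i) i x| ≤ 12 * (9 * M * cp) * E := by
      refine (Finset.abs_sum_le_sum_abs _ _).trans ((Finset.sum_le_sum fun i _ => pb i i x).trans (le_of_eq ?_))
      simp; ring
    have a3 := abs_sub (g x) (∑ i, pd (w i) i x)
    have b1 : 0 ≤ 12 * (9 * M * cp) * ∑ j, |u j x| := by positivity
    have b2 : 0 ≤ cp * E := by positivity
    nlinarith


def ZI (f : R3 → ℝ) : Prop := Integrable f ∧ ∫ x, f x = 0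
lemma ZI.add {f g : R3 → ℝ} (hf : ZI f) (hg : ZI g) : ZI (fun x => f x + g x) :=
  ⟨hf.1.add hg.1, by rw [integral_add hf.1 hg.1, hf.2, hg.2, add_zero]⟩
lemma ZI.cmul {f : R3 → ℝ} (c : ℝ) (hf : ZI f) : ZI (fun x => c * f x) :=
  ⟨hf.1.const_mul c, by rw [integral_const_mul, hf.2, mul_zero]⟩
lemma ZI.congr {f g : R3 → ℝ} (hf : ZI f) (h : ∀ x, g x = f x) : ZI g := by
  rw [show g = f from funext h]; exact hf
lemma ZI.div {F : Fin 3 → R3 → ℝ} (hf : ∀ j, Sm (F j)) (hc : ∀ j, HasCompactSupport (F j)) :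
    ZI (fun x => ∑ j, pd (F j) j x) :=
  ⟨integrable_finsetSum _ fun j _ => cs_int ((hf j).pd j).cont (cs_pd (hc j) j), int_div hf hc⟩
lemma ZI.sum {F : Fin 3 → R3 → ℝ} (h : ∀ i, ZI (F i)) : ZI (fun x => ∑ i, F i x) :=
  ⟨integrable_finsetSum _ fun j _ => (h j).1, by
    rw [integral_finsetSum _ fun j _ => (h j).1]; exact Finset.sum_eq_zero fun j _ => (h j).2⟩

lemma z1 {φ f : R3 → ℝ} (sφ : Sm φ) (cφ : HasCompactSupport φ) (sf : Sm f) :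
    ZI (fun x => φ x * f x * lap f x + φ x * ∑ j, pd f j x ^ 2 - f x ^ 2 / 2 * lap φ x) := by
  have A := ZI.div (F := fun j x => φ x * f x * pd f j x) (fun j => (sφ.mul sf).mul (sf.pd j))
    (fun j => (cφ.mul_right (f' := f)).mul_right)
  have B := ZI.div (F := fun j x => f x * f x * pd φ j x) (fun j => (sf.mul sf).mul (sφ.pd j))
    (fun j => (cs_pd cφ j).mul_left)
  refine (A.add (B.cmul (-1 / 2))).congr fun x => ?_
  simp only [pd_mul (sφ.mul sf) (sf.pd _), pd_mul (sf.mul sf) (sφ.pd _), pd_mul sφ sf, pd_mul sf sf, lap, Fin.sum_univ_three]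
  ring

lemma z2 {φ f : R3 → ℝ} {u : Fin 3 → R3 → ℝ} (sφ : Sm φ) (cφ : HasCompactSupport φ) (sf : Sm f) (su : ∀ i, Sm (u i))
    (du : ∀ x, ∑ j, pd (u j) j x = 0) :
    ZI (fun x => φ x * f x * ∑ j, u j x * pd f j x + f x ^ 2 / 2 * ∑ j, u j x * pd φ j x) := by
  have A := ZI.div (F := fun j x => φ x * (f x * f x) * u j x) (fun j => (sφ.mul (sf.mul sf)).mul (su j))
    (fun j => (cφ.mul_right (f' := fun x => f x * f x)).mul_right)
  refine (A.cmul (1 / 2)).congr fun x => ?_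
  have d := du x
  simp only [pd_mul (sφ.mul (sf.mul sf)) (su _), pd_mul sφ (sf.mul sf), pd_mul sf sf, Fin.sum_univ_three] at d ⊢
  linear_combination (-φ x * f x * f x / 2) * d

lemma z3 {φ θ : R3 → ℝ} {v : Fin 3 → R3 → ℝ} (sφ : Sm φ) (cφ : HasCompactSupport φ) (sf : Sm θ) (su : ∀ i, Sm (v i)) :
    ZI (fun x => φ x * ∑ j, v j x * pd θ j x + φ x * θ x * ∑ j, pd (v j) j x + θ x * ∑ j, v j x * pd φ j x) := by
  have A := ZI.div (F := fun j x => φ x * θ x * v j x) (fun j => (sφ.mul sf).mul (su j))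
    (fun j => (cφ.mul_right (f' := θ)).mul_right)
  refine A.congr fun x => ?_
  simp only [pd_mul (sφ.mul sf) (su _), pd_mul sφ sf, Fin.sum_univ_three]
  ring

lemma z4 {φ f g : R3 → ℝ} {v : Fin 3 → R3 → ℝ} (sφ : Sm φ) (cφ : HasCompactSupport φ) (sf : Sm f) (sg : Sm g) (su : ∀ i, Sm (v i)) :
    ZI (fun x => φ x * f x * ∑ j, pd (fun y => v j y * g y) j x + φ x * g x * ∑ j, v j x * pd f j x
      + f x * g x * ∑ j, v j x * pd φ j x) := by
  have A := ZI.div (F := fun j x => φ x * f x * (v j x * g x)) (fun j => (sφ.mul sf).mul ((su j).mul sg))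
    (fun j => (cφ.mul_right (f' := f)).mul_right)
  refine A.congr fun x => ?_
  simp only [pd_mul (sφ.mul sf) ((su _).mul sg), pd_mul sφ sf, Fin.sum_univ_three]
  ring

lemma z5 {pr : R3 → ℝ} {v : Fin 3 → R3 → ℝ} (sf : Sm pr) (su : ∀ i, Sm (v i)) (cv : ∀ i, HasCompactSupport (v i))
    (dv : ∀ x, ∑ j, pd (v j) j x = 0) :
    ZI (fun x => ∑ j, v j x * pd pr j x) := by
  have A := ZI.div (F := fun j x => v j x * pr x) (fun j => (su j).mul sf) (fun j => (cv j).mul_right)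
  refine A.congr fun x => ?_
  have d := dv x
  simp only [pd_mul (su _) sf, Fin.sum_univ_three] at d ⊢
  linear_combination (-pr x) * d

lemma z6 {f g : R3 → ℝ} (sf : Sm f) (cf : HasCompactSupport f) (sg : Sm g) :
    ZI (fun x => f x * lap g x - g x * lap f x) := by
  have A := ZI.div (F := fun j x => f x * pd g j x) (fun j => sf.mul (sg.pd j)) (fun j => cf.mul_right)
  have B := ZI.div (F := fun j x => g x * pd f j x) (fun j => sg.mul (sf.pd j)) (fun j => (cs_pd cf j).mul_left)
  refine (A.add (B.cmul (-1))).congr fun x => ?_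
  simp only [pd_mul sf (sg.pd _), pd_mul sg (sf.pd _), lap, Fin.sum_univ_three]
  ring

lemma z6b {h : R3 → ℝ} {u : Fin 3 → R3 → ℝ} (sh : Sm h) (ch : HasCompactSupport h) (su : ∀ i, Sm (u i))
    (du : ∀ x, ∑ j, pd (u j) j x = 0) : ZI (fun x => ∑ i, u i x * lap (pd h i) x) := by
  have A := ZI.div (F := fun j x => u j x * lap h x) (fun j => (su j).mul sh.lap) (fun j => (cs_lap ch).mul_left)
  refine A.congr fun x => ?_
  have d := du x
  simp only [lap_pd sh, pd_mul (su _) sh.lap, Fin.sum_univ_three] at d ⊢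
  linear_combination (-lap h x) * d

lemma z7 {W g : R3 → ℝ} {u : Fin 3 → R3 → ℝ} (sW : Sm W) (cW : HasCompactSupport W) (sg : Sm g) (su : ∀ i, Sm (u i)) :
    ZI (fun x => W x * ∑ j, pd (fun y => u j y * g y) j x + ∑ j, pd W j x * (u j x * g x)) := by
  have A := ZI.div (F := fun j x => W x * (u j x * g x)) (fun j => sW.mul ((su j).mul sg)) (fun j => cW.mul_right)
  refine A.congr fun x => ?_
  simp only [pd_mul sW ((su _).mul sg), Fin.sum_univ_three]
  ring

lemma div_conv {g : R3 → ℝ} {u : Fin 3 → R3 → ℝ} (sg : Sm g) (su : ∀ i, Sm (u i))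
    (du : ∀ x, ∑ j, pd (u j) j x = 0) (x : R3) : ∑ j, pd (fun y => u j y * g y) j x = ∑ j, u j x * pd g j x := by
  have d := du x
  simp only [pd_mul (su _) sg, Fin.sum_univ_three] at d ⊢
  linear_combination g x * d

structure TN (ν : ℝ) (u v : Fin 3 → R3 → ℝ) (pr θ : R3 → ℝ) : Prop where
  su : ∀ i, Sm (u i)
  sv : ∀ i, Sm (v i)
  sp : Sm pr
  st : Sm θ
  eu : ∀ i x, -(ν * lap (u i) x) + (∑ j, u j x * pd (u i) j x) + pd pr i x + (∑ j, pd (fun y => v j y * v i y) j x) = 0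
  ev : ∀ i x, -(ν * lap (v i) x) + (∑ j, u j x * pd (v i) j x) + pd θ i x + (∑ j, v j x * pd (u i) j x) = 0
  et : ∀ x, -(ν * lap θ x) + (∑ j, u j x * pd θ j x) + (∑ j, pd (v j) j x) = 0
  du : ∀ x, ∑ j, pd (u j) j x = 0

def Gd (u v : Fin 3 → R3 → ℝ) (θ : R3 → ℝ) (x : R3) : ℝ :=
  (∑ i, ∑ j, pd (u i) j x ^ 2) + (∑ i, ∑ j, pd (v i) j x ^ 2) + ∑ j, pd θ j x ^ 2
def Rg (ν : ℝ) (u v : Fin 3 → R3 → ℝ) (θ φ : R3 → ℝ) (w : Fin 3 → R3 → ℝ) (x : R3) : ℝ :=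
  ν / 2 * ((∑ i, u i x ^ 2) + (∑ i, v i x ^ 2) + θ x ^ 2) * lap φ x
  + 1 / 2 * ((∑ i, u i x ^ 2) + (∑ i, v i x ^ 2) + θ x ^ 2) * (∑ j, u j x * pd φ j x)
  + θ x * (∑ j, v j x * pd φ j x) + (∑ i, u i x * v i x) * (∑ j, v j x * pd φ j x)
  - ν * (∑ i, u i x * lap (w i) x) - ∑ i, ∑ j, pd (w i) j x * (u j x * u i x + v j x * v i x)

lemma energy {ν : ℝ} {u v : Fin 3 → R3 → ℝ} {pr θ φ h : R3 → ℝ} {w : Fin 3 → R3 → ℝ} (T : TN ν u v pr θ)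
    (sφ : Sm φ) (cφ : HasCompactSupport φ) (sh : Sm h) (ch : HasCompactSupport h) (sw : ∀ i, Sm (w i))
    (cw : ∀ i, HasCompactSupport (w i)) (hd : ∀ x, lap h x + ∑ i, pd (w i) i x = ∑ i, pd φ i x * u i x) :
    ZI (fun x => ν * (φ x * Gd u v θ x) - Rg ν u v θ φ w x + ∑ i, ∑ j, pd (pd h i) j x * (u j x * u i x + v j x * v i x)) := by
  obtain ⟨su, sv, sp, st, eu, ev, et, du⟩ := T
  set W : Fin 3 → R3 → ℝ := fun i x => pd h i x + w i x with hW
  have sW : ∀ i, Sm (W i) := fun i => (sh.pd i).add (sw i)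
  have cW : ∀ i, HasCompactSupport (W i) := fun i => (cs_pd ch i).add (cw i)
  have lW : ∀ i x, lap (W i) x = lap (pd h i) x + lap (w i) x := fun i x => lap_add (sh.pd i) (sw i) x
  have pW : ∀ i j x, pd (W i) j x = pd (pd h i) j x + pd (w i) j x := fun i j x => pd_add (sh.pd i) (sw i) j x
  have a1 := ZI.sum fun i => z1 sφ cφ (su i)
  have a2 := ZI.sum fun i => z1 sφ cφ (sv i)
  have a3 := z1 sφ cφ st
  have b1 := ZI.sum fun i => z2 sφ cφ (su i) su du
  have b2 := ZI.sum fun i => z2 sφ cφ (sv i) su du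
  have b3 := z2 sφ cφ st su du
  have c := z3 sφ cφ st sv
  have d := ZI.sum fun i => z4 sφ cφ (su i) (sv i) sv
  have e := z5 (v := fun i x => φ x * u i x - W i x) sp (fun i => (sφ.mul (su i)).sub (sW i))
    (fun i => (cφ.mul_right (f' := u i)).sub (cW i)) (fun x => by
      have d := du x
      have k := hd x
      simp only [pd_sub (sφ.mul (su _)) (sW _), pd_mul sφ (su _), pW, lap, Fin.sum_univ_three] at d k ⊢
      linear_combination φ x * d - k)
  have f := ZI.sum fun i => z6 (sW i) (cW i) (su i)
  have g := z6b sh ch su du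
  have k1 := ZI.sum fun i => z7 (sW i) (cW i) (su i) su
  have k2 := ZI.sum fun i => z7 (sW i) (cW i) (sv i) sv
  have all := (((a1.add a2).add a3).cmul ν).add ((((((b1.add b2).add b3).add c).add d).add e).cmul (-1) |>.add
    (((f.add g).cmul (-ν)).add (k1.add k2)))
  refine all.congr fun x => ?_
  simp only [div_conv (su _) su du, lW, pW]
  have E1 : ∑ i, (φ x * u i x - W i x) * (-(ν * lap (u i) x) + (∑ j, u j x * pd (u i) j x) + pd pr i x + (∑ j, pd (fun y => v j y * v i y) j x)) = 0 :=
    Finset.sum_eq_zero fun i _ => by rw [eu i x, mul_zero]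
  have E2 : ∑ i, φ x * v i x * (-(ν * lap (v i) x) + (∑ j, u j x * pd (v i) j x) + pd θ i x + (∑ j, v j x * pd (u i) j x)) = 0 :=
    Finset.sum_eq_zero fun i _ => by rw [ev i x, mul_zero]
  have E3 := et x
  simp only [Gd, Rg, hW, Fin.sum_univ_three] at E1 E2 E3 ⊢
  linear_combination E1 + E2 + φ x * θ x * E3


lemma ann_sub : annulus 1 ⊆ closedBall 0 2 := fun x hx => by
  have := hx.1
  rw [mem_ball_zero_iff] at this
  rw [mem_closedBall_zero_iff]; linarith
lemma ann_int {f : R3 → ℝ} (hf : Continuous f) : IntegrableOn f (annulus 1) :=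
  (hf.continuousOn.integrableOn_compact (isCompact_closedBall 0 2)).mono_set ann_sub
lemma ann_fin : volume (annulus 1) < ⊤ := (measure_mono ann_sub).trans_lt (isCompact_closedBall 0 2).measure_lt_top
lemma ann_memLp {f : R3 → ℝ} (hf : Continuous f) (p : ENNReal) : MemLp f p (volume.restrict (annulus 1)) := by
  obtain ⟨C, hC⟩ := (isCompact_closedBall (0:R3) 2).exists_bound_of_continuousOn hf.continuousOn
  haveI : IsFiniteMeasure (volume.restrict (annulus 1)) := ⟨by rw [Measure.restrict_apply_univ]; exact ann_fin⟩
  refine MemLp.of_bound hf.aestronglyMeasurable C ?_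
  rw [ae_restrict_iff' (ann_meas 1)]
  exact ae_of_all _ fun x hx => hC x (ann_sub hx)
lemma ann_mono {f g : R3 → ℝ} (hf : Continuous f) (hg : Continuous g) (h : ∀ x, f x ≤ g x) :
    ∫ x in annulus 1, f x ≤ ∫ x in annulus 1, g x := integral_mono (ann_int hf) (ann_int hg) h
lemma ann_nn {f : R3 → ℝ} (h : ∀ x, 0 ≤ f x) : 0 ≤ ∫ x in annulus 1, f x := integral_nonneg h
lemma ann_hol {f g : R3 → ℝ} (hf : Continuous f) (hg : Continuous g) (f0 : ∀ x, 0 ≤ f x) (g0 : ∀ x, 0 ≤ g x) {p q : ℝ}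
    (h : p.HolderConjugate q) :
    ∫ x in annulus 1, f x * g x ≤ (∫ x in annulus 1, f x ^ p) ^ (1 / p) * (∫ x in annulus 1, g x ^ q) ^ (1 / q) :=
  integral_mul_le_Lp_mul_Lq_of_nonneg h (ae_of_all _ f0) (ae_of_all _ g0) (ann_memLp hf _) (ann_memLp hg _)

lemma lpS_nn (f : R3 → ℝ) (p : ℝ) (E : Set R3) : 0 ≤ lpS f p E :=
  Real.rpow_nonneg (integral_nonneg fun x => Real.rpow_nonneg (abs_nonneg _) _) _
lemma lpS_pow {f : R3 → ℝ} (f0 : ∀ x, 0 ≤ f x) {p : ℝ} (hp : 0 < p) (E : Set R3) (s : ℝ) :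
    lpS f p E ^ s = (∫ x in E, f x ^ p) ^ (s / p) := by
  unfold lpS
  simp only [abs_of_nonneg (f0 _)]
  rw [← Real.rpow_mul (integral_nonneg fun x => Real.rpow_nonneg (f0 x) _)]
  congr 1; ring

lemma lp_le {s p : ℝ} (hs : 0 < s) (h : s ≤ p) : ∃ K, 0 ≤ K ∧ ∀ f : R3 → ℝ, Continuous f → (∀ x, 0 ≤ f x) →
    ∫ x in annulus 1, f x ^ s ≤ K * lpS f p (annulus 1) ^ s := by
  have hp : 0 < p := hs.trans_le h
  rcases h.eq_or_lt with rfl | h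
  · refine ⟨1, zero_le_one, fun f hf f0 => ?_⟩
    rw [lpS_pow f0 hs, div_self hs.ne', Real.rpow_one, one_mul]
  · have h1 : 1 < p / s := (one_lt_div hs).2 h
    have hc := Real.HolderConjugate.conjExponent h1
    refine ⟨(∫ x in annulus 1, (1:ℝ) ^ (Real.conjExponent (p / s))) ^ (1 / Real.conjExponent (p / s)),
      Real.rpow_nonneg (ann_nn fun _ => by positivity) _, fun f hf f0 => ?_⟩
    have := ann_hol (f := fun x => f x ^ s) (g := fun _ => 1) (hf.rpow_const fun _ => Or.inr hs.le) continuous_const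
      (fun x => Real.rpow_nonneg (f0 x) _) (fun _ => zero_le_one) hc
    simp only [mul_one] at this
    refine this.trans (le_of_eq ?_)
    rw [lpS_pow f0 hp, mul_comm]
    congr 2
    · refine integral_congr_ae (ae_of_all _ fun x => ?_)
      simp only []
      rw [← Real.rpow_mul (f0 x)]; congr 1; field_simp
    · field_simp

lemma lp_nat (n : ℕ) (hn : 0 < n) {p : ℝ} (h : (n:ℝ) ≤ p) : ∃ K, 0 ≤ K ∧ ∀ f : R3 → ℝ, Continuous f → (∀ x, 0 ≤ f x) →
    ∫ x in annulus 1, f x ^ n ≤ K * lpS f p (annulus 1) ^ n := by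
  obtain ⟨K, K0, hK⟩ := lp_le (s := n) (by exact_mod_cast hn) h
  refine ⟨K, K0, fun f hf f0 => ?_⟩
  have := hK f hf f0
  simpa only [Real.rpow_natCast] using this

lemma lp_sq {s q : ℝ} (hs : 1 ≤ s) (h : 2 * s ≤ q) : ∃ K, 0 ≤ K ∧ ∀ f : R3 → ℝ, Continuous f → (∀ x, 0 ≤ f x) →
    (∫ x in annulus 1, (f x ^ 2) ^ s) ^ (1 / s) ≤ K * lpS f q (annulus 1) ^ 2 := by
  obtain ⟨K, K0, hK⟩ := lp_le (s := 2 * s) (by linarith) h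
  refine ⟨K ^ (1 / s), by positivity, fun f hf f0 => ?_⟩
  have h1 : ∀ x, (f x ^ 2) ^ s = f x ^ (2 * s) := fun x => by
    rw [Real.rpow_mul (f0 x), Real.rpow_two]
  simp only [h1]
  have U0 := lpS_nn f q (annulus 1)
  refine (Real.rpow_le_rpow (ann_nn fun x => Real.rpow_nonneg (f0 x) _) (hK f hf f0) (by positivity)).trans (le_of_eq ?_)
  rw [Real.mul_rpow K0 (by positivity), ← Real.rpow_mul U0, ← Real.rpow_two]
  congr 2; field_simp


lemma van {h : R3 → ℝ} (hz : ∀ x, x ∉ Kc → h x = 0) (i : Fin 3) : ∀ x, x ∉ Kc → pd h i x = 0 := fun x hx => by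
  by_contra hne
  have h1 : tsupport h ⊆ Kc := closure_minimal (fun y hy => by
    by_contra hk; exact hy (hz y hk)) Kc_closed
  exact hx (h1 (tsupport_pd h i (subset_tsupport _ hne)))
lemma van_lap {h : R3 → ℝ} (hz : ∀ x, x ∉ Kc → h x = 0) : ∀ x, x ∉ Kc → lap h x = 0 := fun x hx =>
  Finset.sum_eq_zero fun j _ => van (van hz j) j x hx
lemma van_cs {h : R3 → ℝ} (hz : ∀ x, x ∉ Kc → h x = 0) : HasCompactSupport h :=
  cs_of_norm (r := 39 / 20) fun x hx => hz x fun hk => absurd hk.2 (not_le.2 hx)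

lemma chi_ex : ∃ χ : R3 → ℝ, Sm χ ∧ (∀ x, 0 ≤ χ x) ∧ (∀ x, χ x ≤ 1) ∧ (∀ x ∈ Kc, χ x = 1) ∧ (∀ x, x ∉ annulus 1 → χ x = 0) := by
  have sm : ContDiff ℝ (⊤ : ℕ∞) (fun x : R3 => ‖x‖ ^ 2) := contDiff_norm_sq ℝ
  refine ⟨fun x => Real.smoothTransition (50 * (‖x‖ ^ 2 - 1)) * Real.smoothTransition (10 * (4 - ‖x‖ ^ 2)), ?_, ?_, ?_, ?_, ?_⟩
  · exact Sm.mul (Real.smoothTransition.contDiff.comp (contDiff_const.mul (sm.sub contDiff_const)))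
      (Real.smoothTransition.contDiff.comp (contDiff_const.mul (contDiff_const.sub sm)))
  · exact fun x => mul_nonneg (Real.smoothTransition.nonneg _) (Real.smoothTransition.nonneg _)
  · exact fun x => mul_le_one₀ (Real.smoothTransition.le_one _) (Real.smoothTransition.nonneg _) (Real.smoothTransition.le_one _)
  · intro x hx
    have := norm_nonneg x
    have h1 := hx.1
    have h2 := hx.2
    simp only []
    rw [Real.smoothTransition.one_of_one_le, Real.smoothTransition.one_of_one_le, one_mul] <;> nlinarith
  · intro x hx
    have := norm_nonneg x
    simp only []
    by_cases h : ‖x‖ < 2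
    · have : ‖x‖ < 1 := by
        by_contra h1
        exact hx ⟨by rw [mem_ball_zero_iff]; linarith, by rw [mem_ball_zero_iff]; exact h1⟩
      rw [Real.smoothTransition.zero_of_nonpos, zero_mul]; nlinarith
    · rw [mul_comm, Real.smoothTransition.zero_of_nonpos, zero_mul]; nlinarith

lemma ann_bd {f g : R3 → ℝ} (hf : Continuous f) (hg : Continuous g) (h : ∀ x, f x ≤ g x)
    (hz : ∀ x, x ∉ annulus 1 → f x = 0) : ∫ x, f x ≤ ∫ x in annulus 1, g x := by
  rw [← setIntegral_eq_integral_of_forall_compl_eq_zero hz]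
  exact ann_mono hf hg h

lemma czh {p : ℝ} (hp : 3 ≤ p) : ∃ C, 0 ≤ C ∧ ∀ f a h : R3 → ℝ, Sm f → Continuous a → (∀ x, |f x| ≤ a x ^ 2) → Sm h →
    (∀ x, x ∉ Kc → h x = 0) → ∀ i j, |∫ x, f x * pd (pd h i) j x| ≤
      C * ((∫ x in annulus 1, (a x ^ 2) ^ (p / (p - 1))) ^ (1 / (p / (p - 1))) * (∫ x, |lap h x| ^ p) ^ (1 / p)) := by
  obtain ⟨C, C0, hC⟩ := cz (p := p) (by linarith) rfl
  obtain ⟨χ, sχ, χ0, χ1, χK, χz⟩ := chi_ex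
  refine ⟨C, C0, fun f a h sf ca hfa sh hz i j => ?_⟩
  have q0 : 0 < p / (p - 1) := div_pos (by linarith) (by linarith)
  have cA : HasCompactSupport (fun x => χ x * f x) := cs_of_norm (r := 2) fun x hx => by
    rw [χz x fun h => ?_, zero_mul]
    have := ann_sub h
    rw [mem_closedBall_zero_iff] at this; linarith
  have := hC (fun x => χ x * f x) h (sχ.mul sf) cA sh (van_cs hz) i j
  have e : ∫ x, f x * pd (pd h i) j x = ∫ x, χ x * f x * pd (pd h i) j x :=
    integral_congr_ae (ae_of_all _ fun x => by
      simp only []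
      by_cases hx : x ∈ Kc
      · rw [χK x hx, one_mul]
      · rw [van (van hz i) j x hx]; ring)
  rw [e]
  refine this.trans (mul_le_mul_of_nonneg_left (mul_le_mul_of_nonneg_right ?_ (Real.rpow_nonneg (integral_nonneg fun x => by positivity) _)) C0)
  refine Real.rpow_le_rpow (integral_nonneg fun x => by positivity) ?_ (by positivity)
  refine ann_bd ?_ ?_ (fun x => Real.rpow_le_rpow (abs_nonneg _) ?_ q0.le) fun x hx => ?_
  · exact (sχ.mul sf).cont.abs.rpow_const fun _ => Or.inr q0.le
  · exact (ca.pow 2).rpow_const fun _ => Or.inr q0.le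
  · rw [abs_mul, abs_of_nonneg (χ0 x)]
    exact (mul_le_of_le_one_left (abs_nonneg _) (χ1 x)).trans (hfa x)
  · rw [χz x hx]; simp [q0.ne']

lemma laph {p : ℝ} (hp : 3 ≤ p) {L K1 : ℝ} (L0 : 0 ≤ L) (K0 : 0 ≤ K1) : ∃ C, 0 ≤ C ∧ ∀ a h : R3 → ℝ, Continuous a → (∀ x, 0 ≤ a x) → Sm h →
    (∀ x, x ∉ Kc → h x = 0) → (∀ x, |lap h x| ≤ L * (3 * a x + K1 * lpS a p (annulus 1))) →
    (∫ x, |lap h x| ^ p) ^ (1 / p) ≤ C * lpS a p (annulus 1) := by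
  have p0 : 0 < p := by linarith
  set m := ∫ x in annulus 1, (1:ℝ) with hm
  have m0 : 0 ≤ m := ann_nn fun _ => zero_le_one
  refine ⟨((L * 2) ^ p * (3 ^ p + K1 ^ p * m)) ^ (1 / p), by positivity, fun a h ca a0 sh hz hb => ?_⟩
  set U := lpS a p (annulus 1) with hU
  have U0 : 0 ≤ U := lpS_nn _ _ _
  have hUp : U ^ p = ∫ x in annulus 1, a x ^ p := by
    rw [hU, lpS_pow a0 p0, div_self p0.ne', Real.rpow_one]
  have key : ∫ x, |lap h x| ^ p ≤ (L * 2) ^ p * (3 ^ p + K1 ^ p * m) * U ^ p := by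
    have cc : Continuous (fun x => a x ^ p) := ca.rpow_const fun _ => Or.inr p0.le
    have h1 : ∫ x, |lap h x| ^ p ≤ ∫ x in annulus 1, (L * 2) ^ p * (3 ^ p * a x ^ p + K1 ^ p * U ^ p * 1) := by
      refine ann_bd (sh.lap.cont.abs.rpow_const fun _ => Or.inr p0.le) (by fun_prop) (fun x => ?_) fun x hx => ?_
      · have ax := a0 x
        refine (Real.rpow_le_rpow (abs_nonneg _) (hb x) p0.le).trans ?_
        rw [Real.mul_rpow L0 (by positivity), Real.mul_rpow L0 (by positivity), mul_assoc]
        refine mul_le_mul_of_nonneg_left ?_ (by positivity)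
        have X0 : 0 ≤ 3 * a x := by positivity
        have Y0 : 0 ≤ K1 * U := by positivity
        rw [← Real.mul_rpow (by norm_num) ax, ← Real.mul_rpow K0 U0, mul_one]
        generalize 3 * a x = X at *
        generalize K1 * U = Y at *
        have e1 : X + Y ≤ 2 * max X Y := by linarith [le_max_left X Y, le_max_right X Y]
        refine (Real.rpow_le_rpow (by positivity) e1 p0.le).trans ?_
        rw [Real.mul_rpow (by norm_num) (by positivity)]
        refine mul_le_mul_of_nonneg_left ?_ (by positivity)
        have : 0 ≤ X ^ p := by positivity
        have : 0 ≤ Y ^ p := by positivity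
        rcases max_choice X Y with e | e <;> rw [e] <;> linarith
      · rw [van_lap hz x fun hk => hx (Kc_sub hk)]; simp [p0.ne']
    refine h1.trans (le_of_eq ?_)
    rw [integral_const_mul, integral_add (ann_int (by fun_prop)) (ann_int continuous_const), integral_const_mul, integral_const_mul, ← hUp, ← hm]
    ring
  refine (Real.rpow_le_rpow (integral_nonneg fun x => by positivity) key (by positivity)).trans (le_of_eq ?_)
  rw [Real.mul_rpow (by positivity) (by positivity), ← Real.rpow_mul U0, mul_one_div_cancel p0.ne', Real.rpow_one]


lemma le_sq1 {t : ℝ} (h : 0 ≤ t) : t ≤ (t + 1) ^ 2 := by nlinarith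
lemma s3 {f g : Fin 3 → ℝ} {A B : ℝ} (hf : ∀ j, |f j| ≤ A) (hg : ∀ j, |g j| ≤ B) : |∑ j, f j * g j| ≤ 3 * (A * B) := by
  refine (Finset.abs_sum_le_sum_abs _ _).trans ?_
  refine (Finset.sum_le_sum (g := fun _ => A * B) fun j _ => ?_).trans (le_of_eq (by simp))
  rw [abs_mul]
  exact mul_le_mul (hf j) (hg j) (abs_nonneg _) ((abs_nonneg _).trans (hf j))

lemma Rg_bd {ν : ℝ} {u v : Fin 3 → R3 → ℝ} {θ φ : R3 → ℝ} {w : Fin 3 → R3 → ℝ} {x : R3} {a b c L E : ℝ} (ν0 : 0 ≤ ν)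
    (E0 : 0 ≤ E) (hu : ∀ j, |u j x| ≤ a) (hv : ∀ j, |v j x| ≤ b) (ht : |θ x| ≤ c) (p1 : ∀ j, |pd φ j x| ≤ L)
    (p2 : |lap φ x| ≤ L) (w1 : ∀ i j, |pd (w i) j x| ≤ L * E) (w2 : ∀ i, |lap (w i) x| ≤ L * E) :
    |Rg ν u v θ φ w x| ≤ 20 * L * (ν * (a ^ 2 + b ^ 2 + c ^ 2) + (a ^ 3 + a * b ^ 2 + a * c ^ 2 + b * c) + ν * E * a + E * (a ^ 2 + b ^ 2)) := by
  have a0 : 0 ≤ a := (abs_nonneg _).trans (hu 0)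
  have b0 : 0 ≤ b := (abs_nonneg _).trans (hv 0)
  have c0 : 0 ≤ c := (abs_nonneg _).trans ht
  have L0 : 0 ≤ L := (abs_nonneg _).trans p2
  set S := (∑ i, u i x ^ 2) + (∑ i, v i x ^ 2) + θ x ^ 2 with hS
  have S0 : 0 ≤ S := by positivity
  have S1 : |S| ≤ 3 * (a ^ 2 + b ^ 2 + c ^ 2) := by
    rw [abs_of_nonneg S0, hS]
    have h1 : ∀ i, u i x ^ 2 ≤ a ^ 2 := fun i => sq_le_sq' (abs_le.1 (hu i)).1 (abs_le.1 (hu i)).2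
    have h2 : ∀ i, v i x ^ 2 ≤ b ^ 2 := fun i => sq_le_sq' (abs_le.1 (hv i)).1 (abs_le.1 (hv i)).2
    have h3 : θ x ^ 2 ≤ c ^ 2 := sq_le_sq' (abs_le.1 ht).1 (abs_le.1 ht).2
    simp only [Fin.sum_univ_three]
    nlinarith [h1 0, h1 1, h1 2, h2 0, h2 1, h2 2, sq_nonneg c]
  have U1 := s3 hu p1
  have V1 := s3 hv p1
  have UV := s3 hu hv
  have UW := s3 hu w2
  have WW : |∑ i, ∑ j, pd (w i) j x * (u j x * u i x + v j x * v i x)| ≤ 9 * (L * E * (a ^ 2 + b ^ 2)) := by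
    refine (Finset.abs_sum_le_sum_abs _ _).trans ?_
    refine (Finset.sum_le_sum (g := fun _ => 3 * (L * E * (a ^ 2 + b ^ 2))) fun i _ => s3 (w1 i) fun j => ?_).trans (le_of_eq (by simp; ring))
    refine (abs_add_le _ _).trans ?_
    rw [abs_mul, abs_mul, sq, sq]
    exact add_le_add (mul_le_mul (hu j) (hu i) (abs_nonneg _) a0) (mul_le_mul (hv j) (hv i) (abs_nonneg _) b0)
  have T1 : |ν / 2 * S * lap φ x| ≤ ν / 2 * (3 * (a ^ 2 + b ^ 2 + c ^ 2)) * L := by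
    rw [abs_mul, abs_mul, abs_of_nonneg (by positivity : 0 ≤ ν / 2)]; gcongr
  have T2 : |1 / 2 * S * (∑ j, u j x * pd φ j x)| ≤ 1 / 2 * (3 * (a ^ 2 + b ^ 2 + c ^ 2)) * (3 * (a * L)) := by
    rw [abs_mul, abs_mul, abs_of_nonneg (by norm_num : (0:ℝ) ≤ 1 / 2)]; gcongr
  have T3 : |θ x * (∑ j, v j x * pd φ j x)| ≤ c * (3 * (b * L)) := by
    rw [abs_mul]; gcongr
  have T4 : |(∑ i, u i x * v i x) * (∑ j, v j x * pd φ j x)| ≤ (3 * (a * b)) * (3 * (b * L)) := by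
    rw [abs_mul]; gcongr
  have T5 : |ν * (∑ i, u i x * lap (w i) x)| ≤ ν * (3 * (a * (L * E))) := by
    rw [abs_mul, abs_of_nonneg ν0]; gcongr
  unfold Rg
  rw [← hS]
  have P1 : 0 ≤ L * ν * (a ^ 2 + b ^ 2 + c ^ 2) := by positivity
  have P2 : 0 ≤ L * a ^ 3 := by positivity
  have P3 : 0 ≤ L * (a * b ^ 2) := by positivity
  have P4 : 0 ≤ L * (a * c ^ 2) := by positivity
  have P5 : 0 ≤ L * (b * c) := by positivity
  have P6 : 0 ≤ L * (ν * E * a) := by positivity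
  have P7 : 0 ≤ L * (E * (a ^ 2 + b ^ 2)) := by positivity
  refine (abs_sub _ _).trans ?_
  refine (add_le_add_left ((abs_sub _ _).trans (add_le_add_left ((abs_add_le _ _).trans (add_le_add_left ((abs_add_le _ _).trans (add_le_add_left (abs_add_le _ _) _)) _)) _)) _).trans ?_
  linarith

set_option maxHeartbeats 1600000 in
lemma unit_est {p q r : ℝ} (hp : 3 ≤ p) (hq : 2 * (p / (p - 1)) ≤ q) (hr : 2 * (p / (p - 1)) ≤ r) :
    ∃ C, 0 ≤ C ∧ ∀ (ν : ℝ) (u v : Fin 3 → R3 → ℝ) (pr θ a b : R3 → ℝ), 0 < ν → TN ν u v pr θ →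
      Continuous a → Continuous b → (∀ j x, |u j x| ≤ a x) → (∀ j x, |v j x| ≤ b x) →
      ν * ∫ x in ball 0 1, Gd u v θ x ≤ C * (ν * (lpS a p (annulus 1) ^ 2 + lpS b q (annulus 1) ^ 2 + lpS θ r (annulus 1) ^ 2)
        + (lpS a p (annulus 1) ^ 3 + lpS a p (annulus 1) * lpS b q (annulus 1) ^ 2 + lpS a p (annulus 1) * lpS θ r (annulus 1) ^ 2
          + lpS b q (annulus 1) * lpS θ r (annulus 1))) := by
  have p0 : 0 < p := by linarith
  have p1 : 0 < p - 1 := by linarith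
  set s := p / (p - 1) with hs
  have s1 : 1 ≤ s := by rw [hs, le_div_iff₀ p1]; linarith
  have s2 : 2 * s ≤ p := by
    rw [hs, ← mul_div_assoc, div_le_iff₀ p1]; nlinarith
  have hc : p.HolderConjugate s := by
    have := Real.HolderConjugate.conjExponent (p := p) (by linarith)
    exact this
  obtain ⟨φ, sφ, cφ, φ0, φ1, φz, L, L0, HW⟩ := key_hw
  obtain ⟨M1, hM1⟩ : ∃ M, ∀ j x, |pd φ j x| ≤ M := by
    choose m m0 hm using fun j => cs_bdd (sφ.pd j).cont (cs_pd cφ j)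
    obtain ⟨M, hM⟩ := fin_max m
    exact ⟨M, fun j x => (hm j x).trans (hM j)⟩
  obtain ⟨M2, M20, hM2⟩ := cs_bdd sφ.lap.cont (cs_lap cφ)
  obtain ⟨k1, k10, K1⟩ := lp_nat 1 one_pos (p := p) (by push_cast; linarith)
  obtain ⟨k2, k20, K2⟩ := lp_nat 2 two_pos (p := p) (by push_cast; linarith)
  obtain ⟨k3, k30, K3⟩ := lp_nat 3 (by norm_num) (p := p) (by push_cast; linarith)
  obtain ⟨k4, k40, K4⟩ := lp_nat 2 two_pos (p := q) (by push_cast; linarith)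
  obtain ⟨k5, k50, K5⟩ := lp_nat 2 two_pos (p := r) (by push_cast; linarith)
  obtain ⟨k6, k60, K6⟩ := lp_sq s1 s2
  obtain ⟨k7, k70, K7⟩ := lp_sq s1 hq
  obtain ⟨k8, k80, K8⟩ := lp_sq s1 hr
  obtain ⟨C1, C10, HC1⟩ := czh hp
  obtain ⟨C2, C20, HC2⟩ := laph hp L0 (K1 := 3 * k1) (by positivity)
  set Λ := max M1 (max M2 L) with hΛ
  have Λ1 : M1 ≤ Λ := le_max_left _ _
  have Λ2 : M2 ≤ Λ := (le_max_left _ _).trans (le_max_right _ _)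
  have Λ3 : L ≤ Λ := (le_max_right _ _).trans (le_max_right _ _)
  have Λ0 : 0 ≤ Λ := L0.trans Λ3
  set κ := 20 * Λ * (k2 + k4 + k5 + k3 + k7 + k8 + k4 * k5 + 1 + 3 * k1 * k1 + 3 * k1 * (k2 + k4)) + 9 * (C1 * C2 * (k6 + k7)) with hκ
  refine ⟨κ, by positivity, fun ν u v pr θ a b ν0 T ca cb hu hv => ?_⟩
  have a0 : ∀ x, 0 ≤ a x := fun x => (abs_nonneg _).trans (hu 0 x)
  have b0 : ∀ x, 0 ≤ b x := fun x => (abs_nonneg _).trans (hv 0 x)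
  obtain ⟨h, w, sh, sw, hz, wz, hd, wb, wl, hl⟩ := HW u T.su T.du
  set E := ∫ x in annulus 1, ∑ j, |u j x| with hE
  set U := lpS a p (annulus 1) with hU
  set V := lpS b q (annulus 1) with hV
  set c : R3 → ℝ := fun x => |θ x| with hcd
  have cc : Continuous c := T.st.cont.abs
  have c0 : ∀ x, 0 ≤ c x := fun x => abs_nonneg _
  have hΘ : lpS θ r (annulus 1) = lpS c r (annulus 1) := by simp only [lpS, hcd, abs_abs]
  rw [hΘ]
  set Θ := lpS c r (annulus 1) with hΘ'
  have U0 : 0 ≤ U := lpS_nn _ _ _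
  have V0 : 0 ≤ V := lpS_nn _ _ _
  have Θ0 : 0 ≤ Θ := lpS_nn _ _ _
  have E0 : 0 ≤ E := ann_nn fun x => Finset.sum_nonneg fun j _ => abs_nonneg _
  have cu : ∀ i, Continuous (u i) := fun i => (T.su i).cont
  have cv : ∀ i, Continuous (v i) := fun i => (T.sv i).cont
  have sua : ∀ x, ∑ j, |u j x| ≤ 3 * a x := fun x =>
    (Finset.sum_le_sum (g := fun _ => a x) fun j _ => hu j x).trans (le_of_eq (by simp))
  have J1 := K1 a ca a0
  simp only [pow_one] at J1
  have E1 : E ≤ 3 * k1 * U := by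
    have : E ≤ ∫ x in annulus 1, 3 * a x :=
      ann_mono (continuous_finsetSum _ fun j _ => (cu j).abs) (by fun_prop) sua
    rw [integral_const_mul] at this
    linarith
  have Z := energy T sφ cφ sh (van_cs hz) sw (fun i => van_cs (wz i)) hd
  -- the h term
  have Hb := HC2 a h ca a0 sh hz fun x => (hl x).trans (mul_le_mul_of_nonneg_left (add_le_add (sua x) E1) L0)
  have J6 := K6 a ca a0
  have J7 := K7 b cb b0
  have cz1 : ∀ i j, |∫ x, (u j x * u i x) * pd (pd h i) j x| ≤ C1 * ((k6 * U ^ 2) * (C2 * U)) := fun i j => by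
    refine (HC1 (fun x => u j x * u i x) a h ((T.su j).mul (T.su i)) ca (fun x => ?_) sh hz i j).trans ?_
    · rw [abs_mul, sq]; exact mul_le_mul (hu j x) (hu i x) (abs_nonneg _) (a0 x)
    · exact mul_le_mul_of_nonneg_left (mul_le_mul J6 Hb (Real.rpow_nonneg (integral_nonneg fun x => by positivity) _) (by positivity)) C10
  have cz2 : ∀ i j, |∫ x, (v j x * v i x) * pd (pd h i) j x| ≤ C1 * ((k7 * V ^ 2) * (C2 * U)) := fun i j => by
    refine (HC1 (fun x => v j x * v i x) b h ((T.sv j).mul (T.sv i)) cb (fun x => ?_) sh hz i j).trans ?_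
    · rw [abs_mul, sq]; exact mul_le_mul (hv j x) (hv i x) (abs_nonneg _) (b0 x)
    · exact mul_le_mul_of_nonneg_left (mul_le_mul J7 Hb (Real.rpow_nonneg (integral_nonneg fun x => by positivity) _) (by positivity)) C10
  have iu : ∀ i j, Integrable (fun x => (u j x * u i x) * pd (pd h i) j x) := fun i j =>
    cs_int (((T.su j).mul (T.su i)).mul ((sh.pd i).pd j)).cont (cs_pd (cs_pd (van_cs hz) i) j).mul_left
  have iv : ∀ i j, Integrable (fun x => (v j x * v i x) * pd (pd h i) j x) := fun i j =>
    cs_int (((T.sv j).mul (T.sv i)).mul ((sh.pd i).pd j)).cont (cs_pd (cs_pd (van_cs hz) i) j).mul_left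
  have iuv : ∀ i j, Integrable (fun x => (u j x * u i x) * pd (pd h i) j x + (v j x * v i x) * pd (pd h i) j x) := fun i j =>
    (iu i j).add (iv i j)
  have iuvs : ∀ i, Integrable (fun x => ∑ j, ((u j x * u i x) * pd (pd h i) j x + (v j x * v i x) * pd (pd h i) j x)) := fun i =>
    integrable_finsetSum _ fun j _ => iuv i j
  set Hf : R3 → ℝ := fun x => ∑ i, ∑ j, pd (pd h i) j x * (u j x * u i x + v j x * v i x) with hHf
  have Hf' : Hf = fun x => ∑ i, ∑ j, ((u j x * u i x) * pd (pd h i) j x + (v j x * v i x) * pd (pd h i) j x) := by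
    funext x; simp only [hHf]
    exact Finset.sum_congr rfl fun i _ => Finset.sum_congr rfl fun j _ => by ring
  have iH : Integrable Hf := by
    rw [Hf']
    exact integrable_finsetSum _ fun i _ => iuvs i
  have HfB : |∫ x, Hf x| ≤ 9 * (C1 * ((k6 * U ^ 2) * (C2 * U)) + C1 * ((k7 * V ^ 2) * (C2 * U))) := by
    rw [Hf', integral_finsetSum _ fun i _ => iuvs i]
    refine (Finset.abs_sum_le_sum_abs _ _).trans ?_
    refine (Finset.sum_le_sum (g := fun _ => 3 * (C1 * ((k6 * U ^ 2) * (C2 * U)) + C1 * ((k7 * V ^ 2) * (C2 * U)))) fun i _ => ?_).trans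
      (le_of_eq (by simp; ring))
    rw [integral_finsetSum _ fun j _ => iuv i j]
    refine (Finset.abs_sum_le_sum_abs _ _).trans ?_
    refine (Finset.sum_le_sum (g := fun _ => (C1 * ((k6 * U ^ 2) * (C2 * U)) + C1 * ((k7 * V ^ 2) * (C2 * U)))) fun j _ => ?_).trans
      (le_of_eq (by simp; ring))
    rw [integral_add (iu i j) (iv i j)]
    exact (abs_add_le _ _).trans (add_le_add (cz1 i j) (cz2 i j))
  -- the R term
  have cR : Continuous (Rg ν u v θ φ w) := by
    have := T.st.cont
    have := sφ.lap.cont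
    have := fun j => (sφ.pd j).cont
    have := fun i => (sw i).lap.cont
    have := fun i j => ((sw i).pd j).cont
    unfold Rg
    fun_prop
  have Rz : ∀ x, x ∉ Kc → Rg ν u v θ φ w x = 0 := fun x hx => by
    have l0 : lap φ x = 0 := Finset.sum_eq_zero fun j _ => van (φz j) j x hx
    simp only [Rg, l0, φz _ x hx, van (wz _) _ x hx, van_lap (wz _) x hx]
    simp
  have iR : Integrable (Rg ν u v θ φ w) := cs_int cR (van_cs Rz)
  set Bf : R3 → ℝ := fun x => 20 * Λ * (ν * (a x ^ 2 + b x ^ 2 + c x ^ 2) + (a x ^ 3 + a x * b x ^ 2 + a x * c x ^ 2 + b x * c x)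
    + ν * E * a x + E * (a x ^ 2 + b x ^ 2)) with hBf
  have RB : |∫ x, Rg ν u v θ φ w x| ≤ ∫ x in annulus 1, Bf x := by
    refine (abs_integral_le_integral_abs).trans ?_
    refine ann_bd cR.abs (by fun_prop) (fun x => ?_) fun x hx => by rw [Rz x fun hk => hx (Kc_sub hk), abs_zero]
    exact Rg_bd ν0.le E0 (fun j => hu j x) (fun j => hv j x) le_rfl (fun j => (hM1 j x).trans Λ1) ((hM2 x).trans Λ2)
      (fun i j => (wb i j x).trans (mul_le_mul_of_nonneg_right Λ3 E0)) (fun i => (wl i x).trans (mul_le_mul_of_nonneg_right Λ3 E0))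
  have BB : ∫ x in annulus 1, Bf x = 20 * Λ * (ν * ((∫ x in annulus 1, a x ^ 2) + (∫ x in annulus 1, b x ^ 2) + ∫ x in annulus 1, c x ^ 2)
      + ((∫ x in annulus 1, a x ^ 3) + (∫ x in annulus 1, a x * b x ^ 2) + (∫ x in annulus 1, a x * c x ^ 2) + ∫ x in annulus 1, b x * c x)
      + ν * E * (∫ x in annulus 1, a x) + E * ((∫ x in annulus 1, a x ^ 2) + ∫ x in annulus 1, b x ^ 2)) := by
    simp only [hBf]
    rw [integral_const_mul,
      integral_add (f := fun x => ν * (a x ^ 2 + b x ^ 2 + c x ^ 2) + (a x ^ 3 + a x * b x ^ 2 + a x * c x ^ 2 + b x * c x) + ν * E * a x)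
        (g := fun x => E * (a x ^ 2 + b x ^ 2)) (ann_int (by fun_prop)) (ann_int (by fun_prop)),
      integral_add (f := fun x => ν * (a x ^ 2 + b x ^ 2 + c x ^ 2) + (a x ^ 3 + a x * b x ^ 2 + a x * c x ^ 2 + b x * c x))
        (g := fun x => ν * E * a x) (ann_int (by fun_prop)) (ann_int (by fun_prop)),
      integral_add (f := fun x => ν * (a x ^ 2 + b x ^ 2 + c x ^ 2)) (g := fun x => (a x ^ 3 + a x * b x ^ 2 + a x * c x ^ 2 + b x * c x))
        (ann_int (by fun_prop)) (ann_int (by fun_prop)),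
      integral_const_mul, integral_const_mul, integral_const_mul,
      integral_add (f := fun x => a x ^ 2 + b x ^ 2) (g := fun x => c x ^ 2) (ann_int (by fun_prop)) (ann_int (by fun_prop)),
      integral_add (f := fun x => a x ^ 2) (g := fun x => b x ^ 2) (ann_int (by fun_prop)) (ann_int (by fun_prop)),
      integral_add (f := fun x => a x ^ 3 + a x * b x ^ 2 + a x * c x ^ 2) (g := fun x => b x * c x) (ann_int (by fun_prop)) (ann_int (by fun_prop)),
      integral_add (f := fun x => a x ^ 3 + a x * b x ^ 2) (g := fun x => a x * c x ^ 2) (ann_int (by fun_prop)) (ann_int (by fun_prop)),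
      integral_add (f := fun x => a x ^ 3) (g := fun x => a x * b x ^ 2) (ann_int (by fun_prop)) (ann_int (by fun_prop))]
  have J2 := K2 a ca a0
  have J3 := K3 a ca a0
  have J4 := K4 b cb b0
  have J5 := K5 c cc c0
  have J8 := K8 c cc c0
  have Ueq : (∫ x in annulus 1, a x ^ p) ^ (1 / p) = U := by
    simp only [hU, lpS, abs_of_nonneg (a0 _)]
  have ab : ∫ x in annulus 1, a x * b x ^ 2 ≤ U * (k7 * V ^ 2) := by
    refine (ann_hol (g := fun x => b x ^ 2) ca (cb.pow 2) a0 (fun x => sq_nonneg _) hc).trans ?_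
    rw [Ueq]; exact mul_le_mul_of_nonneg_left J7 U0
  have ac : ∫ x in annulus 1, a x * c x ^ 2 ≤ U * (k8 * Θ ^ 2) := by
    refine (ann_hol (g := fun x => c x ^ 2) ca (cc.pow 2) a0 (fun x => sq_nonneg _) hc).trans ?_
    rw [Ueq]; exact mul_le_mul_of_nonneg_left J8 U0
  have bc : ∫ x in annulus 1, b x * c x ≤ (k4 * k5 + 1) * (V * Θ) := by
    have := ann_hol cb cc b0 c0 (p := 2) (q := 2) (by constructor <;> norm_num)
    simp only [Real.rpow_two, ← Real.sqrt_eq_rpow] at this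
    refine this.trans ?_
    have ib0 : 0 ≤ ∫ x in annulus 1, b x ^ 2 := ann_nn fun x => sq_nonneg _
    rw [← Real.sqrt_mul ib0]
    refine Real.sqrt_le_iff.2 ⟨by positivity, ?_⟩
    have ic0 : 0 ≤ ∫ x in annulus 1, c x ^ 2 := ann_nn fun x => sq_nonneg _
    refine (mul_le_mul J4 J5 ic0 (by positivity)).trans ?_
    have e : k4 * V ^ 2 * (k5 * Θ ^ 2) = k4 * k5 * (V * Θ) ^ 2 := by ring
    rw [e, mul_pow (k4 * k5 + 1)]
    refine mul_le_mul_of_nonneg_right ?_ (by positivity)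
    exact le_sq1 (by positivity)
  -- left side
  have cG : Continuous (Gd u v θ) := by
    have := fun i j => ((T.su i).pd j).cont
    have := fun i j => ((T.sv i).pd j).cont
    have := fun j => (T.st.pd j).cont
    unfold Gd
    fun_prop
  have G0 : ∀ x, 0 ≤ Gd u v θ x := fun x => by unfold Gd; positivity
  have iG : Integrable (fun x => φ x * Gd u v θ x) := cs_int (sφ.cont.mul cG) cφ.mul_right
  have Zi : ν * ∫ x, φ x * Gd u v θ x = (∫ x, Rg ν u v θ φ w x) - ∫ x, Hf x := by
    have := Z.2
    rw [integral_add (f := fun x => ν * (φ x * Gd u v θ x) - Rg ν u v θ φ w x) (g := Hf) ((iG.const_mul ν).sub iR) iH,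
      integral_sub (f := fun x => ν * (φ x * Gd u v θ x)) (iG.const_mul ν) iR, integral_const_mul] at this
    linarith
  have LG : ∫ x in ball 0 1, Gd u v θ x ≤ ∫ x, φ x * Gd u v θ x := by
    have : ∫ x in ball 0 1, Gd u v θ x = ∫ x in ball 0 1, φ x * Gd u v θ x :=
      setIntegral_congr_fun measurableSet_ball fun x hx => by
        rw [φ1 x (mem_ball_zero_iff.1 hx).le, one_mul]
    rw [this]
    exact setIntegral_le_integral iG (ae_of_all _ fun x => mul_nonneg (φ0 x) (G0 x))
  refine (mul_le_mul_of_nonneg_left LG ν0.le).trans ?_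
  rw [Zi]
  have F1 := (le_abs_self (∫ x, Rg ν u v θ φ w x)).trans RB
  have F2 := (neg_abs_le (∫ x, Hf x))
  rw [BB] at F1
  have Ia0 : 0 ≤ ∫ x in annulus 1, a x := ann_nn a0
  have R1 : ν * E * (∫ x in annulus 1, a x) ≤ 3 * k1 * k1 * (ν * U ^ 2) := by
    calc _ ≤ ν * (3 * k1 * U) * (k1 * U) := by gcongr
      _ = _ := by ring
  have R2 : E * ((∫ x in annulus 1, a x ^ 2) + ∫ x in annulus 1, b x ^ 2) ≤ 3 * k1 * (k2 + k4) * (U ^ 3 + U * V ^ 2) := by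
    calc _ ≤ (3 * k1 * U) * (k2 * U ^ 2 + k4 * V ^ 2) := by
          refine mul_le_mul E1 (add_le_add J2 J4) (add_nonneg (ann_nn fun x => sq_nonneg _) (ann_nn fun x => sq_nonneg _)) (by positivity)
      _ ≤ (3 * k1 * U) * ((k2 + k4) * (U ^ 2 + V ^ 2)) := by
          refine mul_le_mul_of_nonneg_left ?_ (by positivity)
          linarith [mul_nonneg k20 (sq_nonneg V), mul_nonneg k40 (sq_nonneg U)]
      _ = _ := by ring
  set N := ν * (U ^ 2 + V ^ 2 + Θ ^ 2) + (U ^ 3 + U * V ^ 2 + U * Θ ^ 2 + V * Θ) with hN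
  have n1 : 0 ≤ ν * U ^ 2 := by positivity
  have n2 : 0 ≤ ν * V ^ 2 := by positivity
  have n3 : 0 ≤ ν * Θ ^ 2 := by positivity
  have n4 : 0 ≤ U ^ 3 := by positivity
  have n5 : 0 ≤ U * V ^ 2 := by positivity
  have n6 : 0 ≤ U * Θ ^ 2 := by positivity
  have n7 : 0 ≤ V * Θ := by positivity
  have q1 : ν * ∫ x in annulus 1, a x ^ 2 ≤ k2 * N := by
    calc _ ≤ ν * (k2 * U ^ 2) := by gcongr
      _ = k2 * (ν * U ^ 2) := by ring
      _ ≤ _ := mul_le_mul_of_nonneg_left (by linarith) k20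
  have q2 : ν * ∫ x in annulus 1, b x ^ 2 ≤ k4 * N := by
    calc _ ≤ ν * (k4 * V ^ 2) := by gcongr
      _ = k4 * (ν * V ^ 2) := by ring
      _ ≤ _ := mul_le_mul_of_nonneg_left (by linarith) k40
  have q3 : ν * ∫ x in annulus 1, c x ^ 2 ≤ k5 * N := by
    calc _ ≤ ν * (k5 * Θ ^ 2) := by gcongr
      _ = k5 * (ν * Θ ^ 2) := by ring
      _ ≤ _ := mul_le_mul_of_nonneg_left (by linarith) k50
  have q4 : ∫ x in annulus 1, a x ^ 3 ≤ k3 * N := J3.trans (mul_le_mul_of_nonneg_left (by linarith) k30)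
  have q5 : ∫ x in annulus 1, a x * b x ^ 2 ≤ k7 * N := ab.trans (by
    calc _ = k7 * (U * V ^ 2) := by ring
      _ ≤ _ := mul_le_mul_of_nonneg_left (by linarith) k70)
  have q6 : ∫ x in annulus 1, a x * c x ^ 2 ≤ k8 * N := ac.trans (by
    calc _ = k8 * (U * Θ ^ 2) := by ring
      _ ≤ _ := mul_le_mul_of_nonneg_left (by linarith) k80)
  have q7 : ∫ x in annulus 1, b x * c x ≤ (k4 * k5 + 1) * N := bc.trans (mul_le_mul_of_nonneg_left (by linarith) (by positivity))
  have q8 := R1.trans (mul_le_mul_of_nonneg_left (by linarith : ν * U ^ 2 ≤ N) (by positivity))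
  have q9 := R2.trans (mul_le_mul_of_nonneg_left (by linarith : U ^ 3 + U * V ^ 2 ≤ N) (by positivity))
  have q10 : 9 * (C1 * ((k6 * U ^ 2) * (C2 * U)) + C1 * ((k7 * V ^ 2) * (C2 * U))) ≤ 9 * (C1 * C2 * (k6 + k7)) * N := by
    calc _ = 9 * (C1 * C2 * k6) * U ^ 3 + 9 * (C1 * C2 * k7) * (U * V ^ 2) := by ring
      _ ≤ 9 * (C1 * C2 * k6) * N + 9 * (C1 * C2 * k7) * N :=
          add_le_add (mul_le_mul_of_nonneg_left (by linarith) (by positivity)) (mul_le_mul_of_nonneg_left (by linarith) (by positivity))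
      _ = _ := by ring
  have F3 := F1.trans (mul_le_mul_of_nonneg_left (show _ ≤ (k2 + k4 + k5 + k3 + k7 + k8 + k4 * k5 + 1 + 3 * k1 * k1 + 3 * k1 * (k2 + k4)) * N by linarith) (by positivity))
  rw [hκ]
  linarith


lemma ann_scale {R : ℝ} (hR : 0 < R) (x : R3) : (0 + R • x) ∈ annulus R ↔ x ∈ annulus 1 := by
  simp only [annulus, Set.mem_sdiff, mem_ball_zero_iff, zero_add, norm_smul, Real.norm_eq_abs, abs_of_pos hR, mul_one]
  constructor
  · rintro ⟨h1, h2⟩; constructor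
    · nlinarith
    · intro h; apply h2; nlinarith
  · rintro ⟨h1, h2⟩; constructor
    · nlinarith
    · intro h; apply h2; nlinarith
lemma int_scale {R : ℝ} (hR : 0 < R) {S T : Set R3} (hS : MeasurableSet S) (hT : MeasurableSet T) (h : ∀ x : R3, (0 + R • x) ∈ T ↔ x ∈ S)
    (g : R3 → ℝ) : ∫ x in S, g (0 + R • x) = (R ^ 3)⁻¹ * ∫ x in T, g x := by
  rw [← integral_indicator hS, ← integral_indicator hT, ← int_aff _ 0 hR]
  refine integral_congr_ae (ae_of_all _ fun x => ?_)
  show S.indicator (fun x => g (0 + R • x)) x = T.indicator g (0 + R • x)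
  by_cases hx : x ∈ S
  · rw [Set.indicator_of_mem hx, Set.indicator_of_mem ((h x).2 hx)]
  · rw [Set.indicator_of_notMem hx, Set.indicator_of_notMem fun k => hx ((h x).1 k)]

lemma lpS_scale {R p : ℝ} (hR : 0 < R) (hp : 0 < p) (f : R3 → ℝ) :
    lpS (fun x => f (0 + R • x)) p (annulus 1) = R ^ (-(3 / p)) * lpS f p (annulus R) := by
  unfold lpS
  rw [int_scale hR (ann_meas 1) (ann_meas R) (ann_scale hR) (fun x => |f x| ^ p),
    Real.mul_rpow (by positivity) (integral_nonneg fun x => by positivity)]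
  congr 1
  rw [← Real.rpow_natCast, ← Real.rpow_neg hR.le, ← Real.rpow_mul hR.le]
  congr 1; push_cast; field_simp

lemma lpS_eq {R p α : ℝ} (hR : 0 < R) (hp : 0 < p) (f : R3 → ℝ) :
    lpS (fun x => f (0 + R • x)) p (annulus 1) = R ^ (α - 3 / p) * (R ^ (-α) * lpS f p (annulus R)) := by
  rw [lpS_scale hR hp, ← mul_assoc, ← Real.rpow_add hR]
  congr 2; ring

lemma TN_scale {u v : R3 → R3} {pr θ : R3 → ℝ} (hu : ContDiff ℝ (⊤ : ℕ∞) u) (hv : ContDiff ℝ (⊤ : ℕ∞) v)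
    (hpr : ContDiff ℝ (⊤ : ℕ∞) pr) (hθ : ContDiff ℝ (⊤ : ℕ∞) θ) (hsol : TCM u v pr θ) {R : ℝ} (hR : 0 < R) :
    TN R⁻¹ (fun i x => u (0 + R • x) i) (fun i x => v (0 + R • x) i) (fun x => pr (0 + R • x)) (fun x => θ (0 + R • x)) := by
  have su : ∀ i, Sm (fun y => u y i) := fun i => contDiff_euclidean.1 hu i
  have sv : ∀ i, Sm (fun y => v y i) := fun i => contDiff_euclidean.1 hv i
  obtain ⟨e1, e2, e3, e4⟩ := hsol
  have k := inv_mul_cancel₀ hR.ne'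
  have k' : R⁻¹ * R ^ 2 = R := by rw [sq, ← mul_assoc, k, one_mul]
  have hu' : ∀ i j x, pd (fun x => u (0 + R • x) i) j x = R * pd (fun y => u y i) j (0 + R • x) := fun i j x =>
    pd_aff (fun y => u y i) (su i) 0 R j x
  have hv' : ∀ i j x, pd (fun x => v (0 + R • x) i) j x = R * pd (fun y => v y i) j (0 + R • x) := fun i j x =>
    pd_aff (fun y => v y i) (sv i) 0 R j x
  have lu : ∀ i x, lap (fun x => u (0 + R • x) i) x = R ^ 2 * lap (fun y => u y i) (0 + R • x) := fun i x =>
    lap_aff (su i) R x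
  have lv : ∀ i x, lap (fun x => v (0 + R • x) i) x = R ^ 2 * lap (fun y => v y i) (0 + R • x) := fun i x =>
    lap_aff (sv i) R x
  refine ⟨fun i => sm_aff (su i) 0 R, fun i => sm_aff (sv i) 0 R, sm_aff hpr 0 R, sm_aff hθ 0 R, ?_, ?_, ?_, ?_⟩
  · intro i x
    have hvv : ∀ j, pd (fun x => v (0 + R • x) j * v (0 + R • x) i) j x = R * pd (fun y => v y j * v y i) j (0 + R • x) := fun j =>
      pd_aff (fun y => v y j * v y i) ((sv j).mul (sv i)) 0 R j x
    have := e1 i (0 + R • x)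
    simp only [hu', lu, hvv, pd_aff pr hpr 0 R] 
    rw [← mul_assoc, k']
    simp only [Fin.sum_univ_three] at this ⊢
    linear_combination R * this
  · intro i x
    have := e2 i (0 + R • x)
    simp only [hu', hv', lv, pd_aff θ hθ 0 R] 
    rw [← mul_assoc, k']
    simp only [Fin.sum_univ_three] at this ⊢
    linear_combination R * this
  · intro x
    have := e3 (0 + R • x)
    simp only [hv', lap_aff hθ, pd_aff θ hθ 0 R] 
    rw [← mul_assoc, k']
    simp only [Fin.sum_univ_three] at this ⊢
    linear_combination R * this
  · intro x
    have := e4 (0 + R • x)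
    simp only [hu']
    rw [← Finset.mul_sum, this, mul_zero]

lemma Gd_scale {u v : R3 → R3} {θ : R3 → ℝ} (hu : ContDiff ℝ (⊤ : ℕ∞) u) (hv : ContDiff ℝ (⊤ : ℕ∞) v)
    (hθ : ContDiff ℝ (⊤ : ℕ∞) θ) (R : ℝ) (x : R3) :
    Gd (fun i x => u (0 + R • x) i) (fun i x => v (0 + R • x) i) (fun x => θ (0 + R • x)) x =
      R ^ 2 * Gd (fun i x => u x i) (fun i x => v x i) θ (0 + R • x) := by
  have su : ∀ i, Sm (fun y => u y i) := fun i => contDiff_euclidean.1 hu i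
  have sv : ∀ i, Sm (fun y => v y i) := fun i => contDiff_euclidean.1 hv i
  have hu' : ∀ i j x, pd (fun x => u (0 + R • x) i) j x = R * pd (fun y => u y i) j (0 + R • x) := fun i j x =>
    pd_aff (fun y => u y i) (su i) 0 R j x
  have hv' : ∀ i j x, pd (fun x => v (0 + R • x) i) j x = R * pd (fun y => v y i) j (0 + R • x) := fun i j x =>
    pd_aff (fun y => v y i) (sv i) 0 R j x
  simp only [Gd, hu', hv', pd_aff θ hθ 0 R, mul_pow, ← Finset.mul_sum]
  ring

lemma t0 {Rs s : ℕ → ℝ} (hR : Tendsto Rs atTop atTop) {e : ℝ} (he : e ≤ 0) (hs : Tendsto s atTop (nhds 0)) :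
    Tendsto (fun j => Rs j ^ e * s j) atTop (nhds 0) := by
  refine squeeze_zero_norm' ?_ (tendsto_zero_iff_norm_tendsto_zero.1 hs)
  filter_upwards [hR.eventually_ge_atTop 1] with j hj
  rw [norm_mul]
  refine mul_le_of_le_one_left (norm_nonneg _) ?_
  rw [Real.norm_eq_abs, abs_of_nonneg (by positivity)]
  exact Real.rpow_le_one_of_one_le_of_nonpos hj he
lemma t1 {Rs s : ℕ → ℝ} (hR : Tendsto Rs atTop atTop) {e L : ℝ} (he : e < 0) (hs : Tendsto s atTop (nhds L)) :
    Tendsto (fun j => Rs j ^ e * s j) atTop (nhds 0) := by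
  have h := (tendsto_rpow_neg_atTop (y := -e) (by linarith)).comp hR
  have := h.mul hs
  rw [zero_mul] at this
  simpa only [Function.comp, neg_neg] using this
lemma t2 {Rs : ℕ → ℝ} (hR : Tendsto Rs atTop atTop) {e L k : ℝ} (he : 0 < e) (k0 : 0 ≤ k)
    (hs : Tendsto (fun j => Rs j ^ e * k) atTop (nhds L)) : k = 0 := by
  rcases k0.eq_or_lt with h | h
  · exact h.symm
  · exact absurd hs (not_tendsto_nhds_of_tendsto_atTop (((tendsto_rpow_atTop he).comp hR).atTop_mul_const h) L)

lemma ann_pos : 0 < ∫ _ in annulus 1, (1:ℝ) := by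
  have : 0 < volume (annulus 1) := by
    refine lt_of_lt_of_le (measure_ball_pos volume (EuclideanSpace.single 0 (3 / 2) : R3) (by norm_num : (0:ℝ) < 1 / 4)) (measure_mono fun x hx => ?_)
    rw [mem_ball, dist_eq_norm] at hx
    have n : ‖(EuclideanSpace.single 0 (3 / 2) : R3)‖ = 3 / 2 := by simp
    have h1 := norm_sub_norm_le x (EuclideanSpace.single 0 (3 / 2) : R3)
    have h2 := norm_sub_norm_le (EuclideanSpace.single 0 (3 / 2) : R3) x
    rw [norm_sub_rev] at h2
    rw [n] at h1 h2
    simp only [annulus, Set.mem_sdiff, mem_ball_zero_iff]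
    constructor <;> linarith
  simp only [integral_const, smul_eq_mul, mul_one, Measure.real, Measure.restrict_apply_univ]
  exact ENNReal.toReal_pos this.ne' ann_fin.ne

lemma const_zero {Rs : ℕ → ℝ} (hR : Tendsto Rs atTop atTop) {α p L c : ℝ} (hp : 0 < p) (h : α < 3 / p) {f : R3 → ℝ}
    (hf : ∀ x, f x = c) (hX : Tendsto (fun j => Rs j ^ (-α) * lpS f p (annulus (Rs j))) atTop (nhds L)) : c = 0 := by
  have e : ∀ R, 0 < R → R ^ (-α) * lpS f p (annulus R) = R ^ (3 / p - α) * lpS f p (annulus 1) := fun R hR => by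
    have h1 := lpS_eq (α := α) hR hp f
    have h2 : (fun x => f (0 + R • x)) = f := funext fun x => by rw [hf, hf]
    rw [h2] at h1
    rw [h1, ← mul_assoc, ← Real.rpow_add hR]; simp
  have k := t2 hR (by linarith : 0 < 3 / p - α) (lpS_nn f p (annulus 1)) (hX.congr' (by
    filter_upwards [hR.eventually_gt_atTop 0] with j hj using e _ hj))
  simp only [lpS, hf] at k
  have h3 : ∫ x in annulus 1, |c| ^ p = |c| ^ p * ∫ _ in annulus 1, (1:ℝ) := by rw [← integral_const_mul]; simp
  rw [h3, Real.rpow_eq_zero (mul_nonneg (by positivity) ann_pos.le) (by positivity)] at k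
  rcases mul_eq_zero.1 k with k | k
  · exact abs_eq_zero.1 ((Real.rpow_eq_zero (abs_nonneg _) hp.ne').1 k)
  · exact absurd k ann_pos.ne'

lemma const_of_pd {f : R3 → ℝ} (sf : Sm f) (h : ∀ j x, pd f j x = 0) (x : R3) : f x = f 0 := by
  refine is_const_of_fderiv_eq_zero sf.diff (fun y => ?_) x 0
  ext z
  rw [fderiv_eq_sum]
  simp [h]


lemma Gd_nn (u v : Fin 3 → R3 → ℝ) (θ : R3 → ℝ) (x : R3) : 0 ≤ Gd u v θ x := by
  unfold Gd; positivity
lemma Gd_cont {u v : Fin 3 → R3 → ℝ} {θ : R3 → ℝ} (su : ∀ i, Sm (u i)) (sv : ∀ i, Sm (v i)) (sθ : Sm θ) :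
    Continuous (Gd u v θ) := by
  have a : ∀ i j, Continuous (pd (u i) j) := fun i j => ((su i).pd j).cont
  have b : ∀ i j, Continuous (pd (v i) j) := fun i j => ((sv i).pd j).cont
  have c : ∀ j, Continuous (pd θ j) := fun j => (sθ.pd j).cont
  unfold Gd; fun_prop
lemma Gd_zero {u v : Fin 3 → R3 → ℝ} {θ : R3 → ℝ} {x : R3} (h : Gd u v θ x = 0) :
    (∀ i j, pd (u i) j x = 0) ∧ (∀ i j, pd (v i) j x = 0) ∧ ∀ j, pd θ j x = 0 := by
  have key : ∀ (i j : Fin 3), pd (u i) j x ^ 2 ≤ 0 ∧ pd (v i) j x ^ 2 ≤ 0 ∧ pd θ j x ^ 2 ≤ 0 := by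
    intro i j
    have e1 : pd (u i) j x ^ 2 ≤ ∑ i, ∑ j, pd (u i) j x ^ 2 :=
      (Finset.single_le_sum (f := fun j => pd (u i) j x ^ 2) (fun _ _ => sq_nonneg _) (Finset.mem_univ j)).trans
        (Finset.single_le_sum (f := fun i => ∑ j, pd (u i) j x ^ 2) (fun _ _ => by positivity) (Finset.mem_univ i))
    have e2 : pd (v i) j x ^ 2 ≤ ∑ i, ∑ j, pd (v i) j x ^ 2 :=
      (Finset.single_le_sum (f := fun j => pd (v i) j x ^ 2) (fun _ _ => sq_nonneg _) (Finset.mem_univ j)).trans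
        (Finset.single_le_sum (f := fun i => ∑ j, pd (v i) j x ^ 2) (fun _ _ => by positivity) (Finset.mem_univ i))
    have e3 : pd θ j x ^ 2 ≤ ∑ j, pd θ j x ^ 2 :=
      Finset.single_le_sum (f := fun j => pd θ j x ^ 2) (fun _ _ => sq_nonneg _) (Finset.mem_univ j)
    have p1 : 0 ≤ ∑ i, ∑ j, pd (u i) j x ^ 2 := by positivity
    have p2 : 0 ≤ ∑ i, ∑ j, pd (v i) j x ^ 2 := by positivity
    have p3 : 0 ≤ ∑ j, pd θ j x ^ 2 := by positivity
    have h' : ∑ i, ∑ j, pd (u i) j x ^ 2 + ∑ i, ∑ j, pd (v i) j x ^ 2 + ∑ j, pd θ j x ^ 2 = 0 := by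
      rw [← h]; simp only [Gd]
    refine ⟨?_, ?_, ?_⟩ <;> linarith
  exact ⟨fun i j => pow_eq_zero_iff two_ne_zero |>.1 (le_antisymm (key i j).1 (sq_nonneg _)),
    fun i j => pow_eq_zero_iff two_ne_zero |>.1 (le_antisymm (key i j).2.1 (sq_nonneg _)),
    fun j => pow_eq_zero_iff two_ne_zero |>.1 (le_antisymm (key 0 j).2.2 (sq_nonneg _))⟩

lemma zero_of_int {g : R3 → ℝ} (hg : Continuous g) (h0 : ∀ x, 0 ≤ g x) {ρ : ℝ} (h : ∫ x in ball 0 ρ, g x ≤ 0)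
    {x : R3} (hx : x ∈ ball 0 ρ) : g x = 0 := by
  have hi : IntegrableOn g (ball 0 ρ) := (hg.continuousOn.integrableOn_compact (isCompact_closedBall 0 ρ)).mono_set ball_subset_closedBall
  have h1 := le_antisymm h (integral_nonneg h0)
  rw [integral_eq_zero_iff_of_nonneg h0 hi] at h1
  exact Measure.eqOn_open_of_ae_eq h1 isOpen_ball hg.continuousOn continuousOn_const hx

lemma pw2 {R : ℝ} (hR : 0 < R) (n : ℕ) (a b x y : ℝ) : R ^ n * ((R ^ a * x) * (R ^ b * y)) = R ^ (n + a + b) * (x * y) := by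
  rw [Real.rpow_add hR, Real.rpow_add hR, Real.rpow_natCast]; ring
lemma pw3 {R : ℝ} (hR : 0 < R) (n : ℕ) (a b c x y z : ℝ) :
    R ^ n * ((R ^ a * x) * (R ^ b * y) * (R ^ c * z)) = R ^ (n + a + b + c) * (x * y * z) := by
  rw [Real.rpow_add hR, Real.rpow_add hR, Real.rpow_add hR, Real.rpow_natCast]; ring

theorem liouville_tcm_A9 (u v : R3 → R3) (pr θ : R3 → ℝ)
    (hu : ContDiff ℝ (⊤ : ℕ∞) u) (hv : ContDiff ℝ (⊤ : ℕ∞) v)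
    (hpr : ContDiff ℝ (⊤ : ℕ∞) pr) (hθ : ContDiff ℝ (⊤ : ℕ∞) θ)
    (hsol : TCM u v pr θ)
    (p q r α β γ : ℝ)
    (hp1 : 3 ≤ p) (hp2 : p ≤ 9 / 2)
    (hq1 : 2 * (p / (p - 1)) ≤ q) (hq2 : q ≤ 6)
    (hr1 : 2 * (p / (p - 1)) ≤ r) (hr2 : r ≤ 6)
    (hα1 : 0 ≤ α) (hα2 : α ≤ 3 / p - 2 / 3)
    (hβ1 : 0 ≤ β) (hβ2 : β ≤ 3 / q - 1 / 2)
    (hγ1 : 0 ≤ γ) (hγ2 : γ ≤ 3 / r - 1 / 2)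
    (hc1 : α + 2 * β ≤ 3 / p + 6 / q - 2)
    (hc2 : α + 2 * γ ≤ 3 / p + 6 / r - 2)
    (hc3 : β + γ < 3 / q + 3 / r - 2)
    (Rs : ℕ → ℝ) (hRs : Tendsto Rs atTop atTop)
    (hX : Tendsto (fun j => XnV u α p (Rs j)) atTop (nhds 0))
    (hY : ∃ L : ℝ, Tendsto (fun j => XnV v β q (Rs j)) atTop (nhds L))
    (hZ : ∃ L : ℝ, Tendsto (fun j => XnS θ γ r (Rs j)) atTop (nhds L)) :
    (∀ x, u x = 0) ∧ (∀ x, v x = 0) ∧ (∀ x, θ x = 0) := by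
  have su : ∀ i, Sm (fun y => u y i) := fun i => contDiff_euclidean.1 hu i
  have sv : ∀ i, Sm (fun y => v y i) := fun i => contDiff_euclidean.1 hv i
  obtain ⟨LY, hY⟩ := hY
  obtain ⟨LZ, hZ⟩ := hZ
  have p0 : 0 < p := by linarith
  have pp : 2 < 2 * (p / (p - 1)) := by
    have : 1 < p / (p - 1) := by rw [one_lt_div (by linarith)]; linarith
    linarith
  have q0 : 0 < q := by linarith
  have r0 : 0 < r := by linarith
  have q3 : 3 / q < 3 / 2 := div_lt_div_of_pos_left (by norm_num) (by norm_num) (by linarith)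
  have r3 : 3 / r < 3 / 2 := div_lt_div_of_pos_left (by norm_num) (by norm_num) (by linarith)
  have q6 : 6 / q = 2 * (3 / q) := by ring
  have r6 : 6 / r = 2 * (3 / r) := by ring
  rw [q6] at hc1
  rw [r6] at hc2
  obtain ⟨C, C0, hC⟩ := unit_est hp1 hq1 hr1
  set G : R3 → ℝ := Gd (fun i x => u x i) (fun i x => v x i) θ with hG
  have gc : Continuous G := Gd_cont su sv hθ
  have g0 : ∀ x, 0 ≤ G x := Gd_nn _ _ _
  set X : ℕ → ℝ := fun j => XnV u α p (Rs j) with hXd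
  set Y : ℕ → ℝ := fun j => XnV v β q (Rs j) with hYd
  set Z : ℕ → ℝ := fun j => XnS θ γ r (Rs j) with hZd
  set B : ℕ → ℝ := fun j => C * (
      Rs j ^ (((1:ℕ):ℝ) + (α - 3 / p) + (α - 3 / p)) * (X j * X j) + Rs j ^ (((1:ℕ):ℝ) + (β - 3 / q) + (β - 3 / q)) * (Y j * Y j)
      + Rs j ^ (((1:ℕ):ℝ) + (γ - 3 / r) + (γ - 3 / r)) * (Z j * Z j)
      + Rs j ^ (((2:ℕ):ℝ) + (α - 3 / p) + (α - 3 / p) + (α - 3 / p)) * (X j * X j * X j)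
      + Rs j ^ (((2:ℕ):ℝ) + (α - 3 / p) + (β - 3 / q) + (β - 3 / q)) * (X j * Y j * Y j)
      + Rs j ^ (((2:ℕ):ℝ) + (α - 3 / p) + (γ - 3 / r) + (γ - 3 / r)) * (X j * Z j * Z j)
      + Rs j ^ (((2:ℕ):ℝ) + (β - 3 / q) + (γ - 3 / r)) * (Y j * Z j)) with hB
  have hB0 : Tendsto B atTop (nhds 0) := by
    have a1 := t0 (e := ((1:ℕ):ℝ) + (α - 3 / p) + (α - 3 / p)) hRs (by push_cast; linarith) (by simpa using hX.mul hX)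
    have a2 := t1 (e := ((1:ℕ):ℝ) + (β - 3 / q) + (β - 3 / q)) hRs (by push_cast; linarith) (hY.mul hY)
    have a3 := t1 (e := ((1:ℕ):ℝ) + (γ - 3 / r) + (γ - 3 / r)) hRs (by push_cast; linarith) (hZ.mul hZ)
    have a4 := t0 (e := ((2:ℕ):ℝ) + (α - 3 / p) + (α - 3 / p) + (α - 3 / p)) hRs (by push_cast; linarith)
      (by simpa using (hX.mul hX).mul hX)
    have a5 := t0 (e := ((2:ℕ):ℝ) + (α - 3 / p) + (β - 3 / q) + (β - 3 / q)) hRs (by push_cast; linarith)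
      (by simpa using (hX.mul hY).mul hY)
    have a6 := t0 (e := ((2:ℕ):ℝ) + (α - 3 / p) + (γ - 3 / r) + (γ - 3 / r)) hRs (by push_cast; linarith)
      (by simpa using (hX.mul hZ).mul hZ)
    have a7 := t1 (e := ((2:ℕ):ℝ) + (β - 3 / q) + (γ - 3 / r)) hRs (by push_cast; linarith) (hY.mul hZ)
    have := ((((((a1.add a2).add a3).add a4).add a5).add a6).add a7).const_mul C
    simpa only [add_zero, mul_zero] using this
  have main : ∀ j, 0 < Rs j → ∫ x in ball 0 (Rs j), G x ≤ B j := by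
    intro j hR
    have h := hC (Rs j)⁻¹ _ _ _ _ (fun x => ‖u (0 + Rs j • x)‖) (fun x => ‖v (0 + Rs j • x)‖) (inv_pos.2 hR)
      (TN_scale hu hv hpr hθ hsol hR) (hu.continuous.comp (by fun_prop)).norm (hv.continuous.comp (by fun_prop)).norm
      (fun i x => coord_le _ i) (fun i x => coord_le _ i)
    simp only [Gd_scale hu hv hθ] at h
    rw [lpS_eq (α := α) hR p0 (fun x => ‖u x‖), lpS_eq (α := β) hR q0 (fun x => ‖v x‖), lpS_eq (α := γ) hR r0 θ,
      integral_const_mul, int_scale hR measurableSet_ball measurableSet_ball (T := ball 0 (Rs j)) (fun x => by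
        simp only [mem_ball_zero_iff, zero_add, norm_smul, Real.norm_eq_abs, abs_of_pos hR]
        constructor <;> intro h <;> nlinarith) G] at h
    change _ ≤ C * ((Rs j)⁻¹ * ((Rs j ^ (α - 3 / p) * X j) ^ 2 + (Rs j ^ (β - 3 / q) * Y j) ^ 2 + (Rs j ^ (γ - 3 / r) * Z j) ^ 2)
      + ((Rs j ^ (α - 3 / p) * X j) ^ 3 + (Rs j ^ (α - 3 / p) * X j) * (Rs j ^ (β - 3 / q) * Y j) ^ 2
        + (Rs j ^ (α - 3 / p) * X j) * (Rs j ^ (γ - 3 / r) * Z j) ^ 2 + (Rs j ^ (β - 3 / q) * Y j) * (Rs j ^ (γ - 3 / r) * Z j))) at h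
    simp only [hB, ← pw2 hR, ← pw3 hR]
    have h2 := mul_le_mul_of_nonneg_left h (sq_nonneg (Rs j))
    have hne := hR.ne'
    refine le_trans (le_of_eq ?_) (h2.trans (le_of_eq ?_))
    · field_simp
    · field_simp
      ring
  have hz : ∀ x, G x = 0 := by
    intro x
    refine zero_of_int gc g0 (ρ := ‖x‖ + 1) ?_ (by simp)
    refine ge_of_tendsto hB0 ?_
    filter_upwards [hRs.eventually_gt_atTop 0, hRs.eventually_ge_atTop (‖x‖ + 1)] with j h1 h2
    refine le_trans (setIntegral_mono_set ?_ (ae_of_all _ g0) (LE.le.eventuallyLE (ball_subset_ball h2))) (main j h1)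
    exact (gc.continuousOn.integrableOn_compact (isCompact_closedBall 0 (Rs j))).mono_set ball_subset_closedBall
  have uc : ∀ x, u x = u 0 := fun x => by
    ext i; exact const_of_pd (su i) (fun j y => (Gd_zero (hz y)).1 i j) x
  have vc : ∀ x, v x = v 0 := fun x => by
    ext i; exact const_of_pd (sv i) (fun j y => (Gd_zero (hz y)).2.1 i j) x
  have θc : ∀ x, θ x = θ 0 := const_of_pd hθ (fun j y => (Gd_zero (hz y)).2.2 j)
  have u0 : ‖u 0‖ = 0 := const_zero hRs p0 (by linarith : α < 3 / p) (f := fun x => ‖u x‖) (fun x => by rw [uc]) hX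
  have v0 : ‖v 0‖ = 0 := const_zero hRs q0 (by linarith : β < 3 / q) (f := fun x => ‖v x‖) (fun x => by rw [vc]) hY
  have θ0 : θ 0 = 0 := const_zero hRs r0 (by linarith : γ < 3 / r) θc hZ
  exact ⟨fun x => by rw [uc, norm_eq_zero.1 u0], fun x => by rw [vc, norm_eq_zero.1 v0], fun x => by rw [θc, θ0]⟩
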